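/- arXiv:2205.00802 — 2 statements merged into one kernel-verified Lean document; each statement's English description precedes it below -/
import Mathlib

section
/- There exists a bounded measurable function u : ℝ → ℝ which is 2π-periodic, even, and not almost everywhere zero, such that (i) for almost every x ∈ ℝ, (1/2)·u(x)² = −(1/π)·∫_{−π}^{π} (log|sin((x−y)/2)| − log|sin(y/2)|)·u(y) dy, and (ii) there exist constants C > 0 and r ∈ (0,1) such that |u(x) + (1/π)·|x|·log|x|| ≤ C·|x|·√(log(1/|x|)) for all x with 0 < |x| < r. (Consequently, for every wave speed c ∈ ℝ, φ(x) = c − u(x) is a 2π-periodic highest cusped traveling wave of the Burgers–Hilbert equation with φ(x) = c + (1/π)|x|log|x| + O(|x|√(log(1/|x|))) as x → 0.) -/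
open MeasureTheory Set

theorem det_one_add_smul_eq_sum {E : Type*} [NormedAddCommGroup E] [NormedSpace ℝ E]
    [FiniteDimensional ℝ E] (v : ℕ → ℝ) (hv : Function.Injective v) (c : ℝ) (A : E →L[ℝ] E) :
    (1 + c • A).det = ∑ i ∈ Finset.range (Module.finrank ℝ E + 1),
      (Lagrange.basis (Finset.range (Module.finrank ℝ E + 1)) v i).eval c * (1 + v i • A).det := by
  classical
  let b := Module.finBasis ℝ E
  let M := LinearMap.toMatrix b b (A : E →ₗ[ℝ] E)
  let P : Polynomial ℝ := Matrix.det ((Polynomial.X : Polynomial ℝ) • M.map Polynomial.C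
    + (1 : Matrix _ _ ℝ).map Polynomial.C)
  have hP : ∀ t : ℝ, P.eval t = (1 + t • A).det := by
    intro t
    have h1 : (1 + t • A).det = Matrix.det (t • M + 1) := by
      rw [ContinuousLinearMap.det, ← LinearMap.det_toMatrix b]
      congr 1
      have : (((1 + t • A : E →L[ℝ] E)) : E →ₗ[ℝ] E) = 1 + t • (A : E →ₗ[ℝ] E) := rfl
      rw [this, map_add, map_smul, LinearMap.toMatrix_one, add_comm]
    rw [h1]
    simp only [P]
    rw [← Polynomial.coe_evalRingHom, RingHom.map_det]
    congr 1
    ext i j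
    simp only [RingHom.mapMatrix_apply, Matrix.add_apply, Matrix.smul_apply, Matrix.map_apply,
      smul_eq_mul, Polynomial.coe_evalRingHom, Polynomial.eval_add, Polynomial.eval_mul,
      Polynomial.eval_X, Polynomial.eval_C]
  have hdeg : P.degree < (Finset.range (Module.finrank ℝ E + 1)).card := by
    refine lt_of_le_of_lt Polynomial.degree_le_natDegree ?_
    have := Polynomial.natDegree_det_X_add_C_le M 1
    simp only [Fintype.card_fin] at this
    rw [Finset.card_range]
    exact_mod_cast Nat.lt_succ_of_le this
  have := Lagrange.eq_interpolate (s := Finset.range (Module.finrank ℝ E + 1)) (v := v)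
    hv.injOn hdeg
  have h2 := congrArg (Polynomial.eval c) this
  rw [hP, Lagrange.interpolate_apply, Polynomial.eval_finsetSum] at h2
  rw [h2]
  refine Finset.sum_congr rfl fun i _ => ?_
  rw [Polynomial.eval_mul, Polynomial.eval_C, hP, mul_comm]

theorem det_one_add_pos {E : Type*} [NormedAddCommGroup E] [NormedSpace ℝ E]
    [FiniteDimensional ℝ E] (A : E →L[ℝ] E) (hA : ‖A‖ < 1) : 0 < (1 + A).det := by
  have hc : Continuous fun s : ℝ => (1 + s • A).det :=
    ContinuousLinearMap.continuous_det.comp (by fun_prop)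
  have hne : ∀ s ∈ Icc (0 : ℝ) 1, (1 + s • A).det ≠ 0 := by
    intro s hs h0
    have := LinearMap.bot_lt_ker_of_det_eq_zero (f := ((1 + s • A : E →L[ℝ] E) : E →ₗ[ℝ] E)) h0
    obtain ⟨v, hv, hv0⟩ := (Submodule.ne_bot_iff _).1 this.ne'
    have h1 : v + s • A v = 0 := by simpa using hv
    have h2 : ‖v‖ = ‖s • A v‖ := by
      rw [← norm_neg (s • A v), ← eq_neg_of_add_eq_zero_left h1]
    rw [norm_smul, Real.norm_of_nonneg hs.1] at h2
    have h3 : s * ‖A v‖ ≤ ‖A v‖ := mul_le_of_le_one_left (norm_nonneg _) hs.2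
    have h4 := A.le_opNorm v
    have h5 : 0 < ‖v‖ := norm_pos_iff.2 hv0
    nlinarith
  by_contra hneg
  push Not at hneg
  obtain ⟨s, hs, h0⟩ := intermediate_value_Icc' (zero_le_one' ℝ) hc.continuousOn
    (show (0 : ℝ) ∈ Icc _ _ from ⟨by simpa using hneg, by simp [ContinuousLinearMap.det]⟩)
  exact hne s hs h0

open Metric in
theorem no_retraction_of_contDiffAt {E : Type*} [NormedAddCommGroup E] [InnerProductSpace ℝ E]
    [FiniteDimensional ℝ E] (r : E → E) (hr : ∀ x ∈ closedBall (0 : E) 1, ContDiffAt ℝ 1 r x)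
    (hn : ∀ x ∈ closedBall (0 : E) 1, ‖r x‖ = 1) (hid : ∀ x ∈ sphere (0 : E) 1, r x = x) :
    False := by
  classical
  borelize E
  let h : E → E := fun x => r x - x
  let D : E → E →L[ℝ] E := fun x => fderiv ℝ h x
  have hh : ∀ x ∈ closedBall (0 : E) 1, ContDiffAt ℝ 1 h x := fun x hx =>
    (hr x hx).sub contDiffAt_id
  have hd : ∀ x ∈ closedBall (0 : E) 1, HasFDerivAt h (D x) x := fun x hx =>
    ((hh x hx).differentiableAt one_ne_zero).hasFDerivAt
  have hDc : ContinuousOn D (closedBall 0 1) := fun x hx =>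
    ((hh x hx).fderiv_right (m := 0) (by simp)).continuousAt.continuousWithinAt
  obtain ⟨C₀, hC₀⟩ := (isCompact_closedBall (0 : E) 1).exists_bound_of_continuousOn hDc
  let C : ℝ := max C₀ 1
  have hC1 : 1 ≤ C := le_max_right _ _
  have hC : ∀ x ∈ closedBall (0 : E) 1, ‖D x‖ ≤ C := fun x hx => (hC₀ x hx).trans (le_max_left _ _)
  have hlip : ∀ x ∈ closedBall (0 : E) 1, ∀ y ∈ closedBall (0 : E) 1, ‖h y - h x‖ ≤ C * ‖y - x‖ :=
    fun x hx y hy => (convex_closedBall (0 : E) 1).norm_image_sub_le_of_norm_hasFDerivWithin_le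
      (fun z hz => (hd z hz).hasFDerivWithinAt) hC hx hy
  let H : E → E := fun x => if x ∈ closedBall (0 : E) 1 then h x else 0
  have hHin : ∀ x ∈ closedBall (0 : E) 1, H x = h x := fun x hx => if_pos hx
  have hHout : ∀ x, x ∉ ball (0 : E) 1 → H x = 0 := by
    intro x hx
    by_cases hx' : x ∈ closedBall (0 : E) 1
    · have : x ∈ sphere (0 : E) 1 := by
        simp only [mem_ball_zero_iff, mem_closedBall_zero_iff, mem_sphere_zero_iff_norm] at *
        linarith
      rw [hHin x hx']
      simp [h, hid x this]
    · exact if_neg hx'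
  have hmix : ∀ x ∈ closedBall (0 : E) 1, ∀ y ∉ closedBall (0 : E) 1, ‖h x‖ ≤ C * ‖x - y‖ := by
    intro x hx y hy
    have hcont : ContinuousOn (fun s : ℝ => ‖x + s • (y - x)‖) (Icc 0 1) := by fun_prop
    rw [mem_closedBall_zero_iff] at hx hy
    obtain ⟨s, hs, h1⟩ := intermediate_value_Icc (zero_le_one' ℝ) hcont
      (show (1 : ℝ) ∈ Icc _ _ from ⟨by simpa using hx, by simpa using (not_le.1 hy).le⟩)
    have hz : x + s • (y - x) ∈ sphere (0 : E) 1 := by simpa using h1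
    have := hlip _ (sphere_subset_closedBall hz) x (by simpa using hx)
    have h0 : h (x + s • (y - x)) = 0 := by simp only [h]; rw [hid _ hz, sub_self]
    rw [h0, sub_zero] at this
    refine this.trans (mul_le_mul_of_nonneg_left ?_ (by linarith))
    have : x - (x + s • (y - x)) = s • (x - y) := by module
    rw [this, norm_smul, Real.norm_of_nonneg hs.1]
    exact mul_le_of_le_one_left (norm_nonneg _) hs.2
  have hHlip : ∀ x y, ‖H x - H y‖ ≤ C * ‖x - y‖ := by
    intro x y
    by_cases hx : x ∈ closedBall (0 : E) 1 <;> by_cases hy : y ∈ closedBall (0 : E) 1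
    · rw [hHin x hx, hHin y hy]; exact hlip y hy x hx
    · rw [hHin x hx, show H y = 0 from if_neg hy, sub_zero]; exact hmix x hx y hy
    · rw [hHin y hy, show H x = 0 from if_neg hx, zero_sub, norm_neg, norm_sub_rev x y]
      exact hmix y hy x hx
    · rw [show H x = 0 from if_neg hx, show H y = 0 from if_neg hy]; simp; positivity
  have key : ∀ t : ℝ, 0 < t → t * C < 1 →
      ∫ x in ball (0 : E) 1, (1 + t • D x).det = (volume (ball (0 : E) 1)).toReal := by
    intro t ht htC
    let G : E → E := fun x => x + t • H x
    have hG : ∀ x y, ‖G x - G y - (x - y)‖ ≤ t * C * ‖x - y‖ := by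
      intro x y
      have : G x - G y - (x - y) = t • (H x - H y) := by simp only [G]; module
      rw [this, norm_smul, Real.norm_of_nonneg ht.le, mul_assoc]
      exact mul_le_mul_of_nonneg_left (hHlip x y) ht.le
    have hinj : Function.Injective G := by
      intro x y hxy
      have := hG x y
      rw [hxy, sub_self, zero_sub, norm_neg] at this
      have h0 : ‖x - y‖ = 0 := by nlinarith [norm_nonneg (x - y)]
      exact sub_eq_zero.1 (norm_eq_zero.1 h0)
    have hsurj : Function.Surjective G := by
      have hA : ApproximatesLinearOn G ((ContinuousLinearEquiv.refl ℝ E : E ≃L[ℝ] E) : E →L[ℝ] E)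
          univ (Real.toNNReal (t * C)) := by
        intro x _ y _
        rw [Real.coe_toNNReal _ (by positivity)]
        exact hG x y
      refine hA.surjective ?_
      rcases subsingleton_or_nontrivial E with hE | hE
      · exact Or.inl hE
      · right
        have : ‖((ContinuousLinearEquiv.refl ℝ E).symm : E →L[ℝ] E)‖₊ = 1 := by
          have : ((ContinuousLinearEquiv.refl ℝ E).symm : E →L[ℝ] E) = 1 := rfl
          rw [this]; exact nnnorm_one
        rw [this, inv_one]
        exact Real.toNNReal_lt_one.2 htC
    have himg : G '' ball (0 : E) 1 = ball (0 : E) 1 := by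
      have hout : ∀ x, x ∉ ball (0 : E) 1 → G x = x := fun x hx => by simp [G, hHout x hx]
      ext y
      constructor
      · rintro ⟨x, hx, rfl⟩
        by_contra hy
        exact hy ((hinj (hout _ hy)).symm ▸ hx)
      · intro hy
        obtain ⟨x, rfl⟩ := hsurj y
        by_cases hx : x ∈ ball (0 : E) 1
        · exact ⟨x, hx, rfl⟩
        · rw [hout x hx] at hy; exact absurd hy hx
    have hGd : ∀ x ∈ ball (0 : E) 1, HasFDerivWithinAt G (1 + t • D x) (ball (0 : E) 1) x := by
      intro x hx
      have h1 : HasFDerivAt (fun x => x + t • h x) (1 + t • D x) x :=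
        (hasFDerivAt_id x).add ((hd x (ball_subset_closedBall hx)).const_smul t)
      refine h1.hasFDerivWithinAt.congr (fun y hy => ?_) ?_
      · simp only [G, hHin y (ball_subset_closedBall hy)]
      · simp only [G, hHin x (ball_subset_closedBall hx)]
    have hintegral := integral_image_eq_integral_abs_det_fderiv_smul volume measurableSet_ball hGd
      hinj.injOn (fun _ => (1 : ℝ))
    rw [himg] at hintegral
    simp only [smul_eq_mul, mul_one, integral_const, measureReal_restrict_apply_univ] at hintegral
    rw [← measureReal_def, hintegral]
    refine setIntegral_congr_fun measurableSet_ball fun x hx => ?_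
    refine (abs_of_pos (det_one_add_pos _ ?_)).symm
    rw [norm_smul, Real.norm_of_nonneg ht.le]
    exact lt_of_le_of_lt (mul_le_mul_of_nonneg_left (hC x (ball_subset_closedBall hx)) ht.le) htC
  let v : ℕ → ℝ := fun i => 1 / (2 * C * (i + 1))
  have hv : Function.Injective v := by
    intro i j hij
    have hCp : (0 : ℝ) < C := by linarith
    simp only [v, one_div, inv_inj] at hij
    have := hij
    have := mul_left_cancel₀ (by positivity) this
    exact_mod_cast add_right_cancel this
  have hvpos : ∀ i, 0 < v i := fun i => by simp only [v]; positivity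
  have hvlt : ∀ i, v i * C < 1 := fun i => by
    simp only [v]
    rw [div_mul_eq_mul_div, div_lt_one (by positivity)]
    have : (0 : ℝ) ≤ i := Nat.cast_nonneg i
    nlinarith
  have hdetint : ∀ t : ℝ, IntegrableOn (fun x => (1 + t • D x).det) (ball (0 : E) 1) := by
    intro t
    have : ContinuousOn (fun x => (1 + t • D x).det) (closedBall (0 : E) 1) :=
      ContinuousLinearMap.continuous_det.comp_continuousOn
        (continuousOn_const.add (hDc.const_smul t))
    exact (this.integrableOn_compact (isCompact_closedBall _ _)).mono_set ball_subset_closedBall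
  have hone : ∫ x in ball (0 : E) 1, (1 + (1 : ℝ) • D x).det
      = (volume (ball (0 : E) 1)).toReal := by
    simp_rw [det_one_add_smul_eq_sum v hv 1]
    rw [integral_finsetSum _ (fun i _ => (hdetint (v i)).const_mul _)]
    simp_rw [integral_const_mul, key _ (hvpos _) (hvlt _)]
    rw [← Finset.sum_mul]
    have := det_one_add_smul_eq_sum v hv 1 (0 : E →L[ℝ] E)
    simp only [smul_zero, add_zero] at this
    have h1 : (1 : E →L[ℝ] E).det = 1 := by simp [ContinuousLinearMap.det]
    rw [h1] at this
    simp only [mul_one] at this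
    rw [← this, one_mul]
  have hzero : ∀ x ∈ ball (0 : E) 1, (1 + (1 : ℝ) • D x).det = 0 := by
    intro x hx
    have hrd : HasFDerivAt r (1 + (1 : ℝ) • D x) x := by
      have := (hasFDerivAt_id x).add (hd x (ball_subset_closedBall hx))
      rw [one_smul]
      convert this using 1
      · ext y; simp [h]
      · rfl
    have hconst : HasFDerivAt (fun y => ‖r y‖ ^ 2) (0 : E →L[ℝ] ℝ) x := by
      refine (hasFDerivAt_const (1 : ℝ) x).congr_of_eventuallyEq ?_
      filter_upwards [isOpen_ball.mem_nhds hx] with y hy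
      simp [hn y (ball_subset_closedBall hy)]
    have hu := hconst.unique hrd.norm_sq
    by_contra hdet
    have hker : LinearMap.range ((1 + (1 : ℝ) • D x : E →L[ℝ] E) : E →ₗ[ℝ] E) = ⊤ := by
      rw [← LinearMap.ker_eq_bot_iff_range_eq_top]
      by_contra hne
      exact hdet (LinearMap.det_eq_zero_iff_ker_ne_bot.2 hne)
    obtain ⟨w, hw⟩ := LinearMap.range_eq_top.1 hker (r x)
    have h0 := congrArg (fun L : E →L[ℝ] ℝ => L w) hu
    simp only [ContinuousLinearMap.coe_coe] at hw
    change (0 : ℝ) = 2 • inner ℝ (r x) ((1 + (1 : ℝ) • D x : E →L[ℝ] E) w) at h0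
    rw [hw, real_inner_self_eq_norm_sq, hn x (ball_subset_closedBall hx)] at h0
    norm_num at h0
  rw [setIntegral_congr_fun measurableSet_ball hzero] at hone
  simp only [integral_zero] at hone
  have hpos : 0 < (volume (ball (0 : E) 1)).toReal :=
    ENNReal.toReal_pos (measure_ball_pos _ _ one_pos).ne' measure_ball_lt_top.ne
  linarith

open Metric in
theorem exists_fixedPoint_of_contDiff {E : Type*} [NormedAddCommGroup E] [InnerProductSpace ℝ E]
    [FiniteDimensional ℝ E] (f : E → E) (hf : ContDiff ℝ 1 f) (hb : ∀ x, ‖f x‖ ≤ 1) :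
    ∃ x ∈ closedBall (0 : E) 1, f x = x := by
  by_contra hno
  push Not at hno
  let w : E → E := fun x => x - f x
  have hw : ∀ x ∈ closedBall (0 : E) 1, 0 < ‖w x‖ ^ 2 := fun x hx => by
    have := norm_pos_iff.2 (sub_ne_zero.2 (hno x hx).symm)
    exact pow_pos this 2
  let b : E → ℝ := fun x => inner ℝ x (w x)
  let d : E → ℝ := fun x => b x ^ 2 + ‖w x‖ ^ 2 * (1 - ‖x‖ ^ 2)
  let l : E → ℝ := fun x => (-b x + √(d x)) / ‖w x‖ ^ 2
  have hws : ContDiff ℝ 1 w := contDiff_id.sub hf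
  have hbs : ContDiff ℝ 1 b := contDiff_id.inner ℝ hws
  have hds : ContDiff ℝ 1 d :=
    (hbs.pow 2).add ((hws.norm_sq ℝ).mul (contDiff_const.sub (contDiff_id.norm_sq ℝ)))
  have hbsph : ∀ x, ‖x‖ = 1 → 0 < b x := by
    intro x hx
    have h1 := hw x (by simp [hx])
    have h2 : ‖w x‖ ^ 2 = ‖x‖ ^ 2 - 2 * inner ℝ x (f x) + ‖f x‖ ^ 2 := norm_sub_sq_real _ _
    have h3 : b x = ‖x‖ ^ 2 - inner ℝ x (f x) := by
      simp only [b, w, inner_sub_right, real_inner_self_eq_norm_sq]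
    have h4 := hb x
    have h5 : ‖f x‖ ^ 2 ≤ 1 := pow_le_one₀ (norm_nonneg _) h4
    rw [hx] at h2 h3
    linarith
  have hdpos : ∀ x ∈ closedBall (0 : E) 1, 0 < d x := by
    intro x hx
    rw [mem_closedBall_zero_iff] at hx
    rcases hx.lt_or_eq with h | h
    · have : 0 < ‖w x‖ ^ 2 * (1 - ‖x‖ ^ 2) :=
        mul_pos (hw x (by simpa using hx)) (by nlinarith [norm_nonneg x])
      simp only [d]; nlinarith [sq_nonneg (b x)]
    · have := hbsph x h
      simp only [d, h]; nlinarith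
  refine no_retraction_of_contDiffAt (fun x => x + l x • w x) (fun x hx => ?_) (fun x hx => ?_)
    fun x hx => ?_
  · have hl : ContDiffAt ℝ 1 l x :=
      ((hbs.contDiffAt.neg).add (hds.contDiffAt.sqrt (hdpos x hx).ne')).div
        (hws.norm_sq ℝ).contDiffAt (hw x hx).ne'
    exact contDiffAt_id.add (hl.smul hws.contDiffAt)
  · have h1 : ‖x + l x • w x‖ ^ 2 = 1 := by
      rw [norm_add_sq_real, norm_smul, inner_smul_right, mul_pow, Real.norm_eq_abs, sq_abs]
      have h2 : l x * ‖w x‖ ^ 2 = -b x + √(d x) := div_mul_cancel₀ _ (hw x hx).ne'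
      have h3 : √(d x) ^ 2 = d x := Real.sq_sqrt (hdpos x hx).le
      have h4 : ‖w x‖ ^ 2 * (l x ^ 2 * ‖w x‖ ^ 2 + 2 * (l x * b x) + (‖x‖ ^ 2 - 1)) = 0 := by
        have : √(d x) = l x * ‖w x‖ ^ 2 + b x := by linarith
        rw [this] at h3
        simp only [d] at h3
        linarith
      have h5 := (mul_eq_zero.1 h4).resolve_left (hw x hx).ne'
      change ‖x‖ ^ 2 + 2 * (l x * b x) + _ = 1
      linarith
    exact (pow_eq_one_iff_of_nonneg (norm_nonneg _) two_ne_zero).1 h1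
  · rw [mem_sphere_zero_iff_norm] at hx
    have : l x = 0 := by
      simp only [l, d, hx]
      rw [show b x ^ 2 + ‖w x‖ ^ 2 * (1 - 1 ^ 2) = b x ^ 2 by ring, Real.sqrt_sq (hbsph x hx).le]
      simp
    simp [this]

open Metric in
/-- Brouwer's fixed point theorem for a continuous map into the closed unit ball. -/
theorem exists_fixedPoint_of_continuous {E : Type*} [NormedAddCommGroup E] [InnerProductSpace ℝ E]
    [FiniteDimensional ℝ E] (f : E → E) (hf : Continuous f) (hb : ∀ x, ‖f x‖ ≤ 1) :
    ∃ x, f x = x := by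
  obtain ⟨x₀, hx₀, hmin⟩ := (isCompact_closedBall (0 : E) 1).exists_isMinOn
    (nonempty_closedBall.2 zero_le_one) (f := fun x => ‖f x - x‖) (by fun_prop)
  refine ⟨x₀, ?_⟩
  by_contra hne
  have hm : 0 < ‖f x₀ - x₀‖ := norm_pos_iff.2 (sub_ne_zero.2 hne)
  set m := ‖f x₀ - x₀‖ with hmdef
  obtain ⟨g, hg, hgf, -⟩ := hf.exists_contDiff_approx (ε := fun _ => m / 3) 1 continuous_const
    (fun _ => by positivity)
  have hg1 : ∀ x, ‖g x‖ ≤ 1 + m / 3 := fun x => by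
    have h1 := hgf x
    rw [dist_eq_norm] at h1
    have h2 := norm_le_norm_add_norm_sub' (g x) (f x)
    linarith [hb x]
  obtain ⟨x, hx, hxe⟩ := exists_fixedPoint_of_contDiff (fun x => (1 + m / 3)⁻¹ • g x)
    (contDiff_const.smul (by exact_mod_cast hg)) fun x => by
      rw [norm_smul, norm_inv, Real.norm_of_nonneg (by positivity), inv_mul_le_iff₀ (by positivity),
        mul_one]
      exact hg1 x
  have h1 : g x - x = (m / 3) • x := by
    have : g x = (1 + m / 3) • x := by
      have h := congrArg (fun y => (1 + m / 3) • y) hxe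
      simp only [smul_smul] at h
      rwa [mul_inv_cancel₀ (by positivity), one_smul] at h
    rw [this]; module
  have h2 : ‖g x - x‖ ≤ m / 3 := by
    rw [h1, norm_smul, Real.norm_of_nonneg (by positivity)]
    exact mul_le_of_le_one_right (by positivity) (by simpa using hx)
  have h3 : m ≤ ‖f x - x‖ := hmin hx
  have h4 := hgf x
  rw [dist_comm, dist_eq_norm] at h4
  have h5 : ‖f x - x‖ ≤ ‖f x - g x‖ + ‖g x - x‖ := norm_sub_le_norm_sub_add_norm_sub _ _ _
  linarith

/-- Schauder's fixed point theorem on a compact convex set. -/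
theorem exists_fixedPoint_of_isCompact_convex {E : Type*} [NormedAddCommGroup E] [NormedSpace ℝ E]
    {K : Set E} (hK : IsCompact K) (hc : Convex ℝ K) (hne : K.Nonempty) (f : E → E)
    (hf : ContinuousOn f K) (hm : MapsTo f K K) : ∃ x ∈ K, f x = x := by
  classical
  obtain ⟨x₀, hx₀, hmin⟩ := hK.exists_isMinOn hne (f := fun x => ‖x - f x‖)
    (continuousOn_id.sub hf).norm
  refine ⟨x₀, hx₀, ?_⟩
  by_contra hfx
  have hε : 0 < ‖x₀ - f x₀‖ / 2 := half_pos (norm_pos_iff.2 (sub_ne_zero.2 (Ne.symm hfx)))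
  set ε := ‖x₀ - f x₀‖ / 2 with hεdef
  obtain ⟨t, htK, htfin, hcov⟩ := hK.finite_cover_balls hε
  have : Fintype t := htfin.fintype
  have : Nonempty t := by
    obtain ⟨x, hx⟩ := hne
    have := hcov hx
    simp only [mem_iUnion] at this
    obtain ⟨y, hy, -⟩ := this
    exact ⟨⟨y, hy⟩⟩
  let S : EuclideanSpace ℝ t → ℝ := fun x => ∑ i, max (x i) 0
  have hS0 : ∀ x, 0 ≤ S x := fun x => Finset.sum_nonneg fun i _ => le_max_right _ _
  let N : ℝ := Fintype.card t
  have hN : 0 < N := by simp only [N]; exact_mod_cast Fintype.card_pos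
  let p : t → EuclideanSpace ℝ t → ℝ := fun i x => (max (x i) 0 + max (1 - S x) 0 / N) / max 1 (S x)
  have hSc : Continuous S := by fun_prop
  have hmaxpos : ∀ x, 0 < max 1 (S x) := fun x => lt_max_of_lt_left one_pos
  have hpc : ∀ i, Continuous (p i) := fun i => by
    refine Continuous.div (by fun_prop) (by fun_prop) fun x => (hmaxpos x).ne'
  have hp0 : ∀ i x, 0 ≤ p i x := fun i x =>
    div_nonneg (add_nonneg (le_max_right _ _) (div_nonneg (le_max_right _ _) hN.le)) (hmaxpos x).le
  have hp1 : ∀ x, ∑ i, p i x = 1 := by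
    intro x
    simp only [p]
    rw [← Finset.sum_div, Finset.sum_add_distrib, Finset.sum_const, Finset.card_univ, nsmul_eq_mul,
      mul_div_cancel₀ _ hN.ne', div_eq_one_iff_eq (hmaxpos x).ne']
    change S x + _ = _
    rcases le_total (S x) 1 with h | h
    · rw [max_eq_left (by linarith), max_eq_left h]; ring
    · rw [max_eq_right (by linarith), max_eq_right h]; ring
  have hpid : ∀ x : EuclideanSpace ℝ t, (∀ i, 0 ≤ x i) → ∑ i, x i = 1 → ∀ i, p i x = x i := by
    intro x hx h1 i
    have : S x = 1 := by
      rw [← h1]; exact Finset.sum_congr rfl fun i _ => max_eq_left (hx i)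
    simp only [p, this, max_eq_left (hx i)]
    simp
  let Z : EuclideanSpace ℝ t → E := fun x => ∑ i, p i x • (i : E)
  have hZc : Continuous Z := by
    refine continuous_finsetSum _ fun i _ => (hpc i).smul continuous_const
  have hZK : ∀ x, Z x ∈ K := fun x =>
    hc.sum_mem (fun i _ => hp0 i x) (hp1 x) fun i _ => htK i.2
  let μ : t → E → ℝ := fun i z => max (ε - ‖z - i‖) 0
  have hμ0 : ∀ i z, 0 ≤ μ i z := fun i z => le_max_right _ _
  have hμc : ∀ i, Continuous (μ i) := fun i => by fun_prop
  let W : E → ℝ := fun z => ∑ i, μ i z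
  have hWpos : ∀ z ∈ K, 0 < W z := by
    intro z hz
    have := hcov hz
    simp only [mem_iUnion] at this
    obtain ⟨y, hy, hzy⟩ := this
    refine Finset.sum_pos' (fun i _ => hμ0 i z) ⟨⟨y, hy⟩, Finset.mem_univ _, ?_⟩
    rw [mem_ball_iff_norm] at hzy
    exact lt_max_of_lt_left (by simpa using hzy)
  have hfZ : Continuous fun x => f (Z x) := hf.comp_continuous hZc hZK
  let F : EuclideanSpace ℝ t → EuclideanSpace ℝ t := fun x =>
    WithLp.toLp 2 fun i => μ i (f (Z x)) / W (f (Z x))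
  have hFc : Continuous F := by
    refine (PiLp.continuous_toLp 2 _).comp (continuous_pi fun i => ?_)
    refine Continuous.div ((hμc i).comp hfZ) ((continuous_finsetSum _ fun i _ => hμc i).comp hfZ)
      fun x => (hWpos _ (hm (hZK x))).ne'
  have hF0 : ∀ x i, 0 ≤ F x i := fun x i => div_nonneg (hμ0 _ _) (hWpos _ (hm (hZK x))).le
  have hF1 : ∀ x, ∑ i, F x i = 1 := fun x => by
    change ∑ i, μ i (f (Z x)) / W (f (Z x)) = 1
    rw [← Finset.sum_div]
    exact div_self (hWpos _ (hm (hZK x))).ne'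
  obtain ⟨x, hx⟩ := exists_fixedPoint_of_continuous F hFc fun x => by
    rw [EuclideanSpace.norm_eq, Real.sqrt_le_left zero_le_one, one_pow, ← hF1 x]
    refine Finset.sum_le_sum fun i _ => ?_
    have h1 : F x i ≤ 1 := by
      rw [← hF1 x]
      exact Finset.single_le_sum (fun i _ => hF0 x i) (Finset.mem_univ i)
    rw [Real.norm_of_nonneg (hF0 x i)]
    nlinarith [hF0 x i]
  have hx0 : ∀ i, 0 ≤ x i := fun i => hx ▸ hF0 x i
  have hx1 : ∑ i, x i = 1 := by
    have := hF1 x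
    rwa [hx] at this
  have hle : ‖Z x - f (Z x)‖ ≤ ε := by
    have h1 : Z x - f (Z x) = ∑ i, x i • ((i : E) - f (Z x)) := by
      simp only [smul_sub, Finset.sum_sub_distrib, ← Finset.sum_smul, hx1, one_smul]
      congr 1
      exact Finset.sum_congr rfl fun i _ => by rw [hpid x hx0 hx1]
    rw [h1]
    calc _ ≤ ∑ i, x i * ε := ?_
      _ = ε := by rw [← Finset.sum_mul, hx1, one_mul]
    refine norm_sum_le_of_le _ fun i _ => ?_
    rw [norm_smul, Real.norm_of_nonneg (hx0 i)]
    by_cases h : ‖f (Z x) - i‖ ≤ ε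
    · rw [norm_sub_rev]; exact mul_le_mul_of_nonneg_left h (hx0 i)
    · have : x i = 0 := by
        rw [← hx]
        change μ i (f (Z x)) / _ = 0
        have : μ i (f (Z x)) = 0 := max_eq_right (by linarith)
        rw [this, zero_div]
      rw [this]; simp
  have : ‖x₀ - f x₀‖ ≤ ‖Z x - f (Z x)‖ := hmin (hZK x)
  linarith

/-- The logarithmic kernel `log |sin (v / 2)|` of the antiderivative of the Hilbert transform. -/
noncomputable def logSinHalf (v : ℝ) : ℝ := Real.log (Real.sin (v / 2))

/-- The weight `|sin (v / 2)| ^ (-1/2)` controlling increments of `logSinHalf`. -/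
noncomputable def invSqrtSinHalf (v : ℝ) : ℝ := 1 / √|Real.sin (v / 2)|

/-- The function `sin (x / 2) ^ 2`. -/
noncomputable def sinSqHalf (x : ℝ) : ℝ := Real.sin (x / 2) ^ 2

/-- The kernel of the operator `u ↦ -H[u]` on even functions. -/
noncomputable def evenKernel (x y : ℝ) : ℝ :=
  2 * logSinHalf y - logSinHalf (x - y) - logSinHalf (x + y)

theorem sin_half_add_two_pi (v : ℝ) : Real.sin ((v + 2 * Real.pi) / 2) = -Real.sin (v / 2) := by
  rw [show (v + 2 * Real.pi) / 2 = v / 2 + Real.pi by ring, Real.sin_add_pi]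

theorem logSinHalf_periodic : Function.Periodic logSinHalf (2 * Real.pi) := fun v => by
  simp only [logSinHalf, sin_half_add_two_pi, Real.log_neg_eq_log]

theorem logSinHalf_neg (v : ℝ) : logSinHalf (-v) = logSinHalf v := by
  simp only [logSinHalf, neg_div, Real.sin_neg, Real.log_neg_eq_log]

theorem invSqrtSinHalf_periodic : Function.Periodic invSqrtSinHalf (2 * Real.pi) := fun v => by
  simp only [invSqrtSinHalf, sin_half_add_two_pi, abs_neg]

theorem invSqrtSinHalf_neg (v : ℝ) : invSqrtSinHalf (-v) = invSqrtSinHalf v := by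
  simp only [invSqrtSinHalf, neg_div, Real.sin_neg, abs_neg]

theorem measurable_logSinHalf : Measurable logSinHalf := by
  unfold logSinHalf; fun_prop

theorem intervalIntegrable_logSinHalf (a b : ℝ) : IntervalIntegrable logSinHalf volume a b := by
  have := (intervalIntegrable_log_sin (a := a / 2) (b := b / 2)).comp_mul_left (c := 1 / 2)
  simp only [div_div_eq_mul_div, div_one] at this
  rw [div_mul_cancel₀ _ two_ne_zero, div_mul_cancel₀ _ two_ne_zero] at this
  refine this.congr fun x _ => ?_
  simp only [logSinHalf, Function.comp_apply]
  congr 2; ring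

theorem intervalIntegrable_invSqrtSinHalf (a b : ℝ) :
    IntervalIntegrable invSqrtSinHalf volume a b := by
  have hpi := Real.pi_pos
  have h0 : IntervalIntegrable invSqrtSinHalf volume 0 Real.pi := by
    have h1 : IntervalIntegrable (fun v : ℝ => √Real.pi * v ^ (-1 / 2 : ℝ)) volume 0 Real.pi :=
      (intervalIntegral.intervalIntegrable_rpow' (by norm_num)).const_mul _
    refine h1.mono_fun' ?_ ?_
    · exact (Measurable.aestronglyMeasurable (by unfold invSqrtSinHalf; fun_prop))
    rw [uIoc_of_le hpi.le]
    refine (ae_restrict_iff' measurableSet_Ioc).2 (Filter.Eventually.of_forall fun v hv => ?_)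
    have hs := Real.mul_le_sin (x := v / 2) (by linarith [hv.1]) (by linarith [hv.2])
    have hs' : v / Real.pi ≤ |Real.sin (v / 2)| := by
      refine le_trans (le_of_eq ?_) (hs.trans (le_abs_self _)); field_simp
    have hvp : 0 < v / Real.pi := div_pos hv.1 hpi
    have hnn : 0 ≤ invSqrtSinHalf v := by unfold invSqrtSinHalf; positivity
    simp only [Real.norm_of_nonneg hnn]
    calc invSqrtSinHalf v ≤ 1 / √(v / Real.pi) :=
          one_div_le_one_div_of_le (Real.sqrt_pos.2 hvp) (Real.sqrt_le_sqrt hs')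
      _ = √Real.pi * v ^ (-1 / 2 : ℝ) := by
          rw [Real.sqrt_div hv.1.le, neg_div, Real.rpow_neg hv.1.le, ← Real.sqrt_eq_rpow]
          field_simp
  have h1 : IntervalIntegrable invSqrtSinHalf volume (-Real.pi) 0 := by
    have := (IntervalIntegrable.iff_comp_neg (by simp)).1 h0
    simp only [invSqrtSinHalf_neg, neg_zero] at this
    exact this.symm
  refine invSqrtSinHalf_periodic.intervalIntegrable (by positivity) (t := -Real.pi) ?_ a b
  rw [show -Real.pi + 2 * Real.pi = Real.pi by ring]
  exact h1.trans h0

theorem integral_sub_add_integral_add {f : ℝ → ℝ} (hf : Function.Periodic f (2 * Real.pi))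
    (hi : ∀ a b, IntervalIntegrable f volume a b) (x : ℝ) :
    (∫ y in (0)..Real.pi, f (x - y)) + ∫ y in (0)..Real.pi, f (x + y)
      = ∫ v in (-Real.pi)..Real.pi, f v := by
  rw [intervalIntegral.integral_comp_sub_left, intervalIntegral.integral_comp_add_left, sub_zero,
    add_zero, intervalIntegral.integral_add_adjacent_intervals (hi _ _) (hi _ _)]
  have := hf.intervalIntegral_add_eq (x - Real.pi) (-Real.pi)
  rwa [show x - Real.pi + 2 * Real.pi = x + Real.pi by ring,
    show -Real.pi + 2 * Real.pi = Real.pi by ring] at this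

theorem integral_symm_of_even {f : ℝ → ℝ} (hf : ∀ v, f (-v) = f v) (a : ℝ)
    (hi : ∀ a b, IntervalIntegrable f volume a b) :
    ∫ v in (-a)..a, f v = 2 * ∫ v in (0)..a, f v := by
  rw [← intervalIntegral.integral_add_adjacent_intervals (hi (-a) 0) (hi 0 a)]
  have := intervalIntegral.integral_comp_neg (a := 0) (b := a) f
  simp only [hf, neg_zero] at this
  rw [← this]; ring

theorem intervalIntegrable_comp_sub {f : ℝ → ℝ} (hi : ∀ a b, IntervalIntegrable f volume a b)
    (x a b : ℝ) : IntervalIntegrable (fun y => f (x - y)) volume a b := by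
  have := (hi (x - a) (x - b)).comp_sub_left x
  simpa using this

theorem intervalIntegrable_comp_add {f : ℝ → ℝ} (hi : ∀ a b, IntervalIntegrable f volume a b)
    (x a b : ℝ) : IntervalIntegrable (fun y => f (x + y)) volume a b := by
  have := (hi (x + a) (x + b)).comp_add_left x
  simpa using this

theorem intervalIntegrable_evenKernel (x a b : ℝ) :
    IntervalIntegrable (evenKernel x) volume a b := by
  have h := intervalIntegrable_logSinHalf
  exact (((h a b).const_mul 2).sub (intervalIntegrable_comp_sub h x a b)).sub
    (intervalIntegrable_comp_add h x a b)

theorem integral_evenKernel (x : ℝ) : ∫ y in (0)..Real.pi, evenKernel x y = 0 := by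
  have h := intervalIntegrable_logSinHalf
  have h1 := intervalIntegrable_comp_sub h x 0 Real.pi
  have h2 := intervalIntegrable_comp_add h x 0 Real.pi
  unfold evenKernel
  rw [intervalIntegral.integral_sub (((h _ _).const_mul 2).sub h1) h2,
    intervalIntegral.integral_sub ((h _ _).const_mul 2) h1, intervalIntegral.integral_const_mul,
    ← integral_symm_of_even logSinHalf_neg _ h, ← integral_sub_add_integral_add
    logSinHalf_periodic h x]
  ring

theorem evenKernel_zero (y : ℝ) : evenKernel 0 y = 0 := by
  simp only [evenKernel, zero_sub, zero_add, logSinHalf_neg]; ring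

theorem countable_sin_half_eq_zero : {v : ℝ | Real.sin (v / 2) = 0}.Countable := by
  refine (countable_range fun n : ℤ => 2 * ((n : ℝ) * Real.pi)).mono ?_
  intro v hv
  obtain ⟨n, hn⟩ := Real.sin_eq_zero_iff.1 hv
  exact ⟨n, by simp only; linarith⟩

theorem ae_sin_half_sub_ne_zero (x : ℝ) : ∀ᵐ y : ℝ, Real.sin ((x - y) / 2) ≠ 0 :=
  (countable_sin_half_eq_zero.preimage (f := fun y : ℝ => x - y)
    fun a b h => by simpa using h).ae_notMem volume

theorem ae_sin_half_add_ne_zero (x : ℝ) : ∀ᵐ y : ℝ, Real.sin ((x + y) / 2) ≠ 0 :=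
  (countable_sin_half_eq_zero.preimage (f := fun y : ℝ => x + y)
    fun a b h => by simpa using h).ae_notMem volume

theorem ae_sin_half_ne_zero : ∀ᵐ y : ℝ, Real.sin (y / 2) ≠ 0 :=
  countable_sin_half_eq_zero.ae_notMem volume

theorem sin_half_mul_sin_half (x y : ℝ) :
    Real.sin ((x - y) / 2) * Real.sin ((x + y) / 2) = sinSqHalf x - sinSqHalf y := by
  rw [show (x - y) / 2 = x / 2 - y / 2 by ring, show (x + y) / 2 = x / 2 + y / 2 by ring,
    Real.sin_sub, Real.sin_add]
  have h1 := Real.sin_sq_add_cos_sq (x / 2)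
  have h2 := Real.sin_sq_add_cos_sq (y / 2)
  simp only [sinSqHalf]
  linear_combination Real.sin (x / 2) ^ 2 * h2 - Real.sin (y / 2) ^ 2 * h1

theorem evenKernel_eq {x y : ℝ} (h1 : Real.sin ((x - y) / 2) ≠ 0)
    (h2 : Real.sin ((x + y) / 2) ≠ 0) :
    evenKernel x y = Real.log (sinSqHalf y) - Real.log (sinSqHalf x - sinSqHalf y) := by
  rw [← sin_half_mul_sin_half, Real.log_mul h1 h2]
  simp only [sinSqHalf, Real.log_pow, evenKernel, logSinHalf]
  push_cast; ring

/-- For a given point, almost every point avoids the singularities of the kernel. -/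
theorem ae_sinSqHalf_ne (x : ℝ) : ∀ᵐ y : ℝ, sinSqHalf x ≠ sinSqHalf y ∧ 0 < sinSqHalf y ∧
    evenKernel x y = Real.log (sinSqHalf y) - Real.log (sinSqHalf x - sinSqHalf y) := by
  filter_upwards [ae_sin_half_sub_ne_zero x, ae_sin_half_add_ne_zero x, ae_sin_half_ne_zero]
    with y h1 h2 h3
  refine ⟨?_, by unfold sinSqHalf; positivity, evenKernel_eq h1 h2⟩
  rw [← sub_ne_zero, ← sin_half_mul_sin_half]
  exact mul_ne_zero h1 h2

theorem abs_log_sub_log_le {a b : ℝ} (ha : 0 < a) (hb : 0 < b) :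
    |Real.log a - Real.log b| ≤ 2 * √|a - b| * (1 / √a + 1 / √b) := by
  wlog hab : b ≤ a generalizing a b
  · have := this hb ha (le_of_not_ge hab)
    rwa [abs_sub_comm, abs_sub_comm b a, add_comm] at this
  have hsb := Real.sqrt_pos.2 hb
  have hsa := Real.sqrt_pos.2 ha
  rw [abs_of_nonneg (sub_nonneg.2 (Real.log_le_log hb hab)), abs_of_nonneg (sub_nonneg.2 hab)]
  have h1 : Real.log a - Real.log b = 2 * Real.log (√a / √b) := by
    rw [Real.log_div hsa.ne' hsb.ne', Real.log_sqrt ha.le, Real.log_sqrt hb.le]; ring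
  have h2 := Real.log_le_sub_one_of_pos (div_pos hsa hsb)
  have h3 : √a ≤ √(a - b) + √b := by
    refine Real.sqrt_le_iff.2 ⟨by positivity, ?_⟩
    nlinarith [Real.sq_sqrt (sub_nonneg.2 hab), Real.sq_sqrt hb.le, Real.sqrt_nonneg (a - b)]
  have h4 : √a / √b - 1 ≤ √(a - b) * (1 / √b) := by
    rw [div_sub_one hsb.ne', mul_one_div]
    exact div_le_div_of_nonneg_right (by linarith) hsb.le
  have h5 : 0 ≤ √(a - b) * (1 / √a) := by positivity
  rw [h1]; nlinarith

theorem abs_logSinHalf_sub_le {v w : ℝ} (hv : Real.sin (v / 2) ≠ 0) (hw : Real.sin (w / 2) ≠ 0) :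
    |logSinHalf v - logSinHalf w| ≤ 2 * √|v - w| * (invSqrtSinHalf v + invSqrtSinHalf w) := by
  have h1 := abs_log_sub_log_le (abs_pos.2 hv) (abs_pos.2 hw)
  rw [Real.log_abs, Real.log_abs] at h1
  refine h1.trans ?_
  have h2 : |(|Real.sin (v / 2)| - |Real.sin (w / 2)|)| ≤ |v - w| := by
    refine (abs_abs_sub_abs_le _ _).trans ?_
    have := Real.abs_sin_sub_sin_le (v / 2) (w / 2)
    refine this.trans ?_
    rw [← sub_div, abs_div, abs_two]
    linarith [abs_nonneg (v - w)]
  have h3 := Real.sqrt_le_sqrt h2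
  have h4 : 0 ≤ 1 / √|Real.sin (v / 2)| + 1 / √|Real.sin (w / 2)| := by positivity
  exact mul_le_mul_of_nonneg_right (by linarith) h4

theorem integral_abs_evenKernel_sub_le (x x' : ℝ) :
    ∫ y in (0)..Real.pi, |evenKernel x y - evenKernel x' y| ≤
      (4 * ∫ v in (-Real.pi)..Real.pi, invSqrtSinHalf v) * √|x - x'| := by
  have hi := intervalIntegrable_invSqrtSinHalf
  have i1 := intervalIntegrable_comp_sub hi x 0 Real.pi
  have i2 := intervalIntegrable_comp_add hi x 0 Real.pi
  have i1' := intervalIntegrable_comp_sub hi x' 0 Real.pi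
  have i2' := intervalIntegrable_comp_add hi x' 0 Real.pi
  have h : ∫ y in (0)..Real.pi, |evenKernel x y - evenKernel x' y| ≤
      ∫ y in (0)..Real.pi, 2 * √|x - x'| * ((invSqrtSinHalf (x - y) + invSqrtSinHalf (x + y)) +
        (invSqrtSinHalf (x' - y) + invSqrtSinHalf (x' + y))) := by
    refine intervalIntegral.integral_mono_ae Real.pi_pos.le
      ((intervalIntegrable_evenKernel x _ _).sub (intervalIntegrable_evenKernel x' _ _)).abs
      (((i1.add i2).add (i1'.add i2')).const_mul _) ?_
    filter_upwards [ae_sin_half_sub_ne_zero x, ae_sin_half_add_ne_zero x,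
      ae_sin_half_sub_ne_zero x', ae_sin_half_add_ne_zero x'] with y h1 h2 h3 h4
    have e1 := abs_logSinHalf_sub_le h1 h3
    have e2 := abs_logSinHalf_sub_le h2 h4
    rw [show x - y - (x' - y) = x - x' by ring] at e1
    rw [show x + y - (x' + y) = x - x' by ring] at e2
    have e3 : |evenKernel x y - evenKernel x' y| ≤ |logSinHalf (x - y) - logSinHalf (x' - y)| +
        |logSinHalf (x + y) - logSinHalf (x' + y)| := by
      rw [← abs_neg]
      refine le_trans (le_of_eq ?_) (abs_add_le _ _)
      congr 1; simp only [evenKernel]; ring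
    nlinarith
  refine h.trans (le_of_eq ?_)
  rw [intervalIntegral.integral_const_mul, intervalIntegral.integral_add (i1.add i2) (i1'.add i2'),
    intervalIntegral.integral_add i1 i2, intervalIntegral.integral_add i1' i2',
    integral_sub_add_integral_add invSqrtSinHalf_periodic hi,
    integral_sub_add_integral_add invSqrtSinHalf_periodic hi]
  ring

/-- The operator `u ↦ -H[u]` on even functions, written with an integral over half a period. -/
noncomputable def cuspOp (u : ℝ → ℝ) (x : ℝ) : ℝ :=
  (1 / Real.pi) * ∫ y in (0)..Real.pi, evenKernel x y * u y

/-- The Hölder constant of `cuspOp` on functions bounded by `1`. -/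
noncomputable def cuspOpConst : ℝ :=
  (1 / Real.pi) * (4 * ∫ v in (-Real.pi)..Real.pi, invSqrtSinHalf v)

theorem cuspOpConst_nonneg : 0 ≤ cuspOpConst := by
  have h := Real.pi_pos
  refine mul_nonneg (by positivity) (mul_nonneg (by norm_num) ?_)
  exact intervalIntegral.integral_nonneg (by linarith) fun v _ => by
    unfold invSqrtSinHalf; positivity

theorem intervalIntegrable_evenKernel_mul {u : ℝ → ℝ} (hu : Continuous u) (x a b : ℝ) :
    IntervalIntegrable (fun y => evenKernel x y * u y) volume a b :=
  (intervalIntegrable_evenKernel x a b).mul_continuousOn hu.continuousOn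

theorem cuspOp_zero (u : ℝ → ℝ) : cuspOp u 0 = 0 := by
  simp [cuspOp, evenKernel_zero]

theorem cuspOp_sub {u w : ℝ → ℝ} (hu : Continuous u) (hw : Continuous w) (x : ℝ) :
    cuspOp (fun y => u y - w y) x = cuspOp u x - cuspOp w x := by
  simp only [cuspOp, mul_sub]
  rw [intervalIntegral.integral_sub (intervalIntegrable_evenKernel_mul hu x _ _)
    (intervalIntegrable_evenKernel_mul hw x _ _), mul_sub]

theorem abs_cuspOp_sub_le {u : ℝ → ℝ} (hu : Continuous u) {M : ℝ}
    (hM : ∀ y ∈ Icc 0 Real.pi, |u y| ≤ M) (x x' : ℝ) :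
    |cuspOp u x - cuspOp u x'| ≤ cuspOpConst * M * √|x - x'| := by
  have hpi := Real.pi_pos
  have hM0 : 0 ≤ M := (abs_nonneg _).trans (hM 0 ⟨le_rfl, hpi.le⟩)
  have hk := (intervalIntegrable_evenKernel x 0 Real.pi).sub
    (intervalIntegrable_evenKernel x' 0 Real.pi)
  have h1 : cuspOp u x - cuspOp u x' =
      (1 / Real.pi) * ∫ y in (0)..Real.pi, (evenKernel x y - evenKernel x' y) * u y := by
    simp only [cuspOp, sub_mul]
    rw [intervalIntegral.integral_sub (intervalIntegrable_evenKernel_mul hu x _ _)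
      (intervalIntegrable_evenKernel_mul hu x' _ _), mul_sub]
  have h2 : |∫ y in (0)..Real.pi, (evenKernel x y - evenKernel x' y) * u y| ≤
      ∫ y in (0)..Real.pi, |evenKernel x y - evenKernel x' y| * M := by
    refine (intervalIntegral.abs_integral_le_integral_abs hpi.le).trans ?_
    refine intervalIntegral.integral_mono_on hpi.le (hk.mul_continuousOn hu.continuousOn).abs
      (hk.abs.mul_const _) fun y hy => ?_
    rw [abs_mul]
    exact mul_le_mul_of_nonneg_left (hM y hy) (abs_nonneg _)
  rw [intervalIntegral.integral_mul_const] at h2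
  have h3 := mul_le_mul_of_nonneg_right (integral_abs_evenKernel_sub_le x x') hM0
  rw [h1, abs_mul, abs_of_pos (by positivity : 0 < 1 / Real.pi), cuspOpConst]
  calc _ ≤ (1 / Real.pi) * _ := mul_le_mul_of_nonneg_left (h2.trans h3) (by positivity)
    _ = _ := by ring

theorem abs_cuspOp_le {u : ℝ → ℝ} (hu : Continuous u) {M : ℝ}
    (hM : ∀ y ∈ Icc 0 Real.pi, |u y| ≤ M) (x : ℝ) :
    |cuspOp u x| ≤ cuspOpConst * M * √|x| := by
  simpa [cuspOp_zero] using abs_cuspOp_sub_le hu hM x 0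

theorem continuous_cuspOp {u : ℝ → ℝ} (hu : Continuous u) : Continuous (cuspOp u) := by
  obtain ⟨M, hM⟩ := isCompact_Icc.exists_bound_of_continuousOn
    (s := Icc 0 Real.pi) hu.continuousOn
  rw [continuous_iff_continuousAt]
  intro x
  rw [ContinuousAt, tendsto_iff_dist_tendsto_zero]
  refine squeeze_zero (fun _ => dist_nonneg) (fun y => abs_cuspOp_sub_le hu hM y x) ?_
  have : Continuous fun y => cuspOpConst * M * √|y - x| := by fun_prop
  simpa using this.tendsto x

/-- If `ψ` has zero mean and changes sign once from negative to positive, its integral against an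
increasing function is nonnegative. -/
theorem integral_mul_nonneg_of_pivot {ψ u : ℝ → ℝ} {a b c : ℝ} (hab : a ≤ b)
    (hψ : IntervalIntegrable ψ volume a b) (hψ0 : ∫ y in a..b, ψ y = 0)
    (hψu : IntervalIntegrable (fun y => ψ y * u y) volume a b)
    (hsign : ∀ᵐ y, y ∈ Icc a b → 0 ≤ ψ y * (u y - u c)) :
    0 ≤ ∫ y in a..b, ψ y * u y := by
  have h1 : ∫ y in a..b, ψ y * u y = ∫ y in a..b, ψ y * (u y - u c) := by
    simp only [mul_sub]
    rw [intervalIntegral.integral_sub hψu (hψ.mul_const _), intervalIntegral.integral_mul_const,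
      hψ0]
    ring
  rw [h1, intervalIntegral.integral_of_le hab]
  refine setIntegral_nonneg_of_ae_restrict ?_
  refine (ae_restrict_iff' measurableSet_Ioc).2 ?_
  filter_upwards [hsign] with y hy hy'
  exact hy (Ioc_subset_Icc_self hy')

theorem continuous_sinSqHalf : Continuous sinSqHalf := by unfold sinSqHalf; fun_prop

theorem strictMonoOn_sin_half : StrictMonoOn (fun x => Real.sin (x / 2)) (Icc 0 Real.pi) := by
  intro x hx y hy hxy
  exact Real.strictMonoOn_sin ⟨by linarith [hx.1, Real.pi_pos], by linarith [hx.2]⟩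
    ⟨by linarith [hy.1, Real.pi_pos], by linarith [hy.2]⟩ (by linarith)

theorem sin_half_nonneg {x : ℝ} (hx : x ∈ Icc 0 Real.pi) : 0 ≤ Real.sin (x / 2) :=
  Real.sin_nonneg_of_nonneg_of_le_pi (by linarith [hx.1]) (by linarith [hx.1, hx.2])

theorem strictMonoOn_sinSqHalf : StrictMonoOn sinSqHalf (Icc 0 Real.pi) := by
  intro x hx y hy hxy
  exact pow_lt_pow_left₀ (strictMonoOn_sin_half hx hy hxy) (sin_half_nonneg hx) two_ne_zero

theorem cuspOp_mono {u : ℝ → ℝ} (hu : Continuous u) (hm : Monotone u) {x₁ x₂ : ℝ}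
    (h1 : 0 ≤ x₁) (h12 : x₁ ≤ x₂) (h2 : x₂ ≤ Real.pi) : cuspOp u x₁ ≤ cuspOp u x₂ := by
  have hpi := Real.pi_pos
  have hx1 : x₁ ∈ Icc 0 Real.pi := ⟨h1, h12.trans h2⟩
  have hx2 : x₂ ∈ Icc 0 Real.pi := ⟨h1.trans h12, h2⟩
  have hs := strictMonoOn_sinSqHalf.monotoneOn
  have hs12 : sinSqHalf x₁ ≤ sinSqHalf x₂ := hs hx1 hx2 h12
  obtain ⟨c, hc, hcs⟩ := intermediate_value_Icc h12 continuous_sinSqHalf.continuousOn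
    (show (sinSqHalf x₁ + sinSqHalf x₂) / 2 ∈ Icc _ _ from ⟨by linarith, by linarith⟩)
  have hcI : c ∈ Icc 0 Real.pi := ⟨h1.trans hc.1, hc.2.trans h2⟩
  have i1 := intervalIntegrable_evenKernel x₁ 0 Real.pi
  have i2 := intervalIntegrable_evenKernel x₂ 0 Real.pi
  have key : 0 ≤ ∫ y in (0)..Real.pi, (evenKernel x₂ y - evenKernel x₁ y) * u y := by
    refine integral_mul_nonneg_of_pivot (c := c) hpi.le (i2.sub i1) ?_
      ((i2.sub i1).mul_continuousOn hu.continuousOn) ?_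
    · rw [intervalIntegral.integral_sub i2 i1, integral_evenKernel, integral_evenKernel, sub_zero]
    filter_upwards [ae_sinSqHalf_ne x₁, ae_sinSqHalf_ne x₂] with y ⟨n1, p1, e1⟩ ⟨n2, p2, e2⟩ hy
    rw [e1, e2, show ∀ a b c : ℝ, a - b - (a - c) = c - b from fun a b c => by ring,
      ← Real.log_abs, ← Real.log_abs (sinSqHalf x₂ - _)]
    have a1 := abs_pos.2 (sub_ne_zero.2 n1)
    have a2 := abs_pos.2 (sub_ne_zero.2 n2)
    rcases le_total y c with hyc | hyc
    · have h3 : sinSqHalf y ≤ (sinSqHalf x₁ + sinSqHalf x₂) / 2 := hcs ▸ hs hy hcI hyc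
      refine mul_nonneg_of_nonpos_of_nonpos (sub_nonpos.2 (Real.log_le_log a1 ?_))
        (sub_nonpos.2 (hm hyc))
      rw [abs_le, abs_of_nonneg (by linarith : 0 ≤ sinSqHalf x₂ - sinSqHalf y)]
      constructor <;> linarith
    · have h3 : (sinSqHalf x₁ + sinSqHalf x₂) / 2 ≤ sinSqHalf y := hcs ▸ hs hcI hy hyc
      refine mul_nonneg (sub_nonneg.2 (Real.log_le_log a2 ?_)) (sub_nonneg.2 (hm hyc))
      rw [abs_le, abs_of_nonpos (by linarith : sinSqHalf x₁ - sinSqHalf y ≤ 0)]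
      constructor <;> linarith
  have h3 : cuspOp u x₂ - cuspOp u x₁ =
      (1 / Real.pi) * ∫ y in (0)..Real.pi, (evenKernel x₂ y - evenKernel x₁ y) * u y := by
    simp only [cuspOp, sub_mul]
    rw [intervalIntegral.integral_sub (intervalIntegrable_evenKernel_mul hu x₂ _ _)
      (intervalIntegrable_evenKernel_mul hu x₁ _ _), mul_sub]
  have h4 : 0 ≤ cuspOp u x₂ - cuspOp u x₁ := by rw [h3]; positivity
  linarith

theorem integral_logSinHalf_mul_cos :
    ∫ v in (0)..Real.pi, logSinHalf v * Real.cos v = -(Real.pi / 2) := by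
  have hpi := Real.pi_pos
  let F : ℝ → ℝ := fun v =>
    2 * Real.cos (v / 2) * (Real.sin (v / 2) * Real.log (Real.sin (v / 2))) - (v + Real.sin v) / 2
  have hF : Continuous F := by
    have := Real.continuous_mul_log.comp (g := fun x => x * Real.log x)
      (f := fun v : ℝ => Real.sin (v / 2)) (by fun_prop)
    have h2 : Continuous fun v : ℝ => Real.sin (v / 2) * Real.log (Real.sin (v / 2)) := this
    simp only [F]; fun_prop
  have hd : ∀ v ∈ Ioo 0 Real.pi, HasDerivAt F (logSinHalf v * Real.cos v) v := by
    intro v hv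
    have hs : 0 < Real.sin (v / 2) :=
      Real.sin_pos_of_pos_of_lt_pi (by linarith [hv.1]) (by linarith [hv.2])
    have hh : HasDerivAt (fun v : ℝ => v / 2) (1 / 2) v := (hasDerivAt_id v).div_const 2
    have h1 := hh.cos
    have h2 := hh.sin
    have h3 := h2.log hs.ne'
    have h4 := ((h1.const_mul 2).mul (h2.mul h3)).sub
      (((hasDerivAt_id v).add (Real.hasDerivAt_sin v)).div_const 2)
    refine h4.congr_deriv ?_
    have hc : Real.cos v = 2 * Real.cos (v / 2) ^ 2 - 1 := by
      rw [← Real.cos_two_mul]; congr 1; ring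
    have hc2 := Real.sin_sq_add_cos_sq (v / 2)
    simp only [logSinHalf, hc, Pi.mul_apply]
    field_simp
    linear_combination (-2 * Real.log (Real.sin (v / 2))) * hc2
  rw [intervalIntegral.integral_eq_sub_of_hasDerivAt_of_le hpi.le hF.continuousOn hd
    ((intervalIntegrable_logSinHalf _ _).mul_continuousOn Real.continuous_cos.continuousOn)]
  simp [F]

theorem integral_evenKernel_mul_cos (y : ℝ) :
    ∫ x in (0)..Real.pi, evenKernel x y * Real.cos x = Real.pi * Real.cos y := by
  have hi := intervalIntegrable_logSinHalf
  have hic : ∀ a b, IntervalIntegrable (fun v => logSinHalf v * Real.cos v) volume a b :=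
    fun a b => (hi a b).mul_continuousOn Real.continuous_cos.continuousOn
  have his : ∀ a b, IntervalIntegrable (fun v => logSinHalf v * Real.sin v) volume a b :=
    fun a b => (hi a b).mul_continuousOn Real.continuous_sin.continuousOn
  have hif : ∀ a b, IntervalIntegrable (fun v => logSinHalf v * Real.cos (v - y)) volume a b :=
    fun a b => (hi a b).mul_continuousOn (by fun_prop)
  have h1 := integral_sub_add_integral_add (f := fun v => logSinHalf v * Real.cos (v - y))
    (fun v => by
      simp only [logSinHalf_periodic v]
      rw [show v + 2 * Real.pi - y = v - y + 2 * Real.pi by ring, Real.cos_add_two_pi]) hif y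
  have h2 : ∫ v in (-Real.pi)..Real.pi, logSinHalf v * Real.cos v = -Real.pi := by
    rw [integral_symm_of_even (fun v => by rw [logSinHalf_neg, Real.cos_neg]) _ hic,
      integral_logSinHalf_mul_cos]
    ring
  have h3 : ∫ v in (-Real.pi)..Real.pi, logSinHalf v * Real.sin v = 0 := by
    have := intervalIntegral.integral_comp_neg (a := -Real.pi) (b := Real.pi)
      (fun v => logSinHalf v * Real.sin v)
    simp only [logSinHalf_neg, Real.sin_neg, neg_neg, mul_neg, intervalIntegral.integral_neg] at this
    linarith
  have h4 : ∫ v in (-Real.pi)..Real.pi, logSinHalf v * Real.cos (v - y)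
      = -Real.pi * Real.cos y := by
    simp only [Real.cos_sub, mul_add, ← mul_assoc]
    rw [intervalIntegral.integral_add ((hic _ _).mul_const _) ((his _ _).mul_const _),
      intervalIntegral.integral_mul_const, intervalIntegral.integral_mul_const, h2, h3]
    ring
  have h5 : ∀ x, evenKernel x y * Real.cos x = 2 * logSinHalf y * Real.cos x -
      logSinHalf (y - x) * Real.cos (y - x - y) - logSinHalf (y + x) * Real.cos (y + x - y) := by
    intro x
    rw [show y - x - y = -x by ring, show y + x - y = x by ring, Real.cos_neg,
      show y - x = -(x - y) by ring, logSinHalf_neg, evenKernel, add_comm y x]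
    ring
  simp only [h5]
  have j0 : IntervalIntegrable (fun x => 2 * logSinHalf y * Real.cos x) volume 0 Real.pi :=
    Continuous.intervalIntegrable (by fun_prop) _ _
  have j1 := intervalIntegrable_comp_sub hif y 0 Real.pi
  have j2 := intervalIntegrable_comp_add hif y 0 Real.pi
  rw [intervalIntegral.integral_sub (j0.sub j1) j2, intervalIntegral.integral_sub j0 j1,
    intervalIntegral.integral_const_mul, integral_cos, Real.sin_pi, Real.sin_zero]
  rw [h4] at h1
  linarith

/-- `1 - cos` is an eigenfunction: testing `cuspOp u` against `cos` returns the same moment. -/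
theorem integral_cuspOp_mul_cos {u : ℝ → ℝ} (hu : Continuous u) :
    ∫ x in (0)..Real.pi, cuspOp u x * Real.cos x = ∫ y in (0)..Real.pi, u y * Real.cos y := by
  have hpi := Real.pi_pos
  obtain ⟨M, hM⟩ := isCompact_Icc.exists_bound_of_continuousOn
    (s := Icc 0 Real.pi) hu.continuousOn
  have hmeas : Measurable (Function.uncurry fun x y => evenKernel x y * u y * Real.cos x) := by
    have := measurable_logSinHalf
    have := hu.measurable
    unfold Function.uncurry evenKernel
    fun_prop
  have hintegral : Integrable (Function.uncurry fun x y => evenKernel x y * u y * Real.cos x)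
      ((volume.restrict (Ioc 0 Real.pi)).prod (volume.restrict (Ioc 0 Real.pi))) := by
    rw [integrable_prod_iff hmeas.aestronglyMeasurable]
    refine ⟨Filter.Eventually.of_forall fun x => ?_, ?_⟩
    · have := (intervalIntegrable_evenKernel_mul hu x 0 Real.pi).mul_const (Real.cos x)
      exact (intervalIntegrable_iff_integrableOn_Ioc_of_le hpi.le).1 this
    · refine Integrable.mono' (g := fun _ => Real.pi * (cuspOpConst * √Real.pi) * M)
        (integrable_const _) ?_ ?_
      · exact (hmeas.norm.stronglyMeasurable.integral_prod_right').aestronglyMeasurable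
      · refine (ae_restrict_iff' measurableSet_Ioc).2 (Filter.Eventually.of_forall fun x hx => ?_)
        rw [Real.norm_of_nonneg (integral_nonneg fun _ => norm_nonneg _)]
        simp only [Function.uncurry]
        rw [← intervalIntegral.integral_of_le hpi.le]
        have h1 : ∫ y in (0)..Real.pi, ‖evenKernel x y * u y * Real.cos x‖ ≤
            ∫ y in (0)..Real.pi, |evenKernel x y| * M := by
          refine intervalIntegral.integral_mono_on hpi.le
            ((intervalIntegrable_evenKernel_mul hu x 0 Real.pi).mul_const (Real.cos x)).norm
            ((intervalIntegrable_evenKernel x _ _).abs.mul_const _) fun y hy => ?_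
          rw [norm_mul, norm_mul, mul_assoc]
          refine mul_le_mul_of_nonneg_left ?_ (abs_nonneg _)
          calc _ ≤ ‖u y‖ * 1 :=
                mul_le_mul_of_nonneg_left (Real.abs_cos_le_one x) (norm_nonneg _)
            _ ≤ M := by rw [mul_one]; exact hM y hy
        rw [intervalIntegral.integral_mul_const] at h1
        refine h1.trans (mul_le_mul_of_nonneg_right ?_
          ((norm_nonneg _).trans (hM 0 ⟨le_rfl, hpi.le⟩)))
        have h2 := integral_abs_evenKernel_sub_le x 0
        simp only [evenKernel_zero, sub_zero] at h2
        have h3 : √|x| ≤ √Real.pi := Real.sqrt_le_sqrt (by rw [abs_of_pos hx.1]; exact hx.2)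
        have h4 := mul_le_mul_of_nonneg_left h3 (mul_nonneg hpi.le cuspOpConst_nonneg)
        have h5 : Real.pi * cuspOpConst = 4 * ∫ v in (-Real.pi)..Real.pi, invSqrtSinHalf v := by
          rw [cuspOpConst]; field_simp
        rw [← h5] at h2
        linarith
  have hswap := integral_integral_swap hintegral
  simp only [← intervalIntegral.integral_of_le hpi.le] at hswap
  have e1 : ∀ x, cuspOp u x * Real.cos x =
      (1 / Real.pi) * ∫ y in (0)..Real.pi, evenKernel x y * u y * Real.cos x := fun x => by
    rw [intervalIntegral.integral_mul_const, cuspOp, mul_assoc]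
  simp only [e1]
  rw [intervalIntegral.integral_const_mul, hswap]
  have e2 : ∀ y, ∫ x in (0)..Real.pi, evenKernel x y * u y * Real.cos x =
      Real.pi * (u y * Real.cos y) := fun y => by
    simp only [mul_right_comm _ (u y)]
    rw [intervalIntegral.integral_mul_const, integral_evenKernel_mul_cos]; ring
  simp only [e2]
  rw [intervalIntegral.integral_const_mul]
  field_simp

theorem abs_sqrt_sub_sqrt_le (a b : ℝ) : |√a - √b| ≤ √|a - b| := by
  have h : ∀ a b : ℝ, √a ≤ √b + √|a - b| := fun a b => by
    refine Real.sqrt_le_iff.2 ⟨by positivity, ?_⟩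
    have h0 : a ≤ √b ^ 2 + |a - b| := by
      rcases le_total 0 b with hb | hb
      · rw [Real.sq_sqrt hb]; linarith [le_abs_self (a - b)]
      · rw [Real.sqrt_eq_zero_of_nonpos hb]; linarith [le_abs_self (a - b)]
    nlinarith [mul_nonneg (Real.sqrt_nonneg b) (Real.sqrt_nonneg |a - b|),
      Real.sq_sqrt (abs_nonneg (a - b))]
  rw [abs_le]
  have h1 := h a b
  have h2 := h b a
  rw [abs_sub_comm] at h2
  constructor <;> linarith

/-- The extension of a function on `[0, π]` to the line, constant outside. -/
noncomputable def extendPi (v : C(Icc (0 : ℝ) Real.pi, ℝ)) : ℝ → ℝ :=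
  IccExtend Real.pi_pos.le v

theorem continuous_extendPi (v : C(Icc (0 : ℝ) Real.pi, ℝ)) : Continuous (extendPi v) :=
  v.continuous.Icc_extend'

theorem extendPi_of_mem (v : C(Icc (0 : ℝ) Real.pi, ℝ)) {x : ℝ} (hx : x ∈ Icc 0 Real.pi) :
    extendPi v x = v ⟨x, hx⟩ := IccExtend_of_mem _ _ hx

theorem abs_extendPi_sub_le (v w : C(Icc (0 : ℝ) Real.pi, ℝ)) (y : ℝ) :
    |extendPi v y - extendPi w y| ≤ dist v w :=
  ContinuousMap.dist_apply_le_dist (f := v) (g := w) (projIcc 0 Real.pi Real.pi_pos.le y)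

theorem abs_cuspOp_extendPi_sub_le (v w : C(Icc (0 : ℝ) Real.pi, ℝ)) {x : ℝ}
    (hx : x ∈ Icc 0 Real.pi) :
    |cuspOp (extendPi v) x - cuspOp (extendPi w) x| ≤ 2 * cuspOpConst * dist v w := by
  have hv := continuous_extendPi v
  have hw := continuous_extendPi w
  rw [← cuspOp_sub hv hw]
  refine (abs_cuspOp_le (hv.sub hw) (fun y _ => abs_extendPi_sub_le v w y) x).trans ?_
  have h1 : √|x| ≤ 2 := by
    rw [abs_of_nonneg hx.1]
    refine Real.sqrt_le_iff.2 ⟨by norm_num, ?_⟩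
    linarith [hx.2, Real.pi_le_four]
  have := mul_le_mul_of_nonneg_left h1 (mul_nonneg cuspOpConst_nonneg (dist_nonneg (x := v) (y := w)))
  linarith

/-- The perturbed fixed-point map. -/
noncomputable def cuspMap (ε : ℝ) (v : C(Icc (0 : ℝ) Real.pi, ℝ)) :
    C(Icc (0 : ℝ) Real.pi, ℝ) where
  toFun x := √(2 * cuspOp (extendPi v) x + 2 * ε * (1 - Real.cos x))
  continuous_toFun := by
    have := continuous_cuspOp (continuous_extendPi v)
    fun_prop

theorem continuous_cuspMap (ε : ℝ) : Continuous (cuspMap ε) := by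
  rw [continuous_iff_continuousAt]
  intro w
  rw [ContinuousAt, tendsto_iff_dist_tendsto_zero]
  refine squeeze_zero (g := fun v => √(4 * cuspOpConst * dist v w)) (fun _ => dist_nonneg)
    (fun v => ?_) ?_
  · refine (ContinuousMap.dist_le (Real.sqrt_nonneg _)).2 fun x => ?_
    refine (abs_sqrt_sub_sqrt_le _ _).trans (Real.sqrt_le_sqrt ?_)
    have := abs_cuspOp_extendPi_sub_le v w x.2
    rw [show ∀ a b c : ℝ, 2 * a + c - (2 * b + c) = 2 * (a - b) from fun a b c => by ring,
      abs_mul, abs_two]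
    linarith
  · have : Continuous fun v => √(4 * cuspOpConst * dist v w) := by fun_prop
    simpa using this.tendsto w

/-- Increasing functions on `[0, π]` with values in `[0, M]` and Hölder constant `B`. -/
def profileSet (M B : ℝ) : Set C(Icc (0 : ℝ) Real.pi, ℝ) :=
  {v | (∀ x, v x ∈ Icc 0 M) ∧ (∀ x y, x ≤ y → v x ≤ v y) ∧
    ∀ x y, |v x - v y| ≤ B * √√(dist x y)}

theorem isCompact_profileSet (M B : ℝ) : IsCompact (profileSet M B) := by
  have hmod : Filter.Tendsto (fun r : ℝ => B * √√r) (nhds 0) (nhds 0) := by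
    have : Continuous fun r : ℝ => B * √√r := by fun_prop
    simpa using this.tendsto 0
  apply ArzelaAscoli.isCompact_of_equicontinuous
  · have himg : ContinuousMap.toFun '' profileSet M B =
        {f : Icc (0 : ℝ) Real.pi → ℝ | (∀ x, f x ∈ Icc 0 M) ∧ (∀ x y, x ≤ y → f x ≤ f y) ∧
          ∀ x y, |f x - f y| ≤ B * √√(dist x y)} := by
      ext f
      constructor
      · rintro ⟨v, hv, rfl⟩
        exact hv
      · intro hf
        refine ⟨⟨f, ?_⟩, hf, rfl⟩
        rw [continuous_iff_continuousAt]
        intro x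
        rw [ContinuousAt, tendsto_iff_dist_tendsto_zero]
        refine squeeze_zero (fun _ => dist_nonneg) (fun y => hf.2.2 y x) ?_
        have : Continuous fun y => B * √√(dist y x) := by fun_prop
        simpa using this.tendsto x
    rw [himg]
    refine (isCompact_univ_pi fun _ => isCompact_Icc (a := (0 : ℝ)) (b := M)).of_isClosed_subset
      ?_ fun f hf x _ => hf.1 x
    simp only [ofPred_and, ofPred_forall]
    refine IsClosed.inter ?_ (IsClosed.inter ?_ ?_)
    · exact isClosed_iInter fun x => isClosed_Icc.preimage (continuous_apply x)
    · exact isClosed_iInter fun x => isClosed_iInter fun y => isClosed_iInter fun _ =>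
        isClosed_le (continuous_apply x) (continuous_apply y)
    · exact isClosed_iInter fun x => isClosed_iInter fun y =>
        isClosed_le ((continuous_apply x).sub (continuous_apply y)).abs continuous_const
  · refine Metric.equicontinuous_of_continuity_modulus (fun r => B * √√r) hmod _ ?_
    intro x y v
    exact v.2.2.2 x y

theorem convex_profileSet (M B : ℝ) : Convex ℝ (profileSet M B) := by
  intro v hv w hw a b ha hb hab
  refine ⟨fun x => ?_, fun x y hxy => ?_, fun x y => ?_⟩
  · exact convex_Icc 0 M (hv.1 x) (hw.1 x) ha hb hab
  · exact add_le_add (mul_le_mul_of_nonneg_left (hv.2.1 x y hxy) ha)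
      (mul_le_mul_of_nonneg_left (hw.2.1 x y hxy) hb)
  · have h1 := mul_le_mul_of_nonneg_left (hv.2.2 x y) ha
    have h2 := mul_le_mul_of_nonneg_left (hw.2.2 x y) hb
    have e : (a • v + b • w) x - (a • v + b • w) y = a * (v x - v y) + b * (w x - w y) := by
      simp; ring
    rw [e]
    calc _ ≤ |a * (v x - v y)| + |b * (w x - w y)| := abs_add_le _ _
      _ ≤ a * (B * √√(dist x y)) + b * (B * √√(dist x y)) := by
          rw [abs_mul, abs_mul, abs_of_nonneg ha, abs_of_nonneg hb]; exact add_le_add h1 h2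
      _ = _ := by rw [← add_mul, hab, one_mul]

theorem monotone_extendPi {M B : ℝ} {v : C(Icc (0 : ℝ) Real.pi, ℝ)} (hv : v ∈ profileSet M B) :
    Monotone (extendPi v) :=
  Monotone.IccExtend _ fun x y hxy => hv.2.1 x y hxy

theorem mapsTo_cuspMap {ε M : ℝ} (hε0 : 0 ≤ ε) (hε1 : ε ≤ 1) (hM0 : 0 ≤ M)
    (hM : 4 * cuspOpConst * M + 4 ≤ M ^ 2) :
    MapsTo (cuspMap ε) (profileSet M √(2 * cuspOpConst * M + 4))
      (profileSet M √(2 * cuspOpConst * M + 4)) := by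
  intro v hv
  have hpi := Real.pi_pos
  have hc := cuspOpConst_nonneg
  have hvc := continuous_extendPi v
  have hvM : ∀ y ∈ Icc 0 Real.pi, |extendPi v y| ≤ M := fun y hy => by
    rw [extendPi_of_mem v hy, abs_of_nonneg (hv.1 _).1]; exact (hv.1 _).2
  have hmono : ∀ x y : Icc (0 : ℝ) Real.pi, x ≤ y →
      2 * cuspOp (extendPi v) x + 2 * ε * (1 - Real.cos x) ≤
        2 * cuspOp (extendPi v) y + 2 * ε * (1 - Real.cos y) := fun x y hxy => by
    have h1 := cuspOp_mono hvc (monotone_extendPi hv) x.2.1 hxy y.2.2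
    have h2 := Real.cos_le_cos_of_nonneg_of_le_pi x.2.1 y.2.2 hxy
    have := mul_le_mul_of_nonneg_left h2 hε0
    linarith
  refine ⟨fun x => ⟨Real.sqrt_nonneg _, ?_⟩, fun x y hxy => Real.sqrt_le_sqrt (hmono x y hxy),
    fun x y => ?_⟩
  · refine Real.sqrt_le_iff.2 ⟨hM0, ?_⟩
    have h1 := (abs_le.1 (abs_cuspOp_le hvc hvM x)).2
    have h2 : √|(x : ℝ)| ≤ 2 := by
      rw [abs_of_nonneg x.2.1]
      refine Real.sqrt_le_iff.2 ⟨by norm_num, ?_⟩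
      linarith [x.2.2, Real.pi_le_four]
    have h3 := mul_le_mul_of_nonneg_left h2 (mul_nonneg hc hM0)
    have h4 : ε * (1 - Real.cos x) ≤ 1 * 2 := by
      refine mul_le_mul hε1 (by linarith [Real.neg_one_le_cos (x : ℝ)])
        (by linarith [Real.cos_le_one (x : ℝ)]) zero_le_one
    linarith
  · refine (abs_sqrt_sub_sqrt_le _ _).trans ?_
    rw [← Real.sqrt_mul (by positivity)]
    refine Real.sqrt_le_sqrt ?_
    have h1 := abs_cuspOp_sub_le hvc hvM x y
    have h2 : |Real.cos x - Real.cos y| ≤ |(x : ℝ) - y| := Real.abs_cos_sub_cos_le _ _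
    have h3 : |(x : ℝ) - y| ≤ 2 * √|(x : ℝ) - y| := by
      have h4 : √|(x : ℝ) - y| ≤ 2 := by
        refine Real.sqrt_le_iff.2 ⟨by norm_num, ?_⟩
        rw [abs_le]
        constructor <;> linarith [x.2.1, x.2.2, y.2.1, y.2.2, Real.pi_le_four]
      have := Real.mul_self_sqrt (abs_nonneg ((x : ℝ) - y))
      nlinarith [Real.sqrt_nonneg |(x : ℝ) - y|]
    have h5 : |ε * (Real.cos x - Real.cos y)| ≤ |(x : ℝ) - y| := by
      rw [abs_mul, abs_of_nonneg hε0]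
      nlinarith [abs_nonneg (Real.cos x - Real.cos y)]
    change |2 * cuspOp (extendPi v) x + 2 * ε * (1 - Real.cos x) -
        (2 * cuspOp (extendPi v) y + 2 * ε * (1 - Real.cos y))| ≤
      (2 * cuspOpConst * M + 4) * √|(x : ℝ) - y|
    rw [show 2 * cuspOp (extendPi v) x + 2 * ε * (1 - Real.cos x) -
        (2 * cuspOp (extendPi v) y + 2 * ε * (1 - Real.cos y)) =
      2 * (cuspOp (extendPi v) x - cuspOp (extendPi v) y) -
        2 * (ε * (Real.cos x - Real.cos y)) by ring]
    refine (abs_sub _ _).trans ?_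
    rw [abs_mul, abs_mul, abs_two]
    linarith

/-- A solution of the perturbed equation cannot stay below `1`. -/
theorem one_le_of_perturbed {ε : ℝ} (hε : 0 < ε) {u : ℝ → ℝ} (hu : Continuous u)
    (hm : Monotone u)
    (h : ∀ x ∈ Icc 0 Real.pi, u x ^ 2 / 2 = cuspOp u x + ε * (1 - Real.cos x)) :
    1 ≤ u Real.pi := by
  by_contra! hlt
  have hpi := Real.pi_pos
  have hcc := continuous_cuspOp hu
  have h1 : ∫ x in (0)..Real.pi, -Real.cos x * (u x - u x ^ 2 / 2) = -(ε * (Real.pi / 2)) := by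
    have e : ∀ x ∈ uIcc 0 Real.pi, -Real.cos x * (u x - u x ^ 2 / 2) =
        cuspOp u x * Real.cos x - u x * Real.cos x + ε * (Real.cos x - Real.cos x ^ 2) := by
      intro x hx
      rw [uIcc_of_le hpi.le] at hx
      rw [h x hx]; ring
    rw [intervalIntegral.integral_congr e, intervalIntegral.integral_add,
      intervalIntegral.integral_sub, integral_cuspOp_mul_cos hu,
      intervalIntegral.integral_const_mul, intervalIntegral.integral_sub, integral_cos,
      integral_cos_sq]
    · simp
    all_goals exact Continuous.intervalIntegrable (by fun_prop) _ _
  have h2 : 0 ≤ ∫ x in (0)..Real.pi, -Real.cos x * (u x - u x ^ 2 / 2) := by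
    refine integral_mul_nonneg_of_pivot (u := fun x => u x - u x ^ 2 / 2) (c := Real.pi / 2) hpi.le
      (Continuous.intervalIntegrable (by fun_prop) _ _) (by simp)
      (Continuous.intervalIntegrable (by fun_prop) _ _) (Filter.Eventually.of_forall ?_)
    intro y hy
    have hy1 : u y ≤ u Real.pi := hm hy.2
    have hy2 : u (Real.pi / 2) ≤ u Real.pi := hm (by linarith)
    rw [show u y - u y ^ 2 / 2 - (u (Real.pi / 2) - u (Real.pi / 2) ^ 2 / 2) =
      (u y - u (Real.pi / 2)) * (1 - (u y + u (Real.pi / 2)) / 2) by ring]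
    rcases le_total y (Real.pi / 2) with hc | hc
    · have := Real.cos_nonneg_of_neg_pi_div_two_le_of_le (by linarith [hy.1]) hc
      exact mul_nonneg_of_nonpos_of_nonpos (by linarith)
        (mul_nonpos_of_nonpos_of_nonneg (by linarith [hm hc]) (by linarith))
    · have := Real.cos_nonpos_of_pi_div_two_le_of_le hc (by linarith [hy.2])
      exact mul_nonneg (by linarith) (mul_nonneg (by linarith [hm hc]) (by linarith))
  have := mul_pos hε hpi
  linarith

theorem exists_perturbed {ε M : ℝ} (hε0 : 0 ≤ ε) (hε1 : ε ≤ 1) (hM0 : 0 ≤ M)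
    (hM : 4 * cuspOpConst * M + 4 ≤ M ^ 2) :
    ∃ v ∈ profileSet M √(2 * cuspOpConst * M + 4), ∀ x ∈ Icc 0 Real.pi,
      extendPi v x ^ 2 / 2 = cuspOp (extendPi v) x + ε * (1 - Real.cos x) := by
  obtain ⟨v, hv, hfix⟩ := exists_fixedPoint_of_isCompact_convex
    (isCompact_profileSet M √(2 * cuspOpConst * M + 4)) (convex_profileSet _ _)
    ⟨0, fun x => ⟨le_rfl, hM0⟩, fun x y _ => le_rfl, fun x y => by simp; positivity⟩
    (cuspMap ε) (continuous_cuspMap ε).continuousOn (mapsTo_cuspMap hε0 hε1 hM0 hM)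
  refine ⟨v, hv, fun x hx => ?_⟩
  have h1 : v ⟨x, hx⟩ = √(2 * cuspOp (extendPi v) x + 2 * ε * (1 - Real.cos x)) :=
    congrArg (fun w : C(Icc (0 : ℝ) Real.pi, ℝ) => w ⟨x, hx⟩) hfix.symm
  have h2 : 0 ≤ 2 * cuspOp (extendPi v) x + 2 * ε * (1 - Real.cos x) := by
    have h3 := cuspOp_mono (continuous_extendPi v) (monotone_extendPi hv) le_rfl hx.1 hx.2
    rw [cuspOp_zero] at h3
    have := mul_nonneg hε0 (sub_nonneg.2 (Real.cos_le_one x))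
    linarith
  rw [extendPi_of_mem v hx, h1, Real.sq_sqrt h2]
  ring

theorem exists_cusp_profile : ∃ u : ℝ → ℝ, Continuous u ∧ Monotone u ∧ u 0 = 0 ∧
    1 ≤ u Real.pi ∧ ∀ x ∈ Icc 0 Real.pi, u x ^ 2 / 2 = cuspOp u x := by
  have hc := cuspOpConst_nonneg
  have hpi := Real.pi_pos
  set M : ℝ := 4 * cuspOpConst + 4 with hMdef
  have hM0 : 0 ≤ M := by positivity
  have hM : 4 * cuspOpConst * M + 4 ≤ M ^ 2 := by rw [hMdef]; nlinarith
  choose v hvK hv using fun n : ℕ => exists_perturbed (ε := 1 / ((n : ℝ) + 1)) (by positivity)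
    (by rw [div_le_one (by positivity)]; linarith [n.cast_nonneg (α := ℝ)]) hM0 hM
  obtain ⟨w, hwK, φ, hφ, hlim⟩ := (isCompact_profileSet M _).tendsto_subseq hvK
  have hev : ∀ x, Filter.Tendsto (fun n => extendPi (v (φ n)) x) Filter.atTop
      (nhds (extendPi w x)) := fun x =>
    ((continuous_eval_const (F := C(Icc (0 : ℝ) Real.pi, ℝ)) (projIcc 0 Real.pi hpi.le x)).tendsto w).comp hlim
  have hop : ∀ x ∈ Icc 0 Real.pi, Filter.Tendsto (fun n => cuspOp (extendPi (v (φ n))) x)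
      Filter.atTop (nhds (cuspOp (extendPi w) x)) := fun x hx => by
    rw [tendsto_iff_dist_tendsto_zero]
    refine squeeze_zero (fun _ => dist_nonneg)
      (fun n => abs_cuspOp_extendPi_sub_le (v (φ n)) w hx) ?_
    simpa using (tendsto_iff_dist_tendsto_zero.1 hlim).const_mul (2 * cuspOpConst)
  have heq : ∀ x ∈ Icc 0 Real.pi, extendPi w x ^ 2 / 2 = cuspOp (extendPi w) x := fun x hx => by
    have h1 := ((hev x).pow 2).div_const 2
    have h2 : Filter.Tendsto (fun n => cuspOp (extendPi (v (φ n))) x +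
        1 / ((φ n : ℝ) + 1) * (1 - Real.cos x)) Filter.atTop
        (nhds (cuspOp (extendPi w) x + 0 * (1 - Real.cos x))) :=
      (hop x hx).add ((tendsto_one_div_add_atTop_nhds_zero_nat.comp hφ.tendsto_atTop).mul_const _)
    rw [zero_mul, add_zero] at h2
    exact tendsto_nhds_unique (h1.congr fun n => hv (φ n) x hx) h2
  refine ⟨extendPi w, continuous_extendPi w, monotone_extendPi hwK, ?_, ?_, heq⟩
  · have := heq 0 ⟨le_rfl, hpi.le⟩
    rw [cuspOp_zero] at this
    exact pow_eq_zero_iff two_ne_zero |>.1 (by linarith)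
  · exact ge_of_tendsto' (hev Real.pi) fun n =>
      one_le_of_perturbed (by positivity) (continuous_extendPi _) (monotone_extendPi (hvK _))
        (hv (φ n))

theorem sub_le_sub_of_hasDerivAt_le {f g f' g' : ℝ → ℝ} {a : ℝ}
    (hf : ∀ t, a ≤ t → HasDerivAt f (f' t) t) (hg : ∀ t, a ≤ t → HasDerivAt g (g' t) t)
    (h : ∀ t, a ≤ t → f' t ≤ g' t) {t : ℝ} (ht : a ≤ t) : f t - f a ≤ g t - g a := by
  have hd : ∀ t, a ≤ t → HasDerivAt (fun t => g t - f t) (g' t - f' t) t :=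
    fun t ht => (hg t ht).sub (hf t ht)
  have hmono : MonotoneOn (fun t => g t - f t) (Ici a) := by
    refine monotoneOn_of_deriv_nonneg (convex_Ici a)
      (fun t ht => (hd t ht).continuousAt.continuousWithinAt)
      (fun t ht => ?_) fun t ht => ?_
    all_goals rw [interior_Ici] at ht
    · exact (hd t (le_of_lt ht)).differentiableAt.differentiableWithinAt
    · rw [(hd t (le_of_lt ht)).deriv]
      exact sub_nonneg.2 (h t (le_of_lt ht))
  have := hmono self_mem_Ici ht ht
  simp only at this
  linarith

theorem hasDerivAt_sqrt_of_pos {W P : ℝ → ℝ} {t : ℝ} (h : HasDerivAt W (P t) t) (h0 : 0 < W t) :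
    HasDerivAt (fun t => √(W t)) (P t / (2 * √(W t))) t := h.sqrt h0.ne'

/-- If `W' ≤ c √W` then `√W` grows at most linearly. -/
theorem sqrt_le_of_deriv_le {P W : ℝ → ℝ} {a c : ℝ}
    (hW : ∀ t, a ≤ t → HasDerivAt W (P t) t) (h0 : ∀ t, a ≤ t → 0 < W t)
    (h : ∀ t, a ≤ t → P t ≤ c * √(W t)) {t : ℝ} (ht : a ≤ t) :
    √(W t) ≤ √(W a) + c / 2 * (t - a) := by
  have := sub_le_sub_of_hasDerivAt_le (g := fun t => c / 2 * t) (g' := fun _ => c / 2)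
    (fun t ht => hasDerivAt_sqrt_of_pos (hW t ht) (h0 t ht))
    (fun t _ => by simpa using (hasDerivAt_id t).const_mul (c / 2))
    (fun t ht => by
      have hs := Real.sqrt_pos.2 (h0 t ht)
      rw [div_le_iff₀ (by positivity)]
      linarith [h t ht]) ht
  linarith

/-- If `W' ≥ c √W` then `√W` grows at least linearly. -/
theorem le_sqrt_of_le_deriv {P W : ℝ → ℝ} {a c : ℝ}
    (hW : ∀ t, a ≤ t → HasDerivAt W (P t) t) (h0 : ∀ t, a ≤ t → 0 < W t)
    (h : ∀ t, a ≤ t → c * √(W t) ≤ P t) {t : ℝ} (ht : a ≤ t) :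
    √(W a) + c / 2 * (t - a) ≤ √(W t) := by
  have := sub_le_sub_of_hasDerivAt_le (f := fun t => c / 2 * t) (f' := fun _ => c / 2)
    (fun t _ => by simpa using (hasDerivAt_id t).const_mul (c / 2))
    (fun t ht => hasDerivAt_sqrt_of_pos (hW t ht) (h0 t ht))
    (fun t ht => by
      have hs := Real.sqrt_pos.2 (h0 t ht)
      rw [le_div_iff₀ (by positivity)]
      linarith [h t ht]) ht
  linarith

/-- Asymptotics of solutions of `W' = P`, `(π/2) P² = W + O(t)`. -/
theorem exists_abs_sub_div_pi_le {P W : ℝ → ℝ} {t₀ m C : ℝ} (hm : 0 < m) (hC : 0 < C)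
    (hW : ∀ t, t₀ ≤ t → HasDerivAt W (P t) t) (hWm : ∀ t, t₀ ≤ t → m ≤ W t)
    (hP : ∀ t, t₀ ≤ t → 0 ≤ P t) (h1 : ∀ t, t₀ ≤ t → W t ≤ C * (P t ^ 2 + P t))
    (h2 : ∀ t, t₀ ≤ t → |Real.pi / 2 * P t ^ 2 - W t| ≤ C * (1 + t)) :
    ∃ D > 0, ∃ t₁ ≥ 1, ∀ t ≥ t₁, |P t - t / Real.pi| ≤ D * √t := by
  have hpi := Real.pi_pos
  have h0 : ∀ t, t₀ ≤ t → 0 < W t := fun t ht => hm.trans_le (hWm t ht)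
  -- linear lower bound for `√W`
  obtain ⟨c, hc, hcP⟩ : ∃ c > 0, ∀ t, t₀ ≤ t → c * √(W t) ≤ P t := by
    refine ⟨min (√m / (2 * C)) (1 / √(2 * C)), by positivity, fun t ht => ?_⟩
    have hs := Real.sqrt_nonneg (W t)
    rcases le_total (P t) 1 with hp | hp
    · have e1 : √m * √(W t) ≤ W t := by
        have := Real.sqrt_le_sqrt (hWm t ht)
        nlinarith [Real.mul_self_sqrt (h0 t ht).le]
      have e2 : W t ≤ 2 * C * P t := by
        have : P t ^ 2 ≤ P t := by nlinarith [hP t ht]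
        nlinarith [h1 t ht]
      calc _ ≤ √m / (2 * C) * √(W t) := mul_le_mul_of_nonneg_right (min_le_left _ _) hs
        _ = √m * √(W t) / (2 * C) := by ring
        _ ≤ P t := by rw [div_le_iff₀ (by positivity)]; linarith
    · have e2 : W t ≤ 2 * C * P t ^ 2 := by
        have : P t ≤ P t ^ 2 := by nlinarith
        nlinarith [h1 t ht]
      calc _ ≤ 1 / √(2 * C) * √(W t) := mul_le_mul_of_nonneg_right (min_le_right _ _) hs
        _ = √(W t) / √(2 * C) := by ring
        _ ≤ P t := by
          rw [div_le_iff₀ (by positivity)]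
          refine (Real.sqrt_le_sqrt e2).trans ?_
          rw [Real.sqrt_mul (by positivity), Real.sqrt_sq (hP t ht), mul_comm]
  set k : ℝ := √(2 / Real.pi) with hk
  have hk0 : 0 < k := by positivity
  have hk2 : k ^ 2 = 2 / Real.pi := Real.sq_sqrt (by positivity)
  set T : ℝ := max 1 (2 * t₀) with hT
  have hT1 : 1 ≤ T := le_max_left _ _
  have hT0 : t₀ ≤ T := by
    rcases le_total t₀ 0 with h | h
    · linarith
    · exact (by linarith : t₀ ≤ 2 * t₀).trans (le_max_right _ _)
  set R : ℝ → ℝ := fun t => √(W t) with hR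
  have hRt : ∀ t, T ≤ t → c / 4 * t ≤ R t := fun t ht => by
    have e1 := le_sqrt_of_le_deriv hW h0 hcP (hT0.trans ht)
    have e2 : 2 * t₀ ≤ t := (le_max_right _ _).trans ht
    have e3 := Real.sqrt_nonneg (W t₀)
    have e4 : c / 4 * t ≤ c / 2 * (t - t₀) := by nlinarith
    simp only [hR]; linarith
  have hRsq : ∀ t, T ≤ t → R t ^ 2 = W t := fun t ht => Real.sq_sqrt (h0 t (hT0.trans ht)).le
  -- `P` stays close to `k R`
  set A : ℝ := 16 * C / (Real.pi * k * c) with hA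
  have hA0 : 0 < A := by positivity
  have hPR : ∀ t, T ≤ t → |P t - k * R t| ≤ A := fun t ht => by
    have ht0 : 0 < t := by linarith
    have e0 := hRt t ht
    have e1 : 0 < R t := lt_of_lt_of_le (by positivity) e0
    have e2 : |P t - k * R t| * (P t + k * R t) ≤ 2 / Real.pi * (C * (1 + t)) := by
      have e3 : 0 ≤ P t + k * R t := add_nonneg (hP t (hT0.trans ht)) (by positivity)
      rw [← abs_of_nonneg e3, ← abs_mul]
      have e4 : (P t - k * R t) * (P t + k * R t) =
          2 / Real.pi * (Real.pi / 2 * P t ^ 2 - W t) := by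
        have : (P t - k * R t) * (P t + k * R t) = P t ^ 2 - k ^ 2 * R t ^ 2 := by ring
        rw [this, hk2, hRsq t ht]
        field_simp
      rw [e4, abs_mul, abs_of_pos (by positivity : 0 < 2 / Real.pi)]
      exact mul_le_mul_of_nonneg_left (h2 t (hT0.trans ht)) (by positivity)
    have e5 : |P t - k * R t| * (k * (c / 4 * t)) ≤ 2 / Real.pi * (C * (2 * t)) := by
      calc _ ≤ |P t - k * R t| * (P t + k * R t) := by
            refine mul_le_mul_of_nonneg_left ?_ (abs_nonneg _)
            have := mul_le_mul_of_nonneg_left e0 hk0.le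
            linarith [hP t (hT0.trans ht)]
        _ ≤ _ := e2
        _ ≤ _ := by
            refine mul_le_mul_of_nonneg_left ?_ (by positivity)
            exact mul_le_mul_of_nonneg_left (by linarith) hC.le
    have e6 : A * (k * (c / 4 * t)) = 2 / Real.pi * (C * (2 * t)) := by
      rw [hA]; field_simp; norm_num
    rw [← e6] at e5
    exact le_of_mul_le_mul_right e5 (by positivity)
  -- integrate `R' = k / 2 + O(1 / R)`
  set B : ℝ := 2 * A / c with hB
  have hB0 : 0 < B := by positivity
  have hRd : ∀ t, T ≤ t → HasDerivAt R (P t / (2 * R t)) t := fun t ht =>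
    hasDerivAt_sqrt_of_pos (hW t (hT0.trans ht)) (h0 t (hT0.trans ht))
  have hRd2 : ∀ t, T ≤ t → |P t / (2 * R t) - k / 2| ≤ B / √t := fun t ht => by
    have ht0 : 0 < t := by linarith
    have e0 := hRt t ht
    have e1 : 0 < R t := lt_of_lt_of_le (by positivity) e0
    have e2 : P t / (2 * R t) - k / 2 = (P t - k * R t) / (2 * R t) := by field_simp
    rw [e2, abs_div, abs_of_pos (by positivity : 0 < 2 * R t)]
    have e3 : √t ≤ t := by
      rw [Real.sqrt_le_iff]; exact ⟨ht0.le, by nlinarith⟩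
    calc _ ≤ A / (2 * (c / 4 * t)) := by
          refine div_le_div₀ hA0.le (hPR t ht) (by positivity) (by linarith)
      _ = B / t := by rw [hB]; field_simp; norm_num
      _ ≤ _ := div_le_div_of_nonneg_left hB0.le (Real.sqrt_pos.2 ht0) e3
  have hsd : ∀ t, T ≤ t → HasDerivAt (fun t => 2 * B * √t) (B / √t) t := fun t ht => by
    have ht0 : 0 < t := by linarith
    have := (Real.hasDerivAt_sqrt ht0.ne').const_mul (2 * B)
    refine this.congr_deriv ?_
    field_simp
  have hld : ∀ t, HasDerivAt (fun t => k / 2 * t) (k / 2) t := fun t => by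
    simpa using (hasDerivAt_id t).const_mul (k / 2)
  set G : ℝ := |R T - k / 2 * T| with hG
  have hRfin : ∀ t, T ≤ t → |R t - k / 2 * t| ≤ G + 2 * B * √t := fun t ht => by
    have u1 := sub_le_sub_of_hasDerivAt_le (f := fun t => R t - k / 2 * t)
      (fun t ht => (hRd t ht).sub (hld t)) hsd (fun t ht => (abs_le.1 (hRd2 t ht)).2) ht
    have u2 := sub_le_sub_of_hasDerivAt_le (g := fun t => R t - k / 2 * t)
      (fun t ht => (hsd t ht).neg) (fun t ht => (hRd t ht).sub (hld t))
      (fun t ht => (abs_le.1 (hRd2 t ht)).1) ht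
    simp only [Pi.neg_apply] at u1 u2
    have u3 : 0 ≤ 2 * B * √T := by positivity
    have u4 := abs_le.1 (le_refl G)
    rw [hG] at u4
    have u5 := neg_abs_le (R T - k / 2 * T)
    have u6 := le_abs_self (R T - k / 2 * T)
    rw [abs_le]
    constructor <;> linarith
  refine ⟨A + k * (G + 2 * B), by positivity, T, hT1, fun t ht => ?_⟩
  have ht1 : 1 ≤ t := hT1.trans ht
  have hs1 : 1 ≤ √t := Real.one_le_sqrt.2 ht1
  have e1 : P t - t / Real.pi = (P t - k * R t) + k * (R t - k / 2 * t) := by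
    have : t / Real.pi = k ^ 2 / 2 * t := by rw [hk2]; field_simp
    rw [this]; ring
  rw [e1]
  refine (abs_add_le _ _).trans ?_
  rw [abs_mul, abs_of_pos hk0]
  have e2 := hPR t ht
  have e3 := mul_le_mul_of_nonneg_left (hRfin t ht) hk0.le
  have hG0 : 0 ≤ G := abs_nonneg _
  calc _ ≤ A * 1 + k * (G * 1 + 2 * B * √t) := by linarith
    _ ≤ A * √t + k * (G * √t + 2 * B * √t) := by gcongr
    _ = _ := by ring

theorem sq_div_pi_sq_le_sinSqHalf {y : ℝ} (hy : y ∈ Icc 0 Real.pi) :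
    y ^ 2 / Real.pi ^ 2 ≤ sinSqHalf y := by
  have h := Real.mul_le_sin (x := y / 2) (by linarith [hy.1]) (by linarith [hy.2])
  have h2 : y / Real.pi ≤ Real.sin (y / 2) := by
    refine le_trans (le_of_eq ?_) h
    field_simp
  rw [← div_pow]
  exact pow_le_pow_left₀ (div_nonneg hy.1 Real.pi_pos.le) h2 2

theorem sinSqHalf_eq (y : ℝ) : sinSqHalf y = (1 - Real.cos y) / 2 := by
  rw [sinSqHalf, Real.sin_sq_eq_half_sub, show 2 * (y / 2) = y by ring]; ring

theorem sinSqHalf_le (y : ℝ) : sinSqHalf y ≤ y ^ 2 / 4 := by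
  rw [sinSqHalf_eq]
  linarith [Real.one_sub_sq_div_two_le_cos (x := y)]

theorem sq_div_four_sub_sinSqHalf_le {y : ℝ} (hy : 0 ≤ y) : y ^ 2 / 4 - sinSqHalf y ≤ y ^ 4 / 4 := by
  rcases le_total y 1 with h | h
  · have := (abs_le.1 (Real.cos_bound (x := y) (by rwa [abs_of_nonneg hy]))).2
    rw [abs_of_nonneg hy] at this
    rw [sinSqHalf_eq]
    nlinarith [pow_nonneg hy 4]
  · have h1 : 0 ≤ sinSqHalf y := sq_nonneg _
    have : y ^ 2 * 1 ≤ y ^ 2 * y ^ 2 := mul_le_mul_of_nonneg_left (one_le_pow₀ h) (sq_nonneg y)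
    nlinarith

theorem sinSqHalf_pos {y : ℝ} (hy0 : 0 < y) (hy : y ≤ Real.pi) : 0 < sinSqHalf y :=
  lt_of_lt_of_le (by have := Real.pi_pos; positivity)
    (sq_div_pi_sq_le_sinSqHalf ⟨hy0.le, hy⟩)

theorem le_sinSqHalf_div {x y : ℝ} (hx : 0 < x) (hxy : x ≤ y) (hy : y ≤ Real.pi) :
    4 / Real.pi ^ 2 * (x ^ 2 / y ^ 2) ≤ sinSqHalf x / sinSqHalf y := by
  have hpi := Real.pi_pos
  have hy0 : 0 < y := hx.trans_le hxy
  have h1 := sq_div_pi_sq_le_sinSqHalf ⟨hx.le, hxy.trans hy⟩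
  have h2 := sinSqHalf_le y
  calc _ = x ^ 2 / Real.pi ^ 2 / (y ^ 2 / 4) := by field_simp
    _ ≤ _ := div_le_div₀ (sq_nonneg _) h1 (sinSqHalf_pos hy0 hy) h2

theorem sinSqHalf_div_le {x y : ℝ} (hy0 : 0 < y) (hy : y ≤ Real.pi) :
    sinSqHalf x / sinSqHalf y ≤ 5 / 2 * (x ^ 2 / y ^ 2) := by
  have hpi := Real.pi_pos
  have h1 := sq_div_pi_sq_le_sinSqHalf ⟨hy0.le, hy⟩
  have h2 := sinSqHalf_le x
  have h3 : Real.pi ^ 2 ≤ 10 := by nlinarith [Real.pi_lt_d2]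
  calc _ ≤ x ^ 2 / 4 / (y ^ 2 / Real.pi ^ 2) := div_le_div₀ (by positivity) h2 (by positivity) h1
    _ = Real.pi ^ 2 / 4 * (x ^ 2 / y ^ 2) := by field_simp
    _ ≤ _ := mul_le_mul_of_nonneg_right (by linarith) (by positivity)

theorem abs_sinSqHalf_div_sub_le {x y : ℝ} (hx : 0 < x) (hxy : x ≤ y) (hy : y ≤ Real.pi) :
    |sinSqHalf x / sinSqHalf y - x ^ 2 / y ^ 2| ≤ 3 * x ^ 2 := by
  have hpi := Real.pi_pos
  have hy0 : 0 < y := hx.trans_le hxy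
  have hsy := sinSqHalf_pos hy0 hy
  have h1 := sq_div_pi_sq_le_sinSqHalf ⟨hy0.le, hy⟩
  have h3 : Real.pi ^ 2 ≤ 10 := by nlinarith [Real.pi_lt_d2]
  have h4 := sq_div_four_sub_sinSqHalf_le hy0.le
  have h5 := sq_div_four_sub_sinSqHalf_le hx.le
  have h6 : y ^ 2 ≤ 10 * sinSqHalf y := by
    rw [div_le_iff₀ (by positivity)] at h1
    nlinarith
  rw [abs_le]
  constructor
  · have e1 : (x ^ 2 / 4 - x ^ 4 / 4) / (y ^ 2 / 4) ≤ sinSqHalf x / sinSqHalf y := by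
      rw [div_le_div_iff₀ (by positivity) hsy]
      rcases le_total 0 (x ^ 2 / 4 - x ^ 4 / 4) with h | h
      · exact mul_le_mul (by linarith) (sinSqHalf_le y) hsy.le (sq_nonneg _)
      · exact (mul_nonpos_of_nonpos_of_nonneg h hsy.le).trans
          (mul_nonneg (sq_nonneg _) (by positivity))
    have e2 : (x ^ 2 / 4 - x ^ 4 / 4) / (y ^ 2 / 4) = x ^ 2 / y ^ 2 - x ^ 2 * (x ^ 2 / y ^ 2) := by
      field_simp
    have e3 : x ^ 2 / y ^ 2 ≤ 1 := by
      rw [div_le_one (by positivity)]; exact pow_le_pow_left₀ hx.le hxy 2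
    nlinarith [sq_nonneg x]
  · have e1 : sinSqHalf x / sinSqHalf y ≤ x ^ 2 / 4 / sinSqHalf y :=
      div_le_div_of_nonneg_right (sinSqHalf_le x) hsy.le
    have e2 : x ^ 2 / 4 / sinSqHalf y ≤ x ^ 2 / y ^ 2 + 3 * x ^ 2 := by
      rw [div_le_iff₀ hsy]
      have e3 : x ^ 2 / 4 = x ^ 2 / y ^ 2 * (y ^ 2 / 4) := by field_simp
      have e4 : x ^ 2 / y ^ 2 * (y ^ 2 / 4 - sinSqHalf y) ≤ x ^ 2 / y ^ 2 * (y ^ 4 / 4) :=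
        mul_le_mul_of_nonneg_left h4 (by positivity)
      have e5 : x ^ 2 / y ^ 2 * (y ^ 4 / 4) = x ^ 2 * (y ^ 2 / 4) := by field_simp
      have e6 : x ^ 2 * (y ^ 2 / 4) ≤ x ^ 2 * (3 * sinSqHalf y) :=
        mul_le_mul_of_nonneg_left (by linarith) (sq_nonneg x)
      linarith
    linarith

/-- Away from the diagonal the kernel is `-log (1 - s(x) / s(y))`. -/
theorem ae_evenKernel_eq_of_lt {x : ℝ} (hx : 0 < x) : ∀ᵐ y, x < y → y ≤ Real.pi →
    evenKernel x y = -Real.log (1 - sinSqHalf x / sinSqHalf y) ∧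
      0 < 1 - sinSqHalf x / sinSqHalf y := by
  filter_upwards [ae_sinSqHalf_ne x] with y ⟨_, hp, he⟩ hxy hy
  have hlt := strictMonoOn_sinSqHalf ⟨hx.le, hxy.le.trans hy⟩ ⟨hx.le.trans hxy.le, hy⟩ hxy
  have h0 : 0 < sinSqHalf y - sinSqHalf x := sub_pos.2 hlt
  have h1 : 1 - sinSqHalf x / sinSqHalf y = (sinSqHalf y - sinSqHalf x) / sinSqHalf y := by
    field_simp
  rw [he, h1, Real.log_div h0.ne' hp.ne', ← Real.log_neg_eq_log (sinSqHalf x - _), neg_sub]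
  exact ⟨by ring, by positivity⟩

theorem ae_le_evenKernel_of_lt {x : ℝ} (hx : 0 < x) : ∀ᵐ y, x < y → y ≤ Real.pi →
    4 / Real.pi ^ 2 * (x ^ 2 / y ^ 2) ≤ evenKernel x y := by
  filter_upwards [ae_evenKernel_eq_of_lt hx] with y h hxy hy
  obtain ⟨h1, h2⟩ := h hxy hy
  have := Real.log_le_sub_one_of_pos h2
  have := le_sinSqHalf_div hx hxy.le hy
  linarith

theorem ae_abs_evenKernel_sub_le {x : ℝ} (hx : 0 < x) : ∀ᵐ y, 4 * x ≤ y → y ≤ Real.pi →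
    |evenKernel x y - x ^ 2 / y ^ 2| ≤ 13 * x ^ 4 * (1 / y ^ 4) + 3 * x ^ 2 := by
  filter_upwards [ae_evenKernel_eq_of_lt hx] with y h hxy hy
  obtain ⟨h1, h2⟩ := h (by linarith) hy
  have hy0 : 0 < y := by linarith
  have hsy := sinSqHalf_pos hy0 hy
  set w := sinSqHalf x / sinSqHalf y with hw
  have hw0 : 0 ≤ w := div_nonneg (sq_nonneg _) hsy.le
  have hwle : w ≤ 5 / 2 * (x ^ 2 / y ^ 2) := sinSqHalf_div_le hy0 hy
  have hr : x ^ 2 / y ^ 2 ≤ 1 / 16 := by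
    rw [div_le_iff₀ (by positivity)]; nlinarith
  have h3 := Real.log_le_sub_one_of_pos h2
  have h4 : -Real.log (1 - w) ≤ w + 2 * w ^ 2 := by
    have := Real.one_sub_inv_le_log_of_pos h2
    have e : (1 - w)⁻¹ - 1 = w / (1 - w) := by field_simp; ring
    have e2 : w / (1 - w) ≤ w + 2 * w ^ 2 := by
      rw [div_le_iff₀ h2]
      nlinarith [sq_nonneg w, mul_nonneg hw0 (sq_nonneg w)]
    linarith
  have h5 : w ^ 2 ≤ 25 / 4 * (x ^ 4 * (1 / y ^ 4)) := by
    calc w ^ 2 ≤ (5 / 2 * (x ^ 2 / y ^ 2)) ^ 2 := pow_le_pow_left₀ hw0 hwle 2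
      _ = _ := by field_simp; norm_num
  have h6 := abs_le.1 (abs_sinSqHalf_div_sub_le hx (by linarith : x ≤ y) hy)
  have h7 : 0 ≤ x ^ 4 * (1 / y ^ 4) := by positivity
  rw [abs_le, h1]
  constructor <;> nlinarith [h6.1, h6.2, h3, h4, h5, h7]

theorem abs_log_abs_sin_half_sub_le {v : ℝ} (hv0 : v ≠ 0) (hv : |v| ≤ Real.pi) :
    |Real.log (Real.sin (v / 2)) - Real.log v| ≤ 2 := by
  have hpi := Real.pi_pos
  have hv1 : 0 < |v| := abs_pos.2 hv0
  have e : |Real.sin (v / 2)| = Real.sin (|v| / 2) := by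
    rcases le_total 0 v with h | h
    · rw [abs_of_nonneg h, abs_of_nonneg]
      exact Real.sin_nonneg_of_nonneg_of_le_pi (by linarith) (by linarith [le_abs_self v])
    · rw [abs_of_nonpos h, neg_div, Real.sin_neg, abs_of_nonpos]
      have := Real.sin_nonneg_of_nonneg_of_le_pi (x := -v / 2) (by linarith)
        (by linarith [neg_le_abs v])
      rw [neg_div, Real.sin_neg] at this
      linarith
  have h1 := Real.mul_le_sin (x := |v| / 2) (by linarith) (by linarith)
  have h2 := Real.sin_le (x := |v| / 2) (by linarith)
  have h3 : |v| / Real.pi ≤ Real.sin (|v| / 2) := by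
    refine le_trans (le_of_eq ?_) h1; field_simp
  have h4 : 0 < |v| / Real.pi := by positivity
  have h5 := Real.log_le_log h4 h3
  have h6 := Real.log_le_log (h4.trans_le h3) h2
  have h7 : Real.log Real.pi ≤ 2 := by
    have : Real.log Real.pi ≤ Real.log 4 := Real.log_le_log hpi Real.pi_le_four
    have h8 : Real.log 4 = 2 * Real.log 2 := by
      rw [show (4 : ℝ) = 2 ^ 2 by norm_num, Real.log_pow]; norm_num
    linarith [Real.log_two_lt_d9]
  rw [Real.log_div hv1.ne' hpi.ne'] at h5
  rw [Real.log_div hv1.ne' two_ne_zero] at h6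
  rw [← Real.log_abs (Real.sin _), ← Real.log_abs v, e, abs_le]
  constructor <;> linarith [Real.log_two_gt_d9]

/-- Scale-invariant majorant of the kernel near the diagonal. -/
noncomputable def nearKernel (t : ℝ) : ℝ :=
  2 * |Real.log t| + |Real.log (1 - t)| + |Real.log (1 + t)| + 8

theorem intervalIntegrable_nearKernel (a b : ℝ) :
    IntervalIntegrable nearKernel volume a b := by
  have hl : ∀ a b, IntervalIntegrable (fun t : ℝ => |Real.log t|) volume a b :=
    fun a b => intervalIntegral.intervalIntegrable_log'.abs
  exact ((((hl a b).const_mul 2).add (intervalIntegrable_comp_sub hl 1 a b)).add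
    (intervalIntegrable_comp_add hl 1 a b)).add intervalIntegrable_const

theorem nearKernel_nonneg (t : ℝ) : 0 ≤ nearKernel t := by
  unfold nearKernel; positivity

theorem ae_abs_evenKernel_le_nearKernel {x : ℝ} (hx : 0 < x) (hx8 : 8 * x ≤ Real.pi) :
    ∀ᵐ y, 0 < y → y ≤ 4 * x → |evenKernel x y| ≤ nearKernel (y / x) := by
  have hne : ∀ᵐ y : ℝ, y ≠ x := by simp [ae_iff]
  filter_upwards [hne] with y hyx hy0 hy
  have b1 := abs_le.1 (abs_log_abs_sin_half_sub_le hy0.ne' (by rw [abs_of_pos hy0]; linarith))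
  have b2 := abs_le.1 (abs_log_abs_sin_half_sub_le (sub_ne_zero.2 hyx.symm)
    (by rw [abs_le]; constructor <;> linarith))
  have b3 := abs_le.1 (abs_log_abs_sin_half_sub_le (v := x + y) (by positivity)
    (by rw [abs_of_pos (by positivity)]; linarith))
  have e1 : Real.log y = Real.log (y / x) + Real.log x := by
    rw [Real.log_div hy0.ne' hx.ne']; ring
  have e2 : Real.log (x - y) = Real.log (1 - y / x) + Real.log x := by
    rw [← Real.log_mul _ hx.ne']
    · congr 1; field_simp
    · intro h
      apply hyx
      field_simp at h
      linarith
  have e3 : Real.log (x + y) = Real.log (1 + y / x) + Real.log x := by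
    rw [← Real.log_mul (by positivity) hx.ne']
    congr 1; field_simp
  have c1 := abs_le.1 (le_refl |Real.log (y / x)|)
  have c2 := abs_le.1 (le_refl |Real.log (1 - y / x)|)
  have c3 := abs_le.1 (le_refl |Real.log (1 + y / x)|)
  unfold evenKernel nearKernel logSinHalf
  rw [e1] at b1
  rw [e2] at b2
  rw [e3] at b3
  rw [abs_le]
  constructor <;> linarith [b1.1, b1.2, b2.1, b2.2, b3.1, b3.2, c1.1, c1.2, c2.1, c2.2, c3.1, c3.2]

theorem integral_nearKernel_div {x : ℝ} (hx : 0 < x) :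
    ∫ y in (0)..(4 * x), nearKernel (y / x) = x * ∫ t in (0)..4, nearKernel t := by
  rw [intervalIntegral.integral_comp_div _ hx.ne']
  simp [hx.ne']

theorem intervalIntegrable_nearKernel_div (x a b : ℝ) (hx : 0 < x) :
    IntervalIntegrable (fun y => nearKernel (y / x)) volume a b := by
  have := (intervalIntegrable_nearKernel (a / x) (b / x)).comp_mul_left (c := x⁻¹)
  simpa [div_eq_inv_mul, hx.ne'] using this

/-- The mass `∫_x^π u(y) / y² dy`, which governs the behaviour of `cuspOp u` near `0`. -/
noncomputable def tailMass (u : ℝ → ℝ) (x : ℝ) : ℝ := ∫ y in x..Real.pi, u y / y ^ 2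

theorem intervalIntegrable_div_pow {u : ℝ → ℝ} (hu : Continuous u) (n : ℕ) {a b : ℝ}
    (ha : 0 < a) (hb : 0 < b) : IntervalIntegrable (fun y => u y / y ^ n) volume a b := by
  refine ContinuousOn.intervalIntegrable ?_
  refine hu.continuousOn.div (by fun_prop) fun y hy => ?_
  have : 0 < y := lt_of_lt_of_le (lt_min ha hb) hy.1
  positivity

theorem integral_one_div_sq {a b : ℝ} (ha : 0 < a) (hab : a ≤ b) :
    ∫ y in a..b, 1 / y ^ 2 = 1 / a - 1 / b := by
  rw [intervalIntegral.integral_eq_sub_of_hasDerivAt (f := fun y => -(1 / y))]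
  · ring
  · intro y hy
    rw [uIcc_of_le hab] at hy
    have hy0 : y ≠ 0 := (ha.trans_le hy.1).ne'
    have := (hasDerivAt_inv hy0).fun_neg
    simpa [one_div] using this
  · exact intervalIntegrable_div_pow continuous_const 2 ha (ha.trans_le hab)

theorem integral_one_div_cube {a b : ℝ} (ha : 0 < a) (hab : a ≤ b) :
    ∫ y in a..b, 1 / y ^ 3 = (1 / a ^ 2 - 1 / b ^ 2) / 2 := by
  rw [intervalIntegral.integral_eq_sub_of_hasDerivAt (f := fun y => -(1 / 2) * (y ^ 2)⁻¹)]
  · ring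
  · intro y hy
    rw [uIcc_of_le hab] at hy
    have hy0 : y ≠ 0 := (ha.trans_le hy.1).ne'
    have := ((hasDerivAt_pow 2 y).inv (pow_ne_zero 2 hy0)).const_mul (-(1 / 2) : ℝ)
    refine this.congr_deriv ?_
    field_simp
    norm_num
  · exact intervalIntegrable_div_pow continuous_const 3 ha (ha.trans_le hab)

theorem integral_le_integral_of_ae_le {f g : ℝ → ℝ} {a b : ℝ} (hab : a ≤ b)
    (hf : IntervalIntegrable f volume a b) (hg : IntervalIntegrable g volume a b)
    (h : ∀ᵐ y, a < y → y ≤ b → f y ≤ g y) : ∫ y in a..b, f y ≤ ∫ y in a..b, g y := by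
  refine intervalIntegral.integral_mono_ae_restrict hab hf hg ?_
  rw [← restrict_Ioc_eq_restrict_Icc]
  refine (ae_restrict_iff' measurableSet_Ioc).2 ?_
  filter_upwards [h] with y hy hy'
  exact hy hy'.1 hy'.2

theorem abs_integral_le_of_ae_abs_le {f g : ℝ → ℝ} {a b : ℝ} (hab : a ≤ b)
    (hf : IntervalIntegrable f volume a b) (hg : IntervalIntegrable g volume a b)
    (h : ∀ᵐ y, a < y → y ≤ b → |f y| ≤ g y) : |∫ y in a..b, f y| ≤ ∫ y in a..b, g y :=
  (intervalIntegral.abs_integral_le_integral_abs hab).trans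
    (integral_le_integral_of_ae_le hab hf.abs hg h)

theorem le_pi_mul_cuspOp {u : ℝ → ℝ} (hu : Continuous u) (hm : Monotone u) (h0 : 0 ≤ u 0) {x : ℝ}
    (hx : 0 < x) (hxpi : x ≤ Real.pi) :
    4 / Real.pi ^ 2 * (x ^ 2 * (tailMass u x - u x / x)) ≤ Real.pi * cuspOp u x := by
  have hpi := Real.pi_pos
  have hs := strictMonoOn_sinSqHalf.monotoneOn
  have hxI : x ∈ Icc 0 Real.pi := ⟨hx.le, hxpi⟩
  have hsx : 0 < sinSqHalf x := sinSqHalf_pos hx hxpi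
  obtain ⟨c, hc, hcs⟩ := intermediate_value_Icc hx.le continuous_sinSqHalf.continuousOn
    (show sinSqHalf x / 2 ∈ Icc _ _ from
      ⟨by simp only [sinSqHalf, zero_div, Real.sin_zero]; norm_num; positivity, by linarith⟩)
  have hcI : c ∈ Icc 0 Real.pi := ⟨hc.1, hc.2.trans hxpi⟩
  have hk := intervalIntegrable_evenKernel x
  have hku := intervalIntegrable_evenKernel_mul hu x
  have hkc : ∀ a b, IntervalIntegrable (fun y => evenKernel x y * (u y - u c)) volume a b :=
    fun a b => (hk a b).mul_continuousOn (by fun_prop)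
  have e1 : Real.pi * cuspOp u x = (∫ y in (0)..x, evenKernel x y * (u y - u c)) +
      ∫ y in x..Real.pi, evenKernel x y * (u y - u c) := by
    rw [intervalIntegral.integral_add_adjacent_intervals (hkc _ _) (hkc _ _)]
    simp only [mul_sub]
    rw [intervalIntegral.integral_sub (hku _ _) ((hk _ _).mul_const _),
      intervalIntegral.integral_mul_const, integral_evenKernel, cuspOp]
    field_simp
    ring
  have e2 : 0 ≤ ∫ y in (0)..x, evenKernel x y * (u y - u c) := by
    have := integral_le_integral_of_ae_le hx.le (f := fun _ => (0 : ℝ)) intervalIntegrable_const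
      (hkc 0 x) ?_
    · simpa using this
    filter_upwards [ae_sinSqHalf_ne x] with y ⟨hne, hp, he⟩ hy0 hyx
    have hyI : y ∈ Icc 0 Real.pi := ⟨hy0.le, hyx.trans hxpi⟩
    have hlt : sinSqHalf y < sinSqHalf x := lt_of_le_of_ne (hs hyI hxI hyx) hne.symm
    rw [he]
    rcases le_total y c with h | h
    · have := hs hyI hcI h
      exact mul_nonneg_of_nonpos_of_nonpos
        (sub_nonpos.2 (Real.log_le_log hp (by linarith))) (sub_nonpos.2 (hm h))
    · have := hs hcI hyI h
      exact mul_nonneg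
        (sub_nonneg.2 (Real.log_le_log (by linarith) (by linarith))) (sub_nonneg.2 (hm h))
  have i2 := intervalIntegrable_div_pow hu 2 hx hpi
  have i3 := (intervalIntegrable_div_pow (continuous_const (y := (1 : ℝ))) 2 hx hpi).const_mul (u x)
  have i4 := ((i2.sub i3).const_mul (x ^ 2)).const_mul (4 / Real.pi ^ 2)
  have e3 : ∫ y in x..Real.pi, 4 / Real.pi ^ 2 * (x ^ 2 * (u y / y ^ 2 - u x * (1 / y ^ 2))) ≤
      ∫ y in x..Real.pi, evenKernel x y * (u y - u c) := by
    refine integral_le_integral_of_ae_le hxpi i4 (hkc _ _) ?_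
    filter_upwards [ae_le_evenKernel_of_lt hx] with y hy h1 h2
    have h3 := hy h1 h2
    have h4 : 0 ≤ u y - u x := sub_nonneg.2 (hm h1.le)
    have h5 : u y - u x ≤ u y - u c := sub_le_sub_left (hm hc.2) _
    have h6 : 0 ≤ 4 / Real.pi ^ 2 * (x ^ 2 / y ^ 2) := by positivity
    calc _ = 4 / Real.pi ^ 2 * (x ^ 2 / y ^ 2) * (u y - u x) := by ring
      _ ≤ _ := mul_le_mul h3 h5 h4 (h6.trans h3)
  have e4 : ∫ y in x..Real.pi, 4 / Real.pi ^ 2 * (x ^ 2 * (u y / y ^ 2 - u x * (1 / y ^ 2))) =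
      4 / Real.pi ^ 2 * (x ^ 2 * (tailMass u x - u x * (1 / x - 1 / Real.pi))) := by
    rw [intervalIntegral.integral_const_mul, intervalIntegral.integral_const_mul,
      intervalIntegral.integral_sub i2 i3, intervalIntegral.integral_const_mul,
      integral_one_div_sq hx hxpi, tailMass]
  have e5 : tailMass u x - u x / x ≤ tailMass u x - u x * (1 / x - 1 / Real.pi) := by
    have : 0 ≤ u x * (1 / Real.pi) := mul_nonneg (h0.trans (hm hx.le)) (by positivity)
    have h2 : u x / x = u x * (1 / x) := by ring
    linarith
  calc _ ≤ 4 / Real.pi ^ 2 * (x ^ 2 * (tailMass u x - u x * (1 / x - 1 / Real.pi))) := by gcongr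
    _ ≤ _ := by rw [← e4]; linarith

/-- Near `0`, `π cuspOp u x = x² ∫_x^π u / y²` up to lower-order terms. -/
theorem exists_abs_pi_mul_cuspOp_sub_le : ∃ H ≥ 0, ∀ u : ℝ → ℝ, Continuous u → Monotone u →
    0 ≤ u 0 → ∀ x, 0 < x → 8 * x ≤ Real.pi →
    |Real.pi * cuspOp u x - x ^ 2 * tailMass u x| ≤
      H * (x * u (4 * x)) + 13 * x ^ 4 * (∫ y in (4 * x)..Real.pi, u y / y ^ 4) +
        10 * x ^ 2 * u Real.pi := by
  have hpi := Real.pi_pos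
  have hJ : 0 ≤ ∫ t in (0)..4, nearKernel t :=
    intervalIntegral.integral_nonneg (by norm_num) fun t _ => nearKernel_nonneg t
  refine ⟨(∫ t in (0)..4, nearKernel t) + 1, by positivity, fun u hu hm h0 x hx hx8 => ?_⟩
  have h4pi : 4 * x ≤ Real.pi := by linarith
  have hx4 : 0 < 4 * x := by linarith
  have hu0 : ∀ y, 0 ≤ y → 0 ≤ u y := fun y hy => h0.trans (hm hy)
  have hku := intervalIntegrable_evenKernel_mul hu x
  have i2 := fun {a b : ℝ} => intervalIntegrable_div_pow hu 2 (a := a) (b := b)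
  have i4 := intervalIntegrable_div_pow hu 4 hx4 hpi
  set J := ∫ t in (0)..4, nearKernel t with hJdef
  have e1 : Real.pi * cuspOp u x - x ^ 2 * tailMass u x =
      (∫ y in (0)..(4 * x), evenKernel x y * u y) -
        x ^ 2 * (∫ y in x..(4 * x), u y / y ^ 2) +
        ∫ y in (4 * x)..Real.pi, (evenKernel x y * u y - x ^ 2 * (u y / y ^ 2)) := by
    have a1 := intervalIntegral.integral_add_adjacent_intervals (hku 0 (4 * x)) (hku (4 * x) Real.pi)
    have a2 := intervalIntegral.integral_add_adjacent_intervals (i2 hx hx4) (i2 hx4 hpi)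
    rw [intervalIntegral.integral_sub (hku _ _) ((i2 hx4 hpi).const_mul _),
      intervalIntegral.integral_const_mul, tailMass, ← a2, cuspOp, ← a1]
    field_simp
    ring
  have t1 : |∫ y in (0)..(4 * x), evenKernel x y * u y| ≤ J * (x * u (4 * x)) := by
    have := abs_integral_le_of_ae_abs_le hx4.le (hku 0 (4 * x))
      ((intervalIntegrable_nearKernel_div x 0 (4 * x) hx).mul_const (u (4 * x))) ?_
    · rw [intervalIntegral.integral_mul_const, integral_nearKernel_div hx] at this
      linarith
    filter_upwards [ae_abs_evenKernel_le_nearKernel hx hx8] with y hy h1 h2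
    rw [abs_mul, abs_of_nonneg (hu0 y h1.le)]
    exact mul_le_mul (hy h1 h2) (hm h2) (hu0 y h1.le) (nearKernel_nonneg _)
  have t2 : |x ^ 2 * (∫ y in x..(4 * x), u y / y ^ 2)| ≤ x * u (4 * x) := by
    have hx41 : x ≤ 4 * x := by linarith
    have := abs_integral_le_of_ae_abs_le hx41 (i2 hx hx4)
      ((intervalIntegrable_div_pow (continuous_const (y := (1 : ℝ))) 2 hx hx4).const_mul
        (u (4 * x))) (Filter.Eventually.of_forall fun y h1 h2 => ?_)
    · rw [intervalIntegral.integral_const_mul, integral_one_div_sq hx hx41] at this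
      rw [abs_mul, abs_of_nonneg (sq_nonneg x)]
      have h4 := hu0 _ hx4.le
      calc _ ≤ x ^ 2 * (u (4 * x) * (1 / x - 1 / (4 * x))) := by gcongr
        _ = 3 / 4 * (x * u (4 * x)) := by field_simp; ring
        _ ≤ _ := by nlinarith [mul_nonneg hx.le h4]
    · have hy0 : 0 < y := hx.trans h1
      rw [abs_of_nonneg (div_nonneg (hu0 y hy0.le) (sq_nonneg y)), mul_one_div]
      exact div_le_div_of_nonneg_right (hm h2) (sq_nonneg y)
  have t3 : |∫ y in (4 * x)..Real.pi, (evenKernel x y * u y - x ^ 2 * (u y / y ^ 2))| ≤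
      13 * x ^ 4 * (∫ y in (4 * x)..Real.pi, u y / y ^ 4) + 10 * x ^ 2 * u Real.pi := by
    have := abs_integral_le_of_ae_abs_le h4pi
      ((hku (4 * x) Real.pi).sub ((i2 hx4 hpi).const_mul (x ^ 2)))
      ((i4.const_mul (13 * x ^ 4)).add
        (intervalIntegrable_const (c := 3 * x ^ 2 * u Real.pi))) ?_
    · refine this.trans ?_
      rw [intervalIntegral.integral_add (i4.const_mul _) intervalIntegrable_const,
        intervalIntegral.integral_const_mul, intervalIntegral.integral_const, smul_eq_mul]
      have hup := hu0 _ hpi.le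
      have h3 : (Real.pi - 4 * x) * 3 ≤ 10 := by linarith [Real.pi_lt_d2]
      have := mul_le_mul_of_nonneg_right h3 (mul_nonneg (sq_nonneg x) hup)
      linarith
    filter_upwards [ae_abs_evenKernel_sub_le hx] with y hy h1 h2
    have hy0 : 0 < y := hx4.trans h1
    have huy := hu0 y hy0.le
    have h3 := hy h1.le h2
    rw [show evenKernel x y * u y - x ^ 2 * (u y / y ^ 2) =
      (evenKernel x y - x ^ 2 / y ^ 2) * u y by ring, abs_mul, abs_of_nonneg huy]
    have h4 := mul_le_mul_of_nonneg_left (hm h2) (by positivity : 0 ≤ 3 * x ^ 2)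
    calc _ ≤ (13 * x ^ 4 * (1 / y ^ 4) + 3 * x ^ 2) * u y := mul_le_mul_of_nonneg_right h3 huy
      _ = 13 * x ^ 4 * (u y / y ^ 4) + 3 * x ^ 2 * u y := by ring
      _ ≤ _ := by linarith
  rw [e1]
  have := abs_add_le ((∫ y in (0)..(4 * x), evenKernel x y * u y) -
        x ^ 2 * (∫ y in x..(4 * x), u y / y ^ 2))
        (∫ y in (4 * x)..Real.pi, (evenKernel x y * u y - x ^ 2 * (u y / y ^ 2)))
  have := abs_sub (∫ y in (0)..(4 * x), evenKernel x y * u y)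
    (x ^ 2 * (∫ y in x..(4 * x), u y / y ^ 2))
  linarith

theorem hasDerivAt_tailMass {u : ℝ → ℝ} (hu : Continuous u) {x : ℝ} (hx : 0 < x) :
    HasDerivAt (tailMass u) (-(u x / x ^ 2)) x := by
  have hpi := Real.pi_pos
  have hc : ContinuousOn (fun y => u y / y ^ 2) (Ioi 0) :=
    hu.continuousOn.div (by fun_prop) fun y hy => pow_ne_zero 2 (ne_of_gt hy)
  exact intervalIntegral.integral_hasDerivAt_left (intervalIntegrable_div_pow hu 2 hx hpi)
    (hc.stronglyMeasurableAtFilter isOpen_Ioi x hx) (hc.continuousAt (Ioi_mem_nhds hx))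

theorem tailMass_anti {u : ℝ → ℝ} (hu : Continuous u) (h0 : ∀ y, 0 ≤ y → 0 ≤ u y) {x x' : ℝ}
    (hx : 0 < x) (hxx : x ≤ x') : tailMass u x' ≤ tailMass u x := by
  have hpi := Real.pi_pos
  have hx' := hx.trans_le hxx
  have := intervalIntegral.integral_add_adjacent_intervals
    (intervalIntegrable_div_pow hu 2 hx hx') (intervalIntegrable_div_pow hu 2 hx' hpi)
  have h2 : 0 ≤ ∫ y in x..x', u y / y ^ 2 := intervalIntegral.integral_nonneg hxx fun y hy =>
    div_nonneg (h0 y (hx.le.trans hy.1)) (sq_nonneg y)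
  unfold tailMass
  linarith

theorem mul_le_tailMass {u : ℝ → ℝ} (hu : Continuous u) (hm : Monotone u)
    (h0 : ∀ y, 0 ≤ y → 0 ≤ u y) {x : ℝ} (hx : 0 < x) (hx2 : 2 * x ≤ Real.pi) :
    u x ≤ 2 * x * tailMass u x := by
  have hpi := Real.pi_pos
  have hx2' : 0 < 2 * x := by linarith
  have hxx : x ≤ 2 * x := by linarith
  have h1 := intervalIntegral.integral_add_adjacent_intervals
    (intervalIntegrable_div_pow hu 2 hx hx2') (intervalIntegrable_div_pow hu 2 hx2' hpi)
  have h2 : 0 ≤ ∫ y in (2 * x)..Real.pi, u y / y ^ 2 :=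
    intervalIntegral.integral_nonneg hx2 fun y hy =>
      div_nonneg (h0 y (hx2'.le.trans hy.1)) (sq_nonneg y)
  have h3 : ∫ y in x..(2 * x), u x * (1 / y ^ 2) ≤ ∫ y in x..(2 * x), u y / y ^ 2 := by
    refine intervalIntegral.integral_mono_on hxx
      ((intervalIntegrable_div_pow continuous_const 2 hx hx2').const_mul _)
      (intervalIntegrable_div_pow hu 2 hx hx2') fun y hy => ?_
    rw [mul_one_div]
    exact div_le_div_of_nonneg_right (hm hy.1) (sq_nonneg y)
  rw [intervalIntegral.integral_const_mul, integral_one_div_sq hx hxx] at h3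
  have h4 : u x * (1 / x - 1 / (2 * x)) ≤ tailMass u x := by unfold tailMass; linarith
  have h5 : 2 * x * (u x * (1 / x - 1 / (2 * x))) = u x := by field_simp; norm_num
  rw [← h5]
  exact mul_le_mul_of_nonneg_left h4 hx2'.le

theorem exp_neg_le_of_four_le {t : ℝ} (ht : 4 ≤ t) : Real.exp (-t) ≤ 1 / 16 := by
  have h1 : (2 : ℝ) ≤ Real.exp 1 := by linarith [Real.add_one_le_exp (1 : ℝ)]
  have h2 : (16 : ℝ) ≤ Real.exp t := by
    calc (16 : ℝ) = 2 ^ 4 := by norm_num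
      _ ≤ Real.exp 1 ^ 4 := pow_le_pow_left₀ (by norm_num) h1 4
      _ = Real.exp 4 := by rw [← Real.exp_nat_mul]; norm_num
      _ ≤ _ := Real.exp_le_exp.2 ht
  rw [Real.exp_neg, ← one_div]
  exact div_le_div_of_nonneg_left zero_le_one (by norm_num) h2

theorem hasDerivAt_tailMass_exp_neg {u : ℝ → ℝ} (hu : Continuous u) (t : ℝ) :
    HasDerivAt (fun t => tailMass u (Real.exp (-t))) (u (Real.exp (-t)) / Real.exp (-t)) t := by
  have h1 : HasDerivAt (fun t : ℝ => Real.exp (-t)) (-Real.exp (-t)) t := by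
    simpa using (hasDerivAt_id t).fun_neg.exp
  have h2 := (hasDerivAt_tailMass hu (Real.exp_pos (-t))).comp t h1
  refine h2.congr_deriv ?_
  have := (Real.exp_pos (-t)).ne'
  field_simp

/-- First growth bound for a profile: `u(y) ≤ A y (1 + t)` for `y ≥ exp (-t)`. -/
theorem exists_profile_le {u : ℝ → ℝ} (hu : Continuous u) (hm : Monotone u) (h0 : 0 ≤ u 0)
    (heq : ∀ x ∈ Icc 0 Real.pi, u x ^ 2 / 2 = cuspOp u x) :
    ∃ A ≥ 0, ∀ t ≥ 4, ∀ y, Real.exp (-t) ≤ y → y ≤ Real.pi → u y ≤ A * (y * (1 + t)) := by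
  obtain ⟨H, hH, hmain⟩ := exists_abs_pi_mul_cuspOp_sub_le
  have hpi := Real.pi_pos
  have hu0 : ∀ y, 0 ≤ y → 0 ≤ u y := fun y hy => h0.trans (hm hy)
  have hup := hu0 _ hpi.le
  set K : ℝ := 32 * H + 2 + 10 * u Real.pi with hK
  have hK0 : 0 ≤ K := by positivity
  set W : ℝ → ℝ := fun t => tailMass u (Real.exp (-t)) + 1 with hW
  set P : ℝ → ℝ := fun t => u (Real.exp (-t)) / Real.exp (-t) with hPdef
  have hWd : ∀ t, 4 ≤ t → HasDerivAt W (P t) t := fun t _ =>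
    (hasDerivAt_tailMass_exp_neg hu t).add_const 1
  have hQ0 : ∀ x, 0 < x → x ≤ Real.pi → 0 ≤ tailMass u x := fun x hx hxpi =>
    intervalIntegral.integral_nonneg hxpi fun y hy =>
      div_nonneg (hu0 y (hx.le.trans hy.1)) (sq_nonneg y)
  have hW1 : ∀ t, 4 ≤ t → 1 ≤ W t := fun t ht => by
    have := hQ0 _ (Real.exp_pos (-t)) (by linarith [exp_neg_le_of_four_le ht, Real.pi_gt_three])
    simp only [hW]; linarith
  have hPW : ∀ t, 4 ≤ t → P t ≤ √K * √(W t) := fun t ht => by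
    rw [← Real.sqrt_mul hK0]
    refine Real.le_sqrt_of_sq_le ?_
    have hx16 := exp_neg_le_of_four_le ht
    have hx := Real.exp_pos (-t)
    simp only [hPdef, hW]
    set x := Real.exp (-t) with hxdef
    have hx8 : 8 * x ≤ Real.pi := by linarith [Real.pi_gt_three]
    have hx4 : 0 < 4 * x := by linarith
    have h1 := (abs_le.1 (hmain u hu hm h0 x hx hx8)).2
    rw [← heq x ⟨hx.le, by linarith⟩] at h1
    have hQ4 := tailMass_anti hu hu0 hx (by linarith : x ≤ 4 * x)
    have hQ := hQ0 x hx (by linarith)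
    have h2 : x * u (4 * x) ≤ 32 * x ^ 2 * tailMass u x := by
      have a1 := mul_le_tailMass hu hm hu0 hx4 (by linarith)
      have a2 := mul_le_mul_of_nonneg_left hQ4 (by positivity : 0 ≤ 8 * x)
      have a3 : u (4 * x) ≤ 8 * x * tailMass u x := by linarith
      have a4 := mul_le_mul_of_nonneg_left a3 hx.le
      nlinarith [mul_nonneg (sq_nonneg x) hQ]
    have h3 : 13 * x ^ 4 * (∫ y in (4 * x)..Real.pi, u y / y ^ 4) ≤ x ^ 2 * tailMass u x := by
      have b1 : ∫ y in (4 * x)..Real.pi, u y / y ^ 4 ≤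
          ∫ y in (4 * x)..Real.pi, 1 / (16 * x ^ 2) * (u y / y ^ 2) := by
        refine intervalIntegral.integral_mono_on (by linarith)
          (intervalIntegrable_div_pow hu 4 hx4 hpi)
          ((intervalIntegrable_div_pow hu 2 hx4 hpi).const_mul _) fun y hy => ?_
        have hy0 : 0 < y := hx4.trans_le hy.1
        have c1 : 1 / y ^ 2 ≤ 1 / (16 * x ^ 2) :=
          div_le_div_of_nonneg_left zero_le_one (by positivity) (by nlinarith [hy.1])
        calc u y / y ^ 4 = 1 / y ^ 2 * (u y / y ^ 2) := by field_simp
          _ ≤ _ := mul_le_mul_of_nonneg_right c1 (div_nonneg (hu0 y hy0.le) (sq_nonneg y))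
      rw [intervalIntegral.integral_const_mul] at b1
      calc _ ≤ 13 * x ^ 4 * (1 / (16 * x ^ 2) * tailMass u x) := by
            refine mul_le_mul_of_nonneg_left (b1.trans ?_) (by positivity)
            exact mul_le_mul_of_nonneg_left hQ4 (by positivity)
        _ = 13 / 16 * (x ^ 2 * tailMass u x) := by field_simp
        _ ≤ _ := by nlinarith [mul_nonneg (sq_nonneg x) hQ]
    rw [div_pow, div_le_iff₀ (by positivity)]
    have h4 : u x ^ 2 ≤ Real.pi * (u x ^ 2 / 2) := by nlinarith [sq_nonneg (u x), Real.pi_gt_three]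
    have h5 := mul_le_mul_of_nonneg_left h2 hH
    have h6 : 0 ≤ u Real.pi * (tailMass u x * x ^ 2) := by positivity
    have h7 : 0 ≤ H * x ^ 2 := by positivity
    rw [hK]
    nlinarith [sq_nonneg x]
  set A₀ : ℝ := √K * (√(W 4) + √K / 2) with hA₀
  have hA₀0 : 0 ≤ A₀ := by positivity
  have hP : ∀ t, 4 ≤ t → P t ≤ A₀ * (1 + t) := fun t ht => by
    have h1 := sqrt_le_of_deriv_le hWd (fun t ht => zero_lt_one.trans_le (hW1 t ht)) hPW ht
    have h2 : √(W t) ≤ (√(W 4) + √K / 2) * (1 + t) := by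
      have a1 := Real.sqrt_nonneg (W 4)
      have a2 := Real.sqrt_nonneg K
      nlinarith [mul_nonneg a1 (by linarith : 0 ≤ t)]
    calc _ ≤ _ := hPW t ht
      _ ≤ √K * ((√(W 4) + √K / 2) * (1 + t)) := mul_le_mul_of_nonneg_left h2 (Real.sqrt_nonneg K)
      _ = _ := by rw [hA₀]; ring
  refine ⟨A₀ + u Real.pi * Real.exp 4, by positivity, fun t ht y hty hy => ?_⟩
  have hy0 : 0 < y := (Real.exp_pos _).trans_le hty
  have hB : 0 ≤ u Real.pi * Real.exp 4 := by positivity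
  have hyt : 0 ≤ y * (1 + t) := by positivity
  rcases le_total y (Real.exp (-4)) with h | h
  · have e1 : 4 ≤ -Real.log y := by
      have := Real.log_le_log hy0 h
      rw [Real.log_exp] at this; linarith
    have e2 : -Real.log y ≤ t := by
      have := Real.log_le_log (Real.exp_pos _) hty
      rw [Real.log_exp] at this; linarith
    have e3 := hP _ e1
    simp only [hPdef, neg_neg, Real.exp_log hy0] at e3
    rw [div_le_iff₀ hy0] at e3
    calc u y ≤ A₀ * (1 + -Real.log y) * y := e3
      _ ≤ A₀ * (1 + t) * y := by gcongr
      _ ≤ _ := by nlinarith [mul_nonneg hB hyt]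
  · have e1 : 1 ≤ Real.exp 4 * y := by
      calc 1 = Real.exp 4 * Real.exp (-4) := by rw [← Real.exp_add]; norm_num
        _ ≤ _ := mul_le_mul_of_nonneg_left h (Real.exp_pos _).le
    have e2 : u y ≤ u Real.pi * (Real.exp 4 * y) :=
      (hm hy).trans (le_mul_of_one_le_right hup e1)
    have e3 : 0 ≤ u Real.pi * Real.exp 4 * y * t := by positivity
    nlinarith [mul_nonneg hA₀0 hyt]

theorem profile_asymptotics {u : ℝ → ℝ} (hu : Continuous u) (hm : Monotone u) (h0 : 0 ≤ u 0)
    (hpos : 0 < u Real.pi) (heq : ∀ x ∈ Icc 0 Real.pi, u x ^ 2 / 2 = cuspOp u x) :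
    ∃ C > (0 : ℝ), ∃ r ∈ Ioo (0 : ℝ) 1, ∀ x : ℝ, 0 < x → x < r →
      |u x + 1 / Real.pi * x * Real.log x| ≤ C * x * √(Real.log (1 / x)) := by
  obtain ⟨H, hH, hmain⟩ := exists_abs_pi_mul_cuspOp_sub_le
  obtain ⟨A, hA, hle⟩ := exists_profile_le hu hm h0 heq
  have hpi := Real.pi_pos
  have hu0 : ∀ y, 0 ≤ y → 0 ≤ u y := fun y hy => h0.trans (hm hy)
  set K : ℝ := 4 * H * A + A + 10 * u Real.pi + 4 with hK
  have hK0 : 0 < K := by positivity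
  have hx4pi : Real.exp (-4) < Real.pi := by
    linarith [exp_neg_le_of_four_le (le_refl 4), Real.pi_gt_three]
  have hm0 : 0 < tailMass u (Real.exp (-4)) := by
    refine intervalIntegral.integral_pos hx4pi ?_ (fun y hy => ?_) ⟨Real.pi, ⟨hx4pi.le, le_rfl⟩, ?_⟩
    · exact hu.continuousOn.div (by fun_prop) fun y hy =>
        pow_ne_zero 2 ((Real.exp_pos _).trans_le hy.1).ne'
    · exact div_nonneg (hu0 y ((Real.exp_pos _).trans hy.1).le) (sq_nonneg y)
    · positivity
  have hlow : ∀ t, 4 ≤ t → tailMass u (Real.exp (-t)) ≤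
      K * ((u (Real.exp (-t)) / Real.exp (-t)) ^ 2 + u (Real.exp (-t)) / Real.exp (-t)) := by
    intro t ht
    have hx16 := exp_neg_le_of_four_le ht
    have hx := Real.exp_pos (-t)
    set x := Real.exp (-t) with hxdef
    have hxpi : x ≤ Real.pi := by linarith [Real.pi_gt_three]
    have hpx : u x ^ 2 = (u x / x) ^ 2 * x ^ 2 := by field_simp
    have hux := div_nonneg (hu0 x hx.le) hx.le
    have h1 := le_pi_mul_cuspOp hu hm h0 hx hxpi
    rw [← heq x ⟨hx.le, hxpi⟩, hpx] at h1
    have h2 : 4 / Real.pi ^ 2 * (tailMass u x - u x / x) ≤ Real.pi / 2 * (u x / x) ^ 2 := by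
      have : 0 < x ^ 2 := by positivity
      refine le_of_mul_le_mul_right ?_ this
      linarith
    have h3 : tailMass u x - u x / x ≤ Real.pi ^ 3 / 8 * (u x / x) ^ 2 := by
      rw [div_mul_eq_mul_div, div_le_iff₀ (by positivity)] at h2
      nlinarith
    have h4 : Real.pi ^ 3 / 8 ≤ 4 := by
      have : Real.pi ^ 3 ≤ 3.15 ^ 3 := pow_le_pow_left₀ hpi.le Real.pi_lt_d2.le 3
      norm_num at this
      linarith
    have h5 := mul_le_mul_of_nonneg_right h4 (sq_nonneg (u x / x))
    have h6 : 4 ≤ K := by rw [hK]; nlinarith [mul_nonneg hH hA]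
    have h7 := mul_le_mul_of_nonneg_right h6 (add_nonneg (sq_nonneg (u x / x)) hux)
    linarith
  have hasym : ∀ t, 4 ≤ t → |Real.pi / 2 * (u (Real.exp (-t)) / Real.exp (-t)) ^ 2 -
      tailMass u (Real.exp (-t))| ≤ K * (1 + t) := by
    intro t ht
    have hx16 := exp_neg_le_of_four_le ht
    have hx := Real.exp_pos (-t)
    have hle' := hle t ht
    set x := Real.exp (-t) with hxdef
    have hxpi : x ≤ Real.pi := by linarith [Real.pi_gt_three]
    have hpx : u x ^ 2 = (u x / x) ^ 2 * x ^ 2 := by field_simp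
    have hux := div_nonneg (hu0 x hx.le) hx.le
    have h1 := hmain u hu hm h0 x hx (by linarith [Real.pi_gt_three])
    rw [← heq x ⟨hx.le, hxpi⟩, hpx] at h1
    have h4x : 4 * x ≤ Real.pi := by linarith [Real.pi_gt_three]
    have hx4 : 0 < 4 * x := by linarith
    have h2 := hle' (4 * x) (by linarith) h4x
    have h3 : ∫ y in (4 * x)..Real.pi, u y / y ^ 4 ≤ A * (1 + t) * (1 / (32 * x ^ 2)) := by
      have b1 : ∫ y in (4 * x)..Real.pi, u y / y ^ 4 ≤
          ∫ y in (4 * x)..Real.pi, A * (1 + t) * (1 / y ^ 3) := by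
        refine intervalIntegral.integral_mono_on h4x (intervalIntegrable_div_pow hu 4 hx4 hpi)
          ((intervalIntegrable_div_pow continuous_const 3 hx4 hpi).const_mul _) fun y hy => ?_
        have hy0 : 0 < y := hx4.trans_le hy.1
        calc u y / y ^ 4 ≤ A * (y * (1 + t)) / y ^ 4 :=
              div_le_div_of_nonneg_right (hle' y (by linarith [hy.1]) hy.2) (by positivity)
          _ = _ := by field_simp
      rw [intervalIntegral.integral_const_mul, integral_one_div_cube hx4 h4x] at b1
      refine b1.trans (mul_le_mul_of_nonneg_left ?_ (by positivity))
      have : 0 ≤ 1 / Real.pi ^ 2 := by positivity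
      have e : 1 / (4 * x) ^ 2 / 2 = 1 / (32 * x ^ 2) := by field_simp; norm_num
      linarith
    have h4 : H * (x * u (4 * x)) ≤ 4 * H * A * (1 + t) * x ^ 2 := by
      calc _ ≤ H * (x * (A * (4 * x * (1 + t)))) := by gcongr
        _ = _ := by ring
    have h5 : 13 * x ^ 4 * (∫ y in (4 * x)..Real.pi, u y / y ^ 4) ≤ A * (1 + t) * x ^ 2 := by
      calc _ ≤ 13 * x ^ 4 * (A * (1 + t) * (1 / (32 * x ^ 2))) := by gcongr
        _ = 13 / 32 * (A * (1 + t) * x ^ 2) := by field_simp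
        _ ≤ _ := by
          have : 0 ≤ A * (1 + t) * x ^ 2 := by positivity
          linarith
    have h6 : |Real.pi / 2 * (u x / x) ^ 2 - tailMass u x| * x ^ 2 ≤ K * (1 + t) * x ^ 2 := by
      rw [← abs_of_nonneg (sq_nonneg x), ← abs_mul, abs_of_nonneg (sq_nonneg x)]
      have e : (Real.pi / 2 * (u x / x) ^ 2 - tailMass u x) * x ^ 2 =
          Real.pi * ((u x / x) ^ 2 * x ^ 2 / 2) - x ^ 2 * tailMass u x := by ring
      rw [e]
      refine h1.trans ?_
      have h7 : 10 * x ^ 2 * u Real.pi ≤ 10 * u Real.pi * (1 + t) * x ^ 2 := by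
        have : 0 ≤ 10 * u Real.pi * x ^ 2 * t := by positivity
        linarith
      have h8 : 0 ≤ 4 * (1 + t) * x ^ 2 := by positivity
      rw [hK]
      linarith
    exact le_of_mul_le_mul_right h6 (by positivity)
  obtain ⟨D, hD, t₁, ht₁, hfin⟩ := exists_abs_sub_div_pi_le (t₀ := 4) hm0 hK0
    (W := fun t => tailMass u (Real.exp (-t))) (P := fun t => u (Real.exp (-t)) / Real.exp (-t))
    (fun t _ => hasDerivAt_tailMass_exp_neg hu t)
    (fun t ht => tailMass_anti hu hu0 (Real.exp_pos _) (Real.exp_le_exp.2 (by linarith)))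
    (fun t _ => div_nonneg (hu0 _ (Real.exp_pos _).le) (Real.exp_pos _).le)
    hlow hasym
  refine ⟨D, hD, Real.exp (-t₁), ⟨Real.exp_pos _, ?_⟩, fun x hx hxr => ?_⟩
  · rw [Real.exp_lt_one_iff]; linarith
  have e1 : t₁ ≤ -Real.log x := by
    have := Real.log_le_log hx hxr.le
    rw [Real.log_exp] at this; linarith
  have e2 := hfin _ e1
  simp only [neg_neg, Real.exp_log hx] at e2
  have e3 : u x + 1 / Real.pi * x * Real.log x = x * (u x / x - -Real.log x / Real.pi) := by
    field_simp
    ring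
  rw [e3, abs_mul, abs_of_pos hx, one_div, Real.log_inv]
  calc _ ≤ x * (D * √(-Real.log x)) := mul_le_mul_of_nonneg_left e2 hx.le
    _ = _ := by ring

/-- The even `2π`-periodic function that agrees with `u` on `[0, π]`. -/
noncomputable def foldPi (u : ℝ → ℝ) (x : ℝ) : ℝ := u (Real.arccos (Real.cos x))

theorem foldPi_of_mem (u : ℝ → ℝ) {x : ℝ} (hx : x ∈ Icc 0 Real.pi) : foldPi u x = u x := by
  rw [foldPi, Real.arccos_cos hx.1 hx.2]

theorem foldPi_neg (u : ℝ → ℝ) (x : ℝ) : foldPi u (-x) = foldPi u x := by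
  rw [foldPi, Real.cos_neg, foldPi]

theorem foldPi_add_two_pi (u : ℝ → ℝ) (x : ℝ) : foldPi u (x + 2 * Real.pi) = foldPi u x := by
  rw [foldPi, Real.cos_add_two_pi, foldPi]

theorem continuous_foldPi {u : ℝ → ℝ} (hu : Continuous u) : Continuous (foldPi u) :=
  hu.comp (Real.continuous_arccos.comp Real.continuous_cos)

theorem integral_log_sub_log_mul_of_even {f : ℝ → ℝ} (hf : Continuous f)
    (heven : ∀ x, f (-x) = f x) (x : ℝ) :
    ∫ y in (-Real.pi)..Real.pi,
      (Real.log |Real.sin ((x - y) / 2)| - Real.log |Real.sin (y / 2)|) * f y =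
    -∫ y in (0)..Real.pi, evenKernel x y * f y := by
  have hg : ∀ a b, IntervalIntegrable (fun y => (logSinHalf (x - y) - logSinHalf y) * f y)
      volume a b := fun a b =>
    ((intervalIntegrable_comp_sub intervalIntegrable_logSinHalf x a b).sub
      (intervalIntegrable_logSinHalf a b)).mul_continuousOn hf.continuousOn
  have h1 : ∀ y, (Real.log |Real.sin ((x - y) / 2)| - Real.log |Real.sin (y / 2)|) * f y =
      (logSinHalf (x - y) - logSinHalf y) * f y := fun y => by
    rw [Real.log_abs, Real.log_abs, logSinHalf, logSinHalf]
  simp only [h1]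
  have h2 : ∫ y in (-Real.pi)..0, (logSinHalf (x - y) - logSinHalf y) * f y =
      ∫ y in (0)..Real.pi, (logSinHalf (x + y) - logSinHalf y) * f y := by
    have := intervalIntegral.integral_comp_neg (a := 0) (b := Real.pi)
      (fun y => (logSinHalf (x - y) - logSinHalf y) * f y)
    simp only [neg_zero, logSinHalf_neg, heven, sub_neg_eq_add] at this
    exact this.symm
  have hg2 : IntervalIntegrable (fun y => (logSinHalf (x + y) - logSinHalf y) * f y)
      volume 0 Real.pi :=
    ((intervalIntegrable_comp_add intervalIntegrable_logSinHalf x _ _).sub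
      (intervalIntegrable_logSinHalf _ _)).mul_continuousOn hf.continuousOn
  rw [← intervalIntegral.integral_add_adjacent_intervals (hg (-Real.pi) 0) (hg 0 Real.pi), h2,
    ← intervalIntegral.integral_add hg2 (hg _ _), ← intervalIntegral.integral_neg]
  congr 1
  funext y
  rw [evenKernel]
  ring

theorem evenKernel_congr_cos {x x' : ℝ} (h : Real.cos x = Real.cos x') (y : ℝ) :
    evenKernel x y = evenKernel x' y := by
  obtain ⟨n, hn⟩ := Real.cos_eq_cos_iff.1 h.symm
  have hper : ∀ v : ℝ, logSinHalf (2 * n * Real.pi + v) = logSinHalf v := fun v => by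
    have := logSinHalf_periodic.int_mul n v
    rw [← this]; congr 1; ring
  rcases hn with hn | hn
  · rw [hn]
    unfold evenKernel
    rw [add_sub_assoc, add_assoc, hper, hper]
  · rw [hn]
    unfold evenKernel
    rw [show 2 * (n : ℝ) * Real.pi - x' - y = 2 * n * Real.pi + -(x' + y) by ring,
      show 2 * (n : ℝ) * Real.pi - x' + y = 2 * n * Real.pi + -(x' - y) by ring, hper, hper,
      logSinHalf_neg, logSinHalf_neg]
    ring

theorem foldPi_eq {u : ℝ → ℝ} (hu : Continuous u)
    (heq : ∀ x ∈ Icc 0 Real.pi, u x ^ 2 / 2 = cuspOp u x) (x : ℝ) :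
    (1 / 2) * foldPi u x ^ 2 = -(1 / Real.pi) * ∫ y in (-Real.pi)..Real.pi,
      (Real.log |Real.sin ((x - y) / 2)| - Real.log |Real.sin (y / 2)|) * foldPi u y := by
  have hpi := Real.pi_pos
  have h1 := heq (Real.arccos (Real.cos x)) ⟨Real.arccos_nonneg _, Real.arccos_le_pi _⟩
  rw [integral_log_sub_log_mul_of_even (continuous_foldPi hu) (foldPi_neg u)]
  have h2 : ∫ y in (0)..Real.pi, evenKernel x y * foldPi u y =
      ∫ y in (0)..Real.pi, evenKernel (Real.arccos (Real.cos x)) y * u y := by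
    refine intervalIntegral.integral_congr fun y hy => ?_
    rw [uIcc_of_le hpi.le] at hy
    simp only [foldPi_of_mem u hy]
    rw [evenKernel_congr_cos]
    rw [Real.cos_arccos (Real.neg_one_le_cos x) (Real.cos_le_one x)]
  rw [h2, foldPi]
  rw [cuspOp] at h1
  linarith

/-- Existence of a periodic highest cusped traveling wave for the Burgers–Hilbert equation:
there is a bounded measurable, `2π`-periodic, even function `u`, not a.e. zero, solving
`(1/2)u² = −H[u]` a.e., with `|u(x) + (1/π)|x|log|x|| ≤ C|x|√(log(1/|x|))` near `0`. -/
theorem stmt_0 :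
    ∃ u : ℝ → ℝ,
      (∃ M : ℝ, ∀ x, |u x| ≤ M) ∧
      Measurable u ∧
      (∀ x, u (x + 2 * Real.pi) = u x) ∧
      (∀ x, u (-x) = u x) ∧
      ¬ (∀ᵐ x : ℝ, u x = 0) ∧
      (∀ᵐ x : ℝ, (1/2) * u x ^ 2 =
        -(1 / Real.pi) * ∫ y in (-Real.pi)..Real.pi,
          (Real.log |Real.sin ((x - y) / 2)| - Real.log |Real.sin (y / 2)|) * u y) ∧
      (∃ C > (0:ℝ), ∃ r ∈ Ioo (0:ℝ) 1, ∀ x : ℝ, 0 < |x| → |x| < r →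
        abs (u x + (1 / Real.pi) * |x| * Real.log |x|) ≤
          C * |x| * Real.sqrt (Real.log (1 / |x|))) := by
  obtain ⟨u, hu, hm, h0, h1, heq⟩ := exists_cusp_profile
  have hpi := Real.pi_pos
  have hc := continuous_foldPi hu
  refine ⟨foldPi u, ⟨u Real.pi, fun x => ?_⟩, hc.measurable, foldPi_add_two_pi u, foldPi_neg u,
    fun h => ?_, Filter.Eventually.of_forall fun x => foldPi_eq hu heq x, ?_⟩
  · have h2 : 0 ≤ foldPi u x := h0 ▸ hm (Real.arccos_nonneg _)
    rw [abs_of_nonneg h2]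
    exact hm (Real.arccos_le_pi _)
  · have h2 := congrFun ((hc.ae_eq_iff_eq volume continuous_const).1 h) Real.pi
    rw [foldPi_of_mem u ⟨hpi.le, le_rfl⟩] at h2
    linarith
  · obtain ⟨C, hC, r, hr, hur⟩ := profile_asymptotics hu hm h0.ge (by linarith) heq
    refine ⟨C, hC, r, hr, fun x hx hxr => ?_⟩
    have h2 : foldPi u x = u |x| := by
      rw [foldPi, ← Real.cos_abs, Real.arccos_cos hx.le]
      linarith [hr.2, Real.pi_gt_three]
    rw [h2]
    exact hur |x| hx hxr
end

section
/- Let u : ℝ → ℝ be bounded, measurable, even and 2π-periodic, and suppose that for all x, (1/2)·u(x)² = −(1/π)·∫_{−π}^{π} (log|sin((x−y)/2)| − log|sin(y/2)|)·u(y) dy. Suppose moreover that there is ν ≠ 0 such that (u(x) − ν·|x|·log|x|)/(|x|·log|x|) → 0 as x → 0 (i.e. u(x) = ν|x|log|x| + o(|x|log|x|) near 0). Then ν = −1/π. -/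
open Filter

section

open Set MeasureTheory intervalIntegral

/-- The even part in `y` of the kernel `log|sin((x-y)/2)| - log|sin(y/2)|`, doubled. -/
noncomputable def symmKernel (x y : ℝ) : ℝ :=
  Real.log (Real.sin ((x - y) / 2)) + Real.log (Real.sin ((x + y) / 2))
    - 2 * Real.log (Real.sin (y / 2))

lemma intervalIntegrable_log_sin_affine (c d a b : ℝ) :
    IntervalIntegrable (fun y => Real.log (Real.sin (c * y + d))) volume a b := by
  have h : AnalyticOnNhd ℝ (fun y => Real.sin (c * y + d)) (uIcc a b) :=
    fun y _ => by fun_prop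
  exact h.meromorphicOn.intervalIntegrable_log

lemma intervalIntegrable_log_sin_sub (x a b : ℝ) :
    IntervalIntegrable (fun y => Real.log (Real.sin ((x - y) / 2))) volume a b := by
  refine (intervalIntegrable_log_sin_affine (-1 / 2) (x / 2) a b).congr (fun y _ => ?_)
  congr 2; ring

lemma intervalIntegrable_log_sin_add (x a b : ℝ) :
    IntervalIntegrable (fun y => Real.log (Real.sin ((x + y) / 2))) volume a b := by
  refine (intervalIntegrable_log_sin_affine (1 / 2) (x / 2) a b).congr (fun y _ => ?_)
  congr 2; ring

lemma intervalIntegrable_log_sin_half (a b : ℝ) :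
    IntervalIntegrable (fun y => Real.log (Real.sin (y / 2))) volume a b := by
  simpa using intervalIntegrable_log_sin_add 0 a b

lemma intervalIntegrable_symmKernel (x a b : ℝ) :
    IntervalIntegrable (symmKernel x) volume a b :=
  ((intervalIntegrable_log_sin_sub x a b).add (intervalIntegrable_log_sin_add x a b)).sub
    ((intervalIntegrable_log_sin_half a b).const_mul 2)

lemma IntervalIntegrable.mul_bounded_measurable {f u : ℝ → ℝ} {a b M : ℝ}
    (hf : IntervalIntegrable f volume a b) (hu : Measurable u) (hM : ∀ x, |u x| ≤ M) :
    IntervalIntegrable (fun y => f y * u y) volume a b := by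
  rw [intervalIntegrable_iff] at hf ⊢
  exact hf.mul_bdd (c := M) hu.aestronglyMeasurable (ae_of_all _ hM)

/-- Folding the integral over `[-π, π]` onto `[0, π]` for an even density. -/
lemma integral_log_sin_mul_even {u : ℝ → ℝ} {M : ℝ} (hM : ∀ x, |u x| ≤ M)
    (hmeas : Measurable u) (heven : ∀ x, u (-x) = u x) (x : ℝ) :
    ∫ y in (-Real.pi)..Real.pi,
        (Real.log |Real.sin ((x - y) / 2)| - Real.log |Real.sin (y / 2)|) * u y =
      ∫ y in (0 : ℝ)..Real.pi, symmKernel x y * u y := by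
  simp only [Real.log_abs]
  set f : ℝ → ℝ := fun y =>
    (Real.log (Real.sin ((x - y) / 2)) - Real.log (Real.sin (y / 2))) * u y with hf
  have hfi : ∀ a b, IntervalIntegrable f volume a b := fun a b =>
    ((intervalIntegrable_log_sin_sub x a b).sub
      (intervalIntegrable_log_sin_half a b)).mul_bounded_measurable hmeas hM
  have hneg : ∫ y in (-Real.pi)..0, f y = ∫ y in (0 : ℝ)..Real.pi, f (-y) := by
    rw [intervalIntegral.integral_comp_neg]; simp
  have hfn : IntervalIntegrable (fun y => f (-y)) volume 0 Real.pi := by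
    have := (hfi 0 (-Real.pi)).comp_mul_left (c := -1)
    simpa using this
  rw [← integral_add_adjacent_intervals (hfi (-Real.pi) 0) (hfi 0 Real.pi), hneg,
    ← integral_add hfn (hfi _ _)]
  refine integral_congr (fun y _ => ?_)
  simp only [hf, symmKernel, heven, sub_neg_eq_add, neg_div, Real.sin_neg, Real.log_neg_eq_log]
  ring

lemma abs_log_sin_half_sub_log_le {θ : ℝ} (h0 : θ ≠ 0) (hpi : |θ| ≤ Real.pi) :
    |Real.log (Real.sin (θ / 2)) - Real.log θ| ≤ Real.log Real.pi := by
  have hp := Real.pi_pos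
  have hθ : 0 < |θ| := abs_pos.2 h0
  have h2 : |θ / 2| = |θ| / 2 := by rw [abs_div]; simp
  have lo : |θ| / Real.pi ≤ |Real.sin (θ / 2)| := by
    have := Real.mul_abs_le_abs_sin (x := θ / 2) (by rw [h2]; linarith)
    rw [h2] at this
    calc |θ| / Real.pi = 2 / Real.pi * (|θ| / 2) := by field_simp
      _ ≤ _ := this
  have hi : |Real.sin (θ / 2)| ≤ |θ| := by
    have := Real.abs_sin_le_abs (x := θ / 2)
    rw [h2] at this
    linarith
  have hlo : 0 < |θ| / Real.pi := by positivity
  rw [← Real.log_abs (Real.sin _), ← Real.log_abs θ]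
  have h3 := Real.log_le_log hlo lo
  have h4 := Real.log_le_log (hlo.trans_le lo) hi
  rw [Real.log_div hθ.ne' hp.ne'] at h3
  have h5 : 0 ≤ Real.log Real.pi := Real.log_nonneg (by linarith [Real.pi_gt_three])
  rw [abs_le]; constructor <;> linarith

/-- The kernel has mass `O(x)` on the near-diagonal region `(0, 2x]`. -/
lemma exists_integral_symmKernel_near_le : ∃ C : ℝ, 0 ≤ C ∧ ∀ x : ℝ, 0 < x → x < 1 →
    ∀ (u : ℝ → ℝ) (B : ℝ), (∀ y, 0 < y → y ≤ 2 * x → |u y| ≤ B) →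
      |∫ y in (0 : ℝ)..2 * x, symmKernel x y * u y| ≤ C * B * x := by
  set g : ℝ → ℝ := fun t => |Real.log (1 - t)| + |Real.log (1 + t)| + 2 * |Real.log t|
    + 4 * Real.log Real.pi with hg
  have hlog : ∀ a b : ℝ, IntervalIntegrable Real.log volume a b :=
    fun a b => intervalIntegrable_log'
  have hgi : ∀ a b : ℝ, IntervalIntegrable g volume a b := by
    intro a b
    have h1 : IntervalIntegrable (fun t => Real.log (1 - t)) volume a b := by
      simpa using (hlog (1 - a) (1 - b)).comp_sub_left 1
    have h2 : IntervalIntegrable (fun t => Real.log (1 + t)) volume a b := by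
      simpa using (hlog (1 + a) (1 + b)).comp_add_left 1
    exact ((h1.abs.add h2.abs).add ((hlog a b).abs.const_mul 2)).add intervalIntegrable_const
  have hlp : 0 ≤ Real.log Real.pi := Real.log_nonneg (by linarith [Real.pi_gt_three])
  refine ⟨∫ t in (0 : ℝ)..2, g t, integral_nonneg (by norm_num) (fun t _ => by positivity), ?_⟩
  intro x hx hx1 u B hB
  have hgx : IntervalIntegrable (fun y => B * g (y / x)) volume 0 (2 * x) := by
    have := (hgi 0 2).comp_mul_left (c := x⁻¹)
    refine IntervalIntegrable.const_mul ?_ B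
    simpa [div_eq_inv_mul, mul_comm] using this
  have hval : ∫ y in (0 : ℝ)..2 * x, B * g (y / x) = (∫ t in (0 : ℝ)..2, g t) * B * x := by
    rw [intervalIntegral.integral_const_mul, integral_comp_div _ hx.ne', zero_div,
      mul_div_assoc, div_self hx.ne', smul_eq_mul]
    ring_nf
  rw [← hval, ← Real.norm_eq_abs]
  refine intervalIntegral.norm_integral_le_of_norm_le (by linarith) ?_ hgx
  have hne : ∀ᵐ y : ℝ, y ≠ x := by simp [ae_iff]
  filter_upwards [hne] with y hyx hy
  have hy0 := hy.1
  have hy2 := hy.2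
  have hB0 := hB y hy0 hy2
  have hpi := Real.pi_gt_three
  have e1 := abs_log_sin_half_sub_log_le (θ := x - y) (sub_ne_zero.2 hyx.symm)
    (by rw [abs_le]; constructor <;> linarith)
  have e2 := abs_log_sin_half_sub_log_le (θ := x + y) (by positivity)
    (by rw [abs_le]; constructor <;> linarith)
  have e3 := abs_log_sin_half_sub_log_le (θ := y) (by positivity)
    (by rw [abs_le]; constructor <;> linarith)
  have hxy : 1 - y / x ≠ 0 := by
    rw [Ne, sub_eq_zero, eq_comm, div_eq_one_iff_eq hx.ne']; exact hyx
  have l1 : Real.log (x - y) = Real.log x + Real.log (1 - y / x) := by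
    rw [← Real.log_mul hx.ne' hxy]; congr 1; field_simp
  have l2 : Real.log (x + y) = Real.log x + Real.log (1 + y / x) := by
    rw [← Real.log_mul hx.ne' (by positivity)]; congr 1; field_simp
  have l3 : Real.log y = Real.log x + Real.log (y / x) := by
    rw [← Real.log_mul hx.ne' (by positivity)]; congr 1; field_simp
  rw [l1] at e1; rw [l2] at e2; rw [l3] at e3
  have hK : |symmKernel x y| ≤ g (y / x) := by
    have a1 := abs_le.1 e1
    have a2 := abs_le.1 e2
    have a3 := abs_le.1 e3
    have b1 := abs_le.1 (le_refl |Real.log (1 - y / x)|)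
    have b2 := abs_le.1 (le_refl |Real.log (1 + y / x)|)
    have b3 := abs_le.1 (le_refl |Real.log (y / x)|)
    simp only [symmKernel, hg]
    rw [abs_le]; constructor <;> linarith [a1.1, a1.2, a2.1, a2.2, a3.1, a3.2]
  rw [Real.norm_eq_abs, abs_mul, mul_comm]
  exact mul_le_mul hB0 hK (abs_nonneg _) ((abs_nonneg _).trans hB0)

/-- Away from the diagonal the kernel is `-(sin(x/2)/sin(y/2))²` up to `O(x⁴/y⁴)`. -/
lemma abs_symmKernel_add_sq_le {x y : ℝ} (hx : 0 < x) (hx1 : x < 1) (hxy : 2 * x ≤ y)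
    (hy : y ≤ Real.pi) :
    |symmKernel x y + (Real.sin (x / 2) / Real.sin (y / 2)) ^ 2| ≤ 32 * x ^ 4 / y ^ 4 := by
  have hpi := Real.pi_gt_three
  have hpi4 := Real.pi_le_four
  have hsx : 0 < Real.sin (x / 2) := Real.sin_pos_of_pos_of_lt_pi (by linarith) (by linarith)
  have hsy : 0 < Real.sin (y / 2) := Real.sin_pos_of_pos_of_lt_pi (by linarith) (by linarith)
  have hy0 : 0 < y := by linarith
  set s := Real.sin (x / 2) / Real.sin (y / 2) with hs
  have hs0 : 0 < s := div_pos hsx hsy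
  have hs2 : s ^ 2 ≤ 1 / 2 := by
    have hc : Real.cos y ≤ Real.cos (2 * x) :=
      Real.cos_le_cos_of_nonneg_of_le_pi (by linarith) hy hxy
    have hc0 : 0 < Real.cos x := Real.cos_pos_of_mem_Ioo ⟨by linarith, by linarith⟩
    have hc1 := Real.cos_le_one x
    rw [Real.cos_two_mul] at hc
    rw [hs, div_pow, div_le_iff₀ (by positivity), Real.sin_sq_eq_half_sub,
      Real.sin_sq_eq_half_sub, mul_div_cancel₀ _ two_ne_zero, mul_div_cancel₀ _ two_ne_zero]
    nlinarith
  have hsle : s ≤ 2 * x / y := by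
    have h1 : Real.sin (x / 2) ≤ x / 2 := Real.sin_le (by linarith)
    have h2 := Real.mul_le_sin (x := y / 2) (by linarith) (by linarith)
    have h3 : y / 4 ≤ 2 / Real.pi * (y / 2) := by
      rw [div_mul_div_comm, div_le_div_iff₀ (by norm_num) (by positivity)]
      nlinarith
    rw [hs, div_le_div_iff₀ hsy hy0]
    nlinarith
  have hK : symmKernel x y = Real.log (1 - s ^ 2) := by
    have hprod : Real.sin ((x - y) / 2) * Real.sin ((x + y) / 2)
        = -(Real.sin (y / 2) ^ 2 * (1 - s ^ 2)) := by
      have : Real.sin (y / 2) ^ 2 * (1 - s ^ 2) = Real.sin (y / 2) ^ 2 - Real.sin (x / 2) ^ 2 := by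
        rw [hs]; field_simp
      rw [this, sub_div, add_div, Real.sin_sub, Real.sin_add]
      nlinarith [Real.sin_sq_add_cos_sq (x / 2), Real.sin_sq_add_cos_sq (y / 2)]
    have hn : Real.sin ((x - y) / 2) * Real.sin ((x + y) / 2) ≠ 0 := by
      rw [hprod, neg_ne_zero]
      have : 0 < 1 - s ^ 2 := by linarith
      positivity
    rw [symmKernel, ← Real.log_mul (left_ne_zero_of_mul hn) (right_ne_zero_of_mul hn), hprod,
      Real.log_neg_eq_log, Real.log_mul (by positivity) (by linarith), Real.log_pow]
    push_cast; ring
  have hl := Real.abs_log_sub_add_sum_range_le (x := s ^ 2)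
    (by rw [abs_of_nonneg (sq_nonneg s)]; linarith) 1
  rw [abs_of_nonneg (sq_nonneg s)] at hl
  simp only [Finset.sum_range_one] at hl
  have h4 : s ^ 4 ≤ (2 * x / y) ^ 4 := by gcongr
  calc |symmKernel x y + s ^ 2| = |(s ^ 2) ^ (0 + 1) / ((0 : ℕ) + 1) + Real.log (1 - s ^ 2)| := by
        rw [hK]; congr 1; push_cast; ring
    _ ≤ (s ^ 2) ^ (1 + 1) / (1 - s ^ 2) := hl
    _ ≤ 2 * s ^ 4 := by
        rw [div_le_iff₀ (by linarith), show (s ^ 2) ^ (1 + 1) = s ^ 4 by ring]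
        nlinarith [mul_nonneg (pow_pos hs0 4).le (sub_nonneg.2 hs2)]
    _ ≤ 2 * (2 * x / y) ^ 4 := by linarith
    _ = 32 * x ^ 4 / y ^ 4 := by ring

/-- A bounded function that is `O(x log x)` at `0+` satisfies `u y = O((x + y)|log x|)`
uniformly in `y`. -/
lemma exists_abs_le_mul_abs_log {u : ℝ → ℝ} {M c : ℝ} (hM : ∀ x, |u x| ≤ M)
    (hu : Tendsto (fun x => u x / (x * Real.log x)) (nhdsWithin 0 (Ioi 0)) (nhds c)) :
    ∃ A : ℝ, 0 ≤ A ∧ ∀ᶠ x in nhdsWithin (0 : ℝ) (Ioi 0), ∀ y, 0 < y →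
      |u y| ≤ A * (x + y) * |Real.log x| := by
  have hM0 : 0 ≤ M := (abs_nonneg _).trans (hM 0)
  have hev : ∀ᶠ y in nhdsWithin (0 : ℝ) (Ioi 0), |u y / (y * Real.log y)| < |c| + 1 :=
    hu.abs.eventually_lt_const (by linarith)
  obtain ⟨δ', hδ', hδu'⟩ := (nhdsGT_basis (0 : ℝ)).eventually_iff.1 hev
  obtain ⟨δ, hδ, hδ1, hδu⟩ : ∃ δ > 0, δ ≤ 1 ∧ ∀ y ∈ Ioo 0 δ,
      |u y / (y * Real.log y)| < |c| + 1 :=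
    ⟨min δ' 1, lt_min hδ' one_pos, min_le_right _ _,
      fun y hy => hδu' ⟨hy.1, hy.2.trans_le (min_le_left _ _)⟩⟩
  refine ⟨|c| + 1 + M / δ, by positivity, ?_⟩
  have hsmall : ∀ᶠ x in nhdsWithin (0 : ℝ) (Ioi 0), x ∈ Ioo 0 (min δ (Real.exp (-1))) :=
    Ioo_mem_nhdsGT (lt_min hδ (Real.exp_pos _))
  filter_upwards [hsmall] with x ⟨hx, hxlt⟩ y hy
  have hxδ : x < δ := hxlt.trans_le (min_le_left _ _)
  have hxe : Real.log x < -1 := (Real.log_lt_iff_lt_exp hx).2 (hxlt.trans_le (min_le_right _ _))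
  have hL : |Real.log x| = -Real.log x := abs_of_neg (by linarith)
  have hL1 : 1 ≤ |Real.log x| := by rw [hL]; linarith
  rcases lt_or_ge y δ with hyδ | hyδ
  · have hly : Real.log y < 0 := Real.log_neg hy (hyδ.trans_le hδ1)
    have h1 := (hδu y ⟨hy, hyδ⟩).le
    rw [abs_div, div_le_iff₀ (abs_pos.2 (mul_neg_of_pos_of_neg hy hly).ne), abs_mul,
      abs_of_pos hy] at h1
    have h2 : y * |Real.log y| ≤ (x + y) * |Real.log x| := by
      rw [abs_of_neg hly, hL]
      rcases le_total x y with h | h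
      · have := Real.log_le_log hx h
        nlinarith
      · have h3 := Real.log_le_sub_one_of_pos (div_pos hx hy)
        rw [Real.log_div hx.ne' hy.ne'] at h3
        have h4 : y * (Real.log x - Real.log y) ≤ x - y := by
          calc y * (Real.log x - Real.log y) ≤ y * (x / y - 1) := by gcongr
            _ = x - y := by field_simp
        nlinarith
    calc |u y| ≤ (|c| + 1) * (y * |Real.log y|) := h1
      _ ≤ (|c| + 1) * ((x + y) * |Real.log x|) := by gcongr
      _ ≤ (|c| + 1 + M / δ) * ((x + y) * |Real.log x|) := by
        have : 0 ≤ M / δ := by positivity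
        refine mul_le_mul_of_nonneg_right (by linarith) (by positivity)
      _ = _ := by ring
  · calc |u y| ≤ M := hM y
      _ = M / δ * δ * 1 := by field_simp
      _ ≤ M / δ * (x + y) * |Real.log x| := by gcongr; linarith
      _ ≤ (|c| + 1 + M / δ) * (x + y) * |Real.log x| := by
        have : 0 ≤ |c| := abs_nonneg c
        gcongr; linarith

/-- If `h y ~ c log y / y` at `0+`, then `∫ y in a..b, h y ~ -(c/2) log² a`. -/
lemma tendsto_integral_div_log_sq {h : ℝ → ℝ} {b c : ℝ} (hb : 0 < b)
    (hi : ∀ a, 0 < a → a ≤ b → IntervalIntegrable h volume a b)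
    (hh : Tendsto (fun y => h y * y / Real.log y) (nhdsWithin 0 (Ioi 0)) (nhds c)) :
    Tendsto (fun a => (∫ y in a..b, h y) / Real.log a ^ 2) (nhdsWithin 0 (Ioi 0))
      (nhds (-c / 2)) := by
  rw [Metric.tendsto_nhds]
  intro ε hε
  obtain ⟨δ', hδ', hδh⟩ := (nhdsGT_basis (0 : ℝ)).eventually_iff.1
    (Metric.tendsto_nhds.1 hh ε hε)
  set δ := min (δ' / 2) (min b (1 / 2)) with hδdef
  have hδ : 0 < δ := by have := hδ'; positivity
  have hδ1 : δ < δ' := (min_le_left _ _).trans_lt (by linarith)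
  have hδ2 : δ < 1 := ((min_le_right _ _).trans (min_le_right _ _)).trans_lt (by norm_num)
  have hδb : δ ≤ b := (min_le_right _ _).trans (min_le_left _ _)
  have hprim : ∀ a, 0 < a → ∫ y in a..δ, Real.log y / y
      = (Real.log δ ^ 2 - Real.log a ^ 2) / 2 := by
    intro a ha
    have hpos : ∀ y ∈ uIcc a δ, 0 < y := fun y hy => (lt_min ha hδ).trans_le hy.1
    rw [integral_eq_sub_of_hasDerivAt (f := fun y => Real.log y ^ 2 / 2)]
    · ring
    · intro y hy
      have := ((Real.hasDerivAt_log (hpos y hy).ne').pow 2).div_const 2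
      exact this.congr_deriv (by push_cast; ring)
    · refine ContinuousOn.intervalIntegrable (ContinuousOn.div ?_ continuousOn_id ?_)
      · exact Real.continuousOn_log.mono (fun y hy => (hpos y hy).ne')
      · exact fun y hy => (hpos y hy).ne'
  set D := |(∫ y in δ..b, h y) + c / 2 * Real.log δ ^ 2| with hD
  have hlog2 : Tendsto (fun a => Real.log a ^ 2) (nhdsWithin 0 (Ioi 0)) atTop := by
    simpa [Function.comp_def] using (tendsto_pow_atTop (α := ℝ) two_ne_zero).comp
      (tendsto_abs_atBot_atTop.comp Real.tendsto_log_nhdsGT_zero)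
  filter_upwards [Ioo_mem_nhdsGT hδ, hlog2.eventually_gt_atTop (4 * D / ε),
    hlog2.eventually_gt_atTop 0] with a ⟨ha, haδ⟩ hbig hpos
  have hlogi : IntervalIntegrable (fun y => Real.log y / y) volume a δ := by
    refine ContinuousOn.intervalIntegrable (ContinuousOn.div ?_ continuousOn_id ?_)
    · refine Real.continuousOn_log.mono (fun y hy => ?_)
      exact ((lt_min ha hδ).trans_le hy.1).ne'
    · exact fun y hy => ((lt_min ha hδ).trans_le hy.1).ne'
  have hia : IntervalIntegrable h volume a δ := (hi a ha (haδ.le.trans hδb)).trans (hi δ hδ hδb).symm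
  have hclose : |∫ y in a..δ, (h y - c * (Real.log y / y))| ≤
      ∫ y in a..δ, -ε * (Real.log y / y) := by
    rw [← Real.norm_eq_abs]
    refine intervalIntegral.norm_integral_le_of_norm_le haδ.le (ae_of_all _ ?_)
      (hlogi.const_mul _)
    intro y hy
    have hy0 : 0 < y := ha.trans hy.1
    have hl : Real.log y < 0 := Real.log_neg hy0 (hy.2.trans_lt hδ2)
    have := hδh ⟨hy0, hy.2.trans_lt hδ1⟩
    rw [Real.dist_eq] at this
    have heq : h y - c * (Real.log y / y) = (h y * y / Real.log y - c) * (Real.log y / y) := by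
      have := hl.ne
      field_simp
    rw [heq, Real.norm_eq_abs, abs_mul, abs_of_neg (div_neg_of_neg_of_pos hl hy0)]
    have : 0 ≤ -(Real.log y / y) := by
      have := div_neg_of_neg_of_pos hl hy0; linarith
    nlinarith
  rw [integral_sub hia (hlogi.const_mul _), intervalIntegral.integral_const_mul,
    intervalIntegral.integral_const_mul, hprim a ha] at hclose
  have hsplit := integral_add_adjacent_intervals hia (hi δ hδ hδb)
  have hDb := abs_le.1 hD.ge
  have hcl := abs_le.1 hclose
  have hbig' : 4 * D < ε * Real.log a ^ 2 := by
    rw [div_lt_iff₀ hε] at hbig; linarith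
  have hmain : |(∫ y in a..b, h y) + c / 2 * Real.log a ^ 2| < ε * Real.log a ^ 2 := by
    rw [← hsplit]
    have hsq : 0 ≤ ε * Real.log δ ^ 2 := by positivity
    rw [abs_lt]; constructor <;> nlinarith [hDb.1, hDb.2, hcl.1, hcl.2]
  rw [Real.dist_eq]
  have : (∫ y in a..b, h y) / Real.log a ^ 2 - -c / 2
      = ((∫ y in a..b, h y) + c / 2 * Real.log a ^ 2) / Real.log a ^ 2 := by
    rw [add_div, mul_div_cancel_right₀ _ hpos.ne']; ring
  rw [this, abs_div, abs_of_pos hpos, div_lt_iff₀ hpos]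
  exact hmain

lemma tendsto_sin_half_div :
    Tendsto (fun x => Real.sin (x / 2) / x) (nhdsWithin 0 (Ioi 0)) (nhds (1 / 2)) := by
  have h : HasDerivAt (fun x : ℝ => Real.sin (x / 2)) (1 / 2) 0 := by
    simpa using ((hasDerivAt_id (0 : ℝ)).div_const 2).sin
  have := h.tendsto_slope.mono_left (nhdsWithin_mono 0 (fun x (hx : 0 < x) => hx.ne'))
  refine this.congr (fun x => ?_)
  simp [slope_def_field]

lemma integral_one_div_cube_le {a b : ℝ} (ha : 0 < a) (hab : a ≤ b) :
    IntervalIntegrable (fun y : ℝ => y ^ (-3 : ℤ)) volume a b ∧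
      ∫ y in a..b, y ^ (-3 : ℤ) ≤ 1 / (2 * a ^ 2) := by
  have h0 : (0 : ℝ) ∉ uIcc a b := by
    rw [uIcc_of_le hab]; exact fun h => absurd h.1 (by linarith)
  refine ⟨intervalIntegrable_zpow (Or.inr h0), ?_⟩
  rw [integral_zpow (Or.inr ⟨by norm_num, h0⟩)]
  have hb : 0 < b := ha.trans_le hab
  have h1 : 0 < (b ^ 2)⁻¹ := by positivity
  have e : ∀ t : ℝ, t ^ ((-3 : ℤ) + 1) = (t ^ 2)⁻¹ := fun t => by
    norm_num [zpow_neg]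
  rw [e, e, one_div, mul_inv]
  norm_num
  linarith

/-- If `u ~ ν x log x` at `0+`, the folded integral is asymptotic to `(ν/2) x² log² x`. -/
lemma tendsto_integral_symmKernel {u : ℝ → ℝ} {M ν : ℝ} (hM : ∀ x, |u x| ≤ M)
    (hmeas : Measurable u)
    (hu : Tendsto (fun x => u x / (x * Real.log x)) (nhdsWithin 0 (Ioi 0)) (nhds ν)) :
    Tendsto (fun x => (∫ y in (0 : ℝ)..Real.pi, symmKernel x y * u y) / (x * Real.log x) ^ 2)
      (nhdsWithin 0 (Ioi 0)) (nhds (ν / 2)) := by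
  have hpi := Real.pi_gt_three
  set G : ℝ → ℝ := fun a => ∫ y in a..Real.pi, u y / Real.sin (y / 2) ^ 2 with hGdef
  have hGi : ∀ a, 0 < a → a ≤ Real.pi → IntervalIntegrable (fun y => u y / Real.sin (y / 2) ^ 2) volume a
      Real.pi := by
    intro a ha hapi
    have hc : IntervalIntegrable (fun y => (Real.sin (y / 2) ^ 2)⁻¹) volume a Real.pi := by
      refine ContinuousOn.intervalIntegrable (ContinuousOn.inv₀ (by fun_prop) (fun y hy => ?_))
      rw [uIcc_of_le hapi] at hy
      exact pow_ne_zero 2 (Real.sin_pos_of_pos_of_lt_pi (by linarith [hy.1])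
        (by linarith [hy.2])).ne'
    refine (hc.mul_bounded_measurable hmeas hM).congr (fun y _ => ?_)
    simp only [div_eq_inv_mul]
  have hpos : ∀ᶠ x in nhdsWithin (0 : ℝ) (Ioi 0), x ∈ Ioo (0 : ℝ) (1 / 2) :=
    Ioo_mem_nhdsGT (by norm_num)
  have hG : Tendsto (fun a => G a / Real.log a ^ 2) (nhdsWithin 0 (Ioi 0))
      (nhds (-(4 * ν) / 2)) := by
    refine tendsto_integral_div_log_sq Real.pi_pos hGi ?_
    have h1 := hu.mul ((tendsto_sin_half_div.inv₀ (by norm_num)).pow 2)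
    rw [show ν * (1 / 2 : ℝ)⁻¹ ^ 2 = 4 * ν by norm_num; ring] at h1
    refine h1.congr' ?_
    filter_upwards [hpos] with y ⟨hy, hy1⟩
    have hs : 0 < Real.sin (y / 2) := Real.sin_pos_of_pos_of_lt_pi (by linarith) (by linarith)
    have hl : Real.log y ≠ 0 := (Real.log_neg hy (by linarith)).ne
    field_simp
  have h2x : Tendsto (fun x : ℝ => 2 * x) (nhdsWithin 0 (Ioi 0)) (nhdsWithin 0 (Ioi 0)) := by
    refine tendsto_nhdsWithin_iff.2 ⟨?_, ?_⟩
    · have : Tendsto (fun x : ℝ => 2 * x) (nhds 0) (nhds (2 * 0)) := tendsto_id.const_mul 2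
      rw [mul_zero] at this
      exact this.mono_left nhdsWithin_le_nhds
    · filter_upwards [self_mem_nhdsWithin] with x hx
      exact mul_pos two_pos (mem_Ioi.1 hx)
  have hloginv : Tendsto (fun x => (Real.log x)⁻¹) (nhdsWithin 0 (Ioi 0)) (nhds 0) :=
    tendsto_inv_atBot_zero.comp Real.tendsto_log_nhdsGT_zero
  have hlogratio : Tendsto (fun x => (Real.log 2 * (Real.log x)⁻¹ + 1) ^ 2)
      (nhdsWithin 0 (Ioi 0)) (nhds 1) := by
    simpa using ((hloginv.const_mul (Real.log 2)).add_const 1).pow 2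
  have hmain : Tendsto (fun x => -(Real.sin (x / 2) / x) ^ 2 *
      (G (2 * x) / Real.log (2 * x) ^ 2 * (Real.log 2 * (Real.log x)⁻¹ + 1) ^ 2))
      (nhdsWithin 0 (Ioi 0)) (nhds (ν / 2)) := by
    have := (tendsto_sin_half_div.pow 2).neg.mul ((hG.comp h2x).mul hlogratio)
    rw [show -(1 / 2 : ℝ) ^ 2 * (-(4 * ν) / 2 * 1) = ν / 2 by ring] at this
    exact this
  obtain ⟨A, hA0, hA⟩ := exists_abs_le_mul_abs_log hM hu
  obtain ⟨C, hC0, hC⟩ := exists_integral_symmKernel_near_le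
  have herr : ∀ᶠ x in nhdsWithin (0 : ℝ) (Ioi 0),
      |(∫ y in (0 : ℝ)..Real.pi, symmKernel x y * u y) + Real.sin (x / 2) ^ 2 * G (2 * x)| ≤
        (3 * C * A + 8 * A) * (x ^ 2 * |Real.log x|) := by
    filter_upwards [hpos, hA] with x ⟨hx, hx1⟩ hAx
    have hKi : ∀ a b, IntervalIntegrable (fun y => symmKernel x y * u y) volume a b :=
      fun a b => (intervalIntegrable_symmKernel x a b).mul_bounded_measurable hmeas hM
    have hnear := hC x hx (by linarith) u (A * (3 * x) * |Real.log x|) (fun y hy hy2 =>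
      (hAx y hy).trans (by gcongr; linarith))
    obtain ⟨hzi, hz⟩ := integral_one_div_cube_le (a := 2 * x) (b := Real.pi) (by positivity)
      (by linarith)
    have hfar : |∫ y in (2 * x)..Real.pi, (symmKernel x y * u y +
        Real.sin (x / 2) ^ 2 * (u y / Real.sin (y / 2) ^ 2))| ≤
        ∫ y in (2 * x)..Real.pi, 64 * A * x ^ 4 * |Real.log x| * y ^ (-3 : ℤ) := by
      rw [← Real.norm_eq_abs]
      refine intervalIntegral.norm_integral_le_of_norm_le (by linarith) (ae_of_all _ ?_)
        (hzi.const_mul _)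
      intro y hy
      have hy0 : 0 < y := lt_trans (by positivity) hy.1
      have hk := abs_symmKernel_add_sq_le hx (by linarith) hy.1.le hy.2
      have hu' : |u y| ≤ A * (2 * y) * |Real.log x| :=
        (hAx y hy0).trans (by gcongr; linarith [hy.1])
      rw [Real.norm_eq_abs, show symmKernel x y * u y + Real.sin (x / 2) ^ 2 *
        (u y / Real.sin (y / 2) ^ 2) = (symmKernel x y +
          (Real.sin (x / 2) / Real.sin (y / 2)) ^ 2) * u y by ring, abs_mul]
      calc _ ≤ 32 * x ^ 4 / y ^ 4 * (A * (2 * y) * |Real.log x|) := by gcongr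
        _ = 64 * A * x ^ 4 * |Real.log x| * y ^ (-3 : ℤ) := by
          rw [zpow_neg]; norm_cast; field_simp; ring
    rw [intervalIntegral.integral_const_mul, integral_add (hKi _ _)
      ((hGi _ (by positivity) (by linarith)).const_mul _), intervalIntegral.integral_const_mul] at hfar
    have hfar2 := hfar.trans (mul_le_mul_of_nonneg_left hz
      (by positivity : 0 ≤ 64 * A * x ^ 4 * |Real.log x|))
    have e1 : 64 * A * x ^ 4 * |Real.log x| * (1 / (2 * (2 * x) ^ 2)) =
        8 * A * (x ^ 2 * |Real.log x|) := by field_simp; ring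
    rw [e1] at hfar2
    rw [← integral_add_adjacent_intervals (hKi 0 (2 * x)) (hKi (2 * x) Real.pi), add_assoc]
    refine (abs_add_le _ _).trans ((add_le_add hnear hfar2).trans (le_of_eq ?_))
    ring
  have herr0 : Tendsto (fun x => ((∫ y in (0 : ℝ)..Real.pi, symmKernel x y * u y)
      + Real.sin (x / 2) ^ 2 * G (2 * x)) / (x * Real.log x) ^ 2) (nhdsWithin 0 (Ioi 0))
      (nhds 0) := by
    refine squeeze_zero_norm' (a := fun x => (3 * C * A + 8 * A) * |(Real.log x)⁻¹|) ?_ ?_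
    · filter_upwards [herr, hpos] with x hx ⟨hx0, hx1⟩
      have hl : 0 < |Real.log x| := abs_pos.2 (Real.log_neg hx0 (by linarith)).ne
      rw [Real.norm_eq_abs, abs_div, abs_of_nonneg (sq_nonneg (x * Real.log x)), mul_pow,
        div_le_iff₀ (by rw [← sq_abs (Real.log x)]; positivity), ← sq_abs (Real.log x), abs_inv]
      refine hx.trans (le_of_eq ?_)
      field_simp
    · simpa using hloginv.abs.const_mul (3 * C * A + 8 * A)
  have := herr0.add hmain
  rw [zero_add] at this
  refine this.congr' ?_
  filter_upwards [hpos] with x ⟨hx, hx1⟩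
  have hl : Real.log x ≠ 0 := (Real.log_neg hx (by linarith)).ne
  have hl2 : Real.log (2 * x) ≠ 0 := (Real.log_neg (by linarith) (by linarith)).ne
  have e : Real.log 2 * (Real.log x)⁻¹ + 1 = Real.log (2 * x) / Real.log x := by
    rw [Real.log_mul two_ne_zero hx.ne']; field_simp
  rw [e]
  generalize Real.log (2 * x) = l at hl2 ⊢
  field_simp
  ring

end

/-- If a bounded, measurable, even, `2π`-periodic `u` solves `(1/2)u² = −H[u]` and
`u(x) = ν|x|log|x| + o(|x|log|x|)` at `0` with `ν ≠ 0`, then `ν = −1/π`. -/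
theorem stmt_4 (u : ℝ → ℝ) (ν : ℝ)
    (hbdd : ∃ M : ℝ, ∀ x, |u x| ≤ M)
    (hmeas : Measurable u)
    (heven : ∀ x, u (-x) = u x)
    (hper : ∀ x, u (x + 2 * Real.pi) = u x)
    (heq : ∀ x : ℝ, (1/2) * u x ^ 2 =
      -(1 / Real.pi) * ∫ y in (-Real.pi)..Real.pi,
        (Real.log |Real.sin ((x - y) / 2)| - Real.log |Real.sin (y / 2)|) * u y)
    (hν : ν ≠ 0)
    (hasymp : Tendsto (fun x : ℝ => (u x - ν * |x| * Real.log |x|) / (|x| * Real.log |x|))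
      (nhdsWithin 0 {0}ᶜ) (nhds 0)) :
    ν = -(1 / Real.pi) := by
  obtain ⟨M, hM⟩ := hbdd
  have hu : Tendsto (fun x => u x / (x * Real.log x)) (nhdsWithin 0 (Set.Ioi 0)) (nhds ν) := by
    have h := (hasymp.mono_left (nhdsWithin_mono 0
      (fun x (hx : 0 < x) => hx.ne'))).add_const ν
    rw [zero_add] at h
    refine h.congr' ?_
    filter_upwards [Ioo_mem_nhdsGT (show (0 : ℝ) < 1 by norm_num)] with x ⟨hx, hx1⟩
    have hl : Real.log x ≠ 0 := (Real.log_neg hx hx1).ne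
    rw [abs_of_pos hx]
    field_simp
    ring
  have hlim := (tendsto_integral_symmKernel hM hmeas hu).const_mul (-(1 / Real.pi))
  have hlim' := (hu.pow 2).const_mul (1 / 2)
  have hν2 : 1 / 2 * ν ^ 2 = -(1 / Real.pi) * (ν / 2) := by
    refine tendsto_nhds_unique hlim' (hlim.congr (fun x => ?_))
    rw [← integral_log_sin_mul_even hM hmeas heven, ← mul_div_assoc, ← heq, div_pow]
    ring
  refine mul_left_cancel₀ hν ?_
  linarith
end
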